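/- arXiv:1304.5342 — 2 statements merged into one kernel-verified Lean document; each statement's English description precedes it below -/
import Mathlib

section
/- Let G be a connected finite simple graph with N_G ≥ 5 edges and h_G ≤ N_G/2 independent cycles, and suppose Dⁿ is obtained by a denominator reduction of G after n < N_G steps with respect to some edge ordering. Then for every prime power q, [X_G]_q ≡ (−1)ⁿ q² [Dⁿ]_q (mod q³); that is, c2(G)_q ≡ (−1)ⁿ [Dⁿ]_q (mod q). -/
open scoped Classical
open Matrix

/-- The graph polynomial (Kirchhoff polynomial) of a finite simple graph `G`:
`Ψ_G = Σ_T Π_{e ∉ T} x_e`, summed over spanning trees `T` of `G`. -/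
noncomputable def graphPoly {V : Type*} [Fintype V] (G : SimpleGraph V) :
    MvPolynomial G.edgeSet ℤ :=
  letI : Fintype G.edgeSet := Fintype.ofFinite _
  ∑ T : Finset G.edgeSet,
    if (SimpleGraph.fromEdgeSet (Subtype.val '' (T : Set G.edgeSet))).IsTree then
      ∏ e ∈ Tᶜ, MvPolynomial.X e
    else 0

/-- `[X_G]_q`: the number of points `x ∈ K^{E(G)}` with `Ψ_G(x) = 0`. -/
noncomputable def Xcount {V : Type*} [Fintype V] (G : SimpleGraph V)
    (K : Type*) [CommRing K] : ℕ :=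
  Nat.card {x : G.edgeSet → K // MvPolynomial.aeval x (graphPoly G) = 0}

/-- `(src, tgt)` is an orientation of the edges of `G`. -/
def IsOrientation {V : Type*} (G : SimpleGraph V) (src tgt : G.edgeSet → V) : Prop :=
  ∀ e : G.edgeSet, (e : Sym2 V) = s(src e, tgt e)

/-- The matrix `M_G` (with the variables of edges in `K` set to `0`), edges enumerated
by `Fin N`, rows/columns of the vertex block indexed by the vertices other than `v₀`. -/
noncomputable def MGmatrix {V : Type*} {N : ℕ} (G : SimpleGraph V)
    (ε : Fin N ≃ G.edgeSet) (src tgt : G.edgeSet → V) (v₀ : V) (K : Finset (Fin N)) :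
    Matrix (Fin N ⊕ {u : V // u ≠ v₀}) (Fin N ⊕ {u : V // u ≠ v₀})
      (MvPolynomial (Fin N) ℤ) :=
  Matrix.fromBlocks
    (Matrix.diagonal fun i => if i ∈ K then 0 else MvPolynomial.X i)
    (Matrix.of fun i (w : {u : V // u ≠ v₀}) =>
      if src (ε i) = ↑w then 1 else if tgt (ε i) = ↑w then -1 else 0)
    (-(Matrix.of fun i (w : {u : V // u ≠ v₀}) =>
      if src (ε i) = ↑w then 1 else if tgt (ε i) = ↑w then -1 else 0)ᵀ)
    0

/-- The determinant of the minor of `M` obtained by deleting the rows indexed by `I`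
and the columns indexed by `J` (rows and columns taken in increasing order). -/
noncomputable def minorDet {R : Type*} [CommRing R] {N : ℕ} {W' : Type*}
    [Fintype W'] [DecidableEq W']
    (M : Matrix (Fin N ⊕ W') (Fin N ⊕ W') R) (I J : Finset (Fin N)) : R :=
  if h : (Jᶜ : Finset (Fin N)).card = (Iᶜ : Finset (Fin N)).card then
    Matrix.det (Matrix.of
      fun (r c : Fin (Iᶜ : Finset (Fin N)).card ⊕ W') =>
        M (Sum.map (fun i => ((Iᶜ.orderIsoOfFin rfl i : {x // x ∈ (Iᶜ : Finset (Fin N))}) : Fin N)) id r)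
          (Sum.map (fun j => ((Jᶜ.orderIsoOfFin h j : {x // x ∈ (Jᶜ : Finset (Fin N))}) : Fin N)) id c))
  else 0

/-- The Dodgson polynomial `Ψ^{I,J}_{G,K} = det M_G(I,J)_K`. -/
noncomputable def dodgson {V : Type*} [Fintype V] [DecidableEq V] {N : ℕ}
    (G : SimpleGraph V) (ε : Fin N ≃ G.edgeSet) (src tgt : G.edgeSet → V) (v₀ : V)
    (I J K : Finset (Fin N)) : MvPolynomial (Fin N) ℤ :=
  minorDet (MGmatrix G ε src tgt v₀ K) I J

/-- The five-invariant `⁵Ψ_G(i,j,k,l,m)`. -/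
noncomputable def fiveInv {V : Type*} [Fintype V] [DecidableEq V] {N : ℕ}
    (G : SimpleGraph V) (ε : Fin N ≃ G.edgeSet) (src tgt : G.edgeSet → V) (v₀ : V)
    (i j k l m : Fin N) : MvPolynomial (Fin N) ℤ :=
  Matrix.det
    !![dodgson G ε src tgt v₀ {i, j} {k, l} {m},
        dodgson G ε src tgt v₀ {i, k} {j, l} {m};
       dodgson G ε src tgt v₀ {i, j, m} {k, l, m} ∅,
        dodgson G ε src tgt v₀ {i, k, m} {j, l, m} ∅]

/-- `D : ℕ → _` is a denominator reduction for `G` of length `n` with respect to the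
edge ordering `ε` (so `e_{k+1}` carries the variable indexed by `k : Fin N`). -/
def IsDenomReduction {V : Type*} [Fintype V] [DecidableEq V] {N : ℕ}
    (G : SimpleGraph V) (ε : Fin N ≃ G.edgeSet) (src tgt : G.edgeSet → V) (v₀ : V)
    (n : ℕ) (D : ℕ → MvPolynomial (Fin N) ℤ) : Prop :=
  5 ≤ n ∧ n ≤ N ∧
  (∃ h5 : 5 ≤ N,
    D 5 = fiveInv G ε src tgt v₀ ⟨0, by omega⟩ ⟨1, by omega⟩ ⟨2, by omega⟩
        ⟨3, by omega⟩ ⟨4, by omega⟩ ∨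
    D 5 = - fiveInv G ε src tgt v₀ ⟨0, by omega⟩ ⟨1, by omega⟩ ⟨2, by omega⟩
        ⟨3, by omega⟩ ⟨4, by omega⟩) ∧
  (∀ k, 5 ≤ k → k ≤ n → ∀ i ∈ (D k).vars, k ≤ (i : ℕ)) ∧
  ∀ k, 5 ≤ k → k < n →
    ∃ (hk : k < N) (a b c d : MvPolynomial (Fin N) ℤ),
      (⟨k, hk⟩ : Fin N) ∉ a.vars ∧ (⟨k, hk⟩ : Fin N) ∉ b.vars ∧
      (⟨k, hk⟩ : Fin N) ∉ c.vars ∧ (⟨k, hk⟩ : Fin N) ∉ d.vars ∧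
      D k = (a * MvPolynomial.X ⟨k, hk⟩ + b) * (c * MvPolynomial.X ⟨k, hk⟩ + d) ∧
      (D (k + 1) = a * d - b * c ∨ D (k + 1) = -(a * d - b * c))

/-- `[Dⁿ]_q`: the number of zeros of `P` in `K^{N-n}`, where `P` is a polynomial in the
variables indexed by `{i : Fin N // n ≤ i}`. -/
noncomputable def restrictedCount {N : ℕ} (P : MvPolynomial (Fin N) ℤ) (n : ℕ)
    (K : Type*) [CommRing K] : ℕ :=
  Nat.card {y : {i : Fin N // n ≤ (i : ℕ)} → K //
    MvPolynomial.aeval (fun i : Fin N => if h : n ≤ (i : ℕ) then y ⟨i, h⟩ else 0) P = 0}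

namespace AxK

lemma kappa_exists (p f : ℕ) [NeZero f] (hp : 1 < p) (k : ℕ) :
    ∃ κ : ZMod f → ℕ, (∀ t, κ t ≡ p ^ t.val * k [MOD (p ^ f - 1)]) ∧
      (k = 0 → ∀ t, κ t = 0) ∧ (0 < k → ∀ t, 0 < κ t) ∧
      (p - 1) * ∑ t, κ t = (Nat.digits p k).sum * (p ^ f - 1) := by
  have hf : 0 < f := Nat.pos_of_ne_zero (NeZero.ne f)
  have hpf : 1 ≤ p ^ f := Nat.one_le_pow _ _ (by omega)
  have hgeom : (p - 1) * ∑ t : ZMod f, p ^ t.val = p ^ f - 1 := by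
    obtain ⟨g, rfl⟩ : ∃ g, f = g + 1 := ⟨f - 1, by omega⟩
    have h1 : ∑ t : ZMod (g + 1), p ^ t.val = ∑ i ∈ Finset.range (g + 1), p ^ i := by
      rw [Finset.sum_range]; rfl
    rw [h1]
    have := Nat.geomSum_eq (m := p) (by omega) (g + 1)
    have h2 := Nat.pred_mul_geom_sum_le 1 1 1
    have h3 : (∑ i ∈ Finset.range (g+1), (p : ℤ) ^ i) * (p - 1) = (p : ℤ) ^ (g+1) - 1 :=
      geom_sum_mul _ _
    zify [hpf, hp.le]
    push_cast
    linarith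
  have hshift : ∀ t : ZMod f, p * p ^ t.val ≡ p ^ (t + 1).val [MOD (p ^ f - 1)] := by
    intro t
    rcases lt_or_ge (t.val + 1) f with h | h
    · have hv : (t + 1).val = t.val + 1 := by
        have h1 : (t + 1) = ((t.val + 1 : ℕ) : ZMod f) := by
          push_cast; rw [ZMod.natCast_zmod_val]
        rw [h1, ZMod.val_natCast, Nat.mod_eq_of_lt h]
      rw [hv, pow_succ, mul_comm]
    · have hv' : t.val + 1 = f := le_antisymm (ZMod.val_lt t) h
      have hv : (t + 1) = 0 := by
        have h1 : (t + 1) = ((t.val + 1 : ℕ) : ZMod f) := by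
          push_cast; rw [ZMod.natCast_zmod_val]
        rw [h1, hv', ZMod.natCast_self]
      rw [hv, ZMod.val_zero, pow_zero, ← pow_succ', hv']
      exact ((Nat.modEq_iff_dvd' hpf).2 dvd_rfl).symm
  induction k using Nat.strong_induction_on with
  | _ k ih =>
    rcases Nat.eq_zero_or_pos k with rfl | hk
    · exact ⟨fun _ => 0, by simp [Nat.ModEq], by simp, by simp, by simp⟩
    · obtain ⟨κ, h1, h2, h3, h4⟩ := ih (k / p) (Nat.div_lt_self hk hp)
      refine ⟨fun t => (k % p) * p ^ t.val + κ (t + 1), ?_, ?_, ?_, ?_⟩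
      · intro t
        have e : p ^ t.val * k = (k % p) * p ^ t.val + (p * p ^ t.val) * (k / p) := by
          conv_lhs => rw [← Nat.mod_add_div k p]
          ring
        rw [e]
        refine Nat.ModEq.add_left _ ((h1 (t + 1)).trans ?_)
        exact (hshift t).symm.mul_right _
      · omega
      · intro _ t
        rcases Nat.eq_zero_or_pos (k / p) with h | h
        · have : k % p = k := by
            have := Nat.mod_add_div k p; rw [h] at this; simpa using this
          rw [this]; positivity
        · have := h3 h (t + 1); positivity
      · rw [Nat.digits_def' hp hk, Finset.sum_add_distrib, ← Finset.mul_sum]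
        have e : ∑ t : ZMod f, κ (t + 1) = ∑ t, κ t :=
          Equiv.sum_comp (Equiv.addRight (1 : ZMod f)) κ
        rw [e, mul_add, h4, List.sum_cons, add_mul, ← hgeom]
        ring

lemma digits_sum_pow_sub_one (p f : ℕ) (hp : 1 < p) :
    (Nat.digits p (p ^ f - 1)).sum = f * (p - 1) := by
  induction f with
  | zero => simp
  | succ f ih =>
    have hpf : 1 ≤ p ^ f := Nat.one_le_pow _ _ (by omega)
    obtain ⟨a, ha⟩ : ∃ a, p ^ f = a + 1 := ⟨p ^ f - 1, by omega⟩
    obtain ⟨c, rfl⟩ : ∃ c, p = c + 1 := ⟨p - 1, by omega⟩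
    have e : (c + 1) ^ (f + 1) - 1 = c + (c + 1) * a := by
      rw [pow_succ, ha]; simp only [add_mul, mul_add]; ring_nf; omega
    have hd := Nat.digits_add (c + 1) hp c a (by omega) (Or.inl (by omega))
    rw [e, hd, List.sum_cons]
    rw [ha] at ih
    simp only [Nat.add_sub_cancel] at ih ⊢
    rw [ih]; ring

/-- Combinatorial heart: digit sums. -/
lemma digit_bound {ι σ : Type*} [Fintype σ] (s : Finset ι) (u : ι → σ → ℕ) (p f : ℕ) [NeZero f]
    (hp : 1 < p) (d c : ℕ) (hu : ∀ i ∈ s, ∑ j, u i j ≤ d) (k : ι → ℕ)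
    (hk : p ^ f - 1 ∣ ∑ i ∈ s, k i)
    (hj : ∀ j, p ^ f - 1 ∣ ∑ i ∈ s, k i * u i j) 
    (hZ : d * c < (Finset.univ.filter fun j => ∑ i ∈ s, k i * u i j ≠ 0).card) :
    f * (p - 1) * (c + 1) ≤ ∑ i ∈ s, (Nat.digits p (k i)).sum := by
  choose κ h1 h2 h3 h4 using fun i => kappa_exists p f hp (k i)
  have hf : 0 < f := Nat.pos_of_ne_zero (NeZero.ne f)
  have hq : 0 < p ^ f - 1 := by
    have := Nat.one_lt_pow hf.ne' hp; omega
  set Q := p ^ f - 1 with hQ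
  have key : ∀ t : ZMod f, Q * (c + 1) ≤ ∑ i ∈ s, κ i t := by
    intro t
    have hdiv : Q ∣ ∑ i ∈ s, κ i t := by
      rw [← Nat.modEq_zero_iff_dvd]
      have : ∑ i ∈ s, κ i t ≡ ∑ i ∈ s, p ^ t.val * k i [MOD Q] := by
        have := fun i (_ : i ∈ s) => h1 i t
        simp only [← ZMod.natCast_eq_natCast_iff] at this ⊢
        push_cast
        push_cast at this
        exact Finset.sum_congr rfl this
      refine this.trans ?_
      rw [← Finset.mul_sum, Nat.modEq_zero_iff_dvd]
      exact hk.mul_left _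
    have hdivj : ∀ j, Q ∣ ∑ i ∈ s, κ i t * u i j := by
      intro j
      rw [← Nat.modEq_zero_iff_dvd]
      have : ∑ i ∈ s, κ i t * u i j ≡ ∑ i ∈ s, p ^ t.val * (k i * u i j) [MOD Q] := by
        have := fun i (_ : i ∈ s) => (h1 i t).mul_right (u i j)
        simp only [← ZMod.natCast_eq_natCast_iff] at this ⊢
        push_cast
        push_cast at this
        simp only [← mul_assoc]
        exact Finset.sum_congr rfl this
      refine this.trans ?_
      rw [← Finset.mul_sum, Nat.modEq_zero_iff_dvd]
      exact (hj j).mul_left _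
    have hpos : ∀ j, ∑ i ∈ s, k i * u i j ≠ 0 → Q ≤ ∑ i ∈ s, κ i t * u i j := by
      intro j hjn
      refine Nat.le_of_dvd ?_ (hdivj j)
      obtain ⟨i, his, hi⟩ := Finset.exists_ne_zero_of_sum_ne_zero hjn
      refine lt_of_lt_of_le ?_ (Finset.single_le_sum (f := fun i => κ i t * u i j)
        (fun _ _ => Nat.zero_le _) his)
      have hk0 : 0 < k i := Nat.pos_of_ne_zero (left_ne_zero_of_mul hi)
      exact Nat.mul_pos (h3 i hk0 t) (Nat.pos_of_ne_zero (right_ne_zero_of_mul hi))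
    obtain ⟨m, hm⟩ := hdiv
    have hle : (Finset.univ.filter fun j => ∑ i ∈ s, k i * u i j ≠ 0).card * Q ≤ d * (Q * m) := by
      rw [← hm]
      calc _ ≤ ∑ j ∈ Finset.univ.filter (fun j => ∑ i ∈ s, k i * u i j ≠ 0), 
            ∑ i ∈ s, κ i t * u i j := by
              rw [← smul_eq_mul]
              exact Finset.card_nsmul_le_sum _ _ _ (fun j hj => hpos j (by simpa using hj))
        _ ≤ ∑ j, ∑ i ∈ s, κ i t * u i j := Finset.sum_le_sum_of_subset (Finset.filter_subset _ _)
        _ = ∑ i ∈ s, κ i t * ∑ j, u i j := by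
              rw [Finset.sum_comm]; simp only [Finset.mul_sum]
        _ ≤ ∑ i ∈ s, κ i t * d := Finset.sum_le_sum fun i hi => Nat.mul_le_mul_left _ (hu i hi)
        _ = _ := by rw [← Finset.sum_mul, mul_comm]
    have : d * c < d * m := by
      by_contra hcon
      have h5 : d * (Q * m) ≤ d * c * Q := by nlinarith
      have := (Nat.mul_lt_mul_right hq).2 hZ
      omega
    have : c < m := Nat.lt_of_mul_lt_mul_left this
    rw [hm]
    exact Nat.mul_le_mul_left _ this
  have tot : (p - 1) * ∑ t : ZMod f, ∑ i ∈ s, κ i t = (∑ i ∈ s, (Nat.digits p (k i)).sum) * Q := by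
    rw [Finset.sum_comm, Finset.mul_sum, Finset.sum_mul]
    exact Finset.sum_congr rfl fun i _ => h4 i
  have : f * (Q * (c + 1)) ≤ ∑ t : ZMod f, ∑ i ∈ s, κ i t := by
    have := Finset.card_nsmul_le_sum (Finset.univ : Finset (ZMod f)) (fun t => ∑ i ∈ s, κ i t) _
      (fun t _ => key t)
    simpa [ZMod.card] using this
  refine Nat.le_of_mul_le_mul_right ?_ hq
  rw [← tot]
  calc _ = (p - 1) * (f * (Q * (c + 1))) := by ring
    _ ≤ _ := Nat.mul_le_mul_left _ this

end AxK

namespace AxK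

lemma padic_prod_factorial {ι : Type*} (p : ℕ) [Fact p.Prime] (s : Finset ι) (k : ι → ℕ) :
    (p - 1) * padicValNat p (∏ i ∈ s, (k i).factorial) + ∑ i ∈ s, (Nat.digits p (k i)).sum
      = ∑ i ∈ s, k i := by
  classical
  induction s using Finset.induction_on with
  | empty => simp
  | insert a s ha ih =>
    rw [Finset.prod_insert ha, Finset.sum_insert ha, Finset.sum_insert ha,
      padicValNat.mul (Nat.factorial_ne_zero _)
        (Finset.prod_ne_zero_iff.2 fun i _ => Nat.factorial_ne_zero _), mul_add,
      sub_one_mul_padicValNat_factorial, ← ih]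
    have := Nat.digit_sum_le p (k a)
    omega

lemma multinomial_dvd {ι : Type*} (p : ℕ) [hp : Fact p.Prime] (s : Finset ι) (k : ι → ℕ)
    (f B c : ℕ) (hM : ∑ i ∈ s, k i = p ^ B * (p ^ f - 1)) (hf : 0 < f)
    (h : f * (p - 1) * (c + 1) ≤ ∑ i ∈ s, (Nat.digits p (k i)).sum) :
    p ^ (f * c) ∣ Nat.multinomial s k := by
  have hp1 := hp.out.one_lt
  have h1 := padic_prod_factorial p s k
  have h2 := sub_one_mul_padicValNat_factorial (p := p) (∑ i ∈ s, k i)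
  have h3 := Nat.digit_sum_le p (∑ i ∈ s, k i)
  have hsM : (Nat.digits p (∑ i ∈ s, k i)).sum = f * (p - 1) := by
    have : 0 < p ^ f - 1 := by have := Nat.one_lt_pow hf.ne' hp1; omega
    rw [hM, Nat.digits_base_pow_mul hp1 this, List.sum_append, digits_sum_pow_sub_one p f hp1]
    simp
  have h0 : Nat.multinomial s k ≠ 0 := (Nat.multinomial_pos s k).ne'
  rw [padicValNat_dvd_iff_le h0]
  rw [← Nat.multinomial_spec, padicValNat.mul
        (Finset.prod_ne_zero_iff.2 fun i _ => Nat.factorial_ne_zero _) h0, mul_add] at h2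
  rw [hsM] at h2 h3
  have h4 : f * (p - 1) * c ≤ (p - 1) * padicValNat p (Nat.multinomial s k) := by
    rw [mul_add, mul_one] at h
    omega
  refine Nat.le_of_mul_le_mul_left (c := p - 1) ?_ (by omega)
  calc _ = f * (p - 1) * c := by ring
    _ ≤ _ := h4

open WittVector in
lemma teich_sum {p : ℕ} [hp : Fact p.Prime] {K : Type} [Field K] [Fintype K] [CharP K p] (m : ℕ) :
    (∑ t : K, (teichmuller p t) ^ m = 0) ∨
    (Fintype.card K - 1 ∣ m ∧ (m = 0 → ∑ t : K, (teichmuller p t) ^ m = (Fintype.card K : WittVector p K))) := by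
  classical
  by_cases hm : Fintype.card K - 1 ∣ m
  · right
    refine ⟨hm, ?_⟩
    rintro rfl
    simp
  · left
    have : ∃ g : Kˣ, g ^ m ≠ 1 := by
      by_contra hcon
      push Not at hcon
      apply hm
      have := Monoid.exponent_dvd_of_forall_pow_eq_one hcon
      rwa [IsCyclic.exponent_eq_card, Nat.card_eq_fintype_card, Fintype.card_units] at this
    obtain ⟨g, hg⟩ := this
    have h1 : ∑ t : K, (teichmuller p t) ^ m = (teichmuller p (g : K)) ^ m * ∑ t : K, (teichmuller p t) ^ m := by
      conv_lhs => rw [← Equiv.sum_comp (Units.mulLeft g)]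
      rw [Finset.mul_sum]
      refine Finset.sum_congr rfl fun t _ => ?_
      simp [mul_pow]
    have h2 : (teichmuller p (g : K)) ^ m ≠ 1 := by
      intro h
      apply hg
      have := congrArg (fun x : WittVector p K => x.coeff 0) h
      simp only [← map_pow, teichmuller_coeff_zero, WittVector.one_coeff_zero] at this
      exact Units.ext (by simpa using this)
    have h3 : ((teichmuller p (g : K)) ^ m - 1) * ∑ t : K, (teichmuller p t) ^ m = 0 := by
      rw [sub_mul, one_mul, ← h1, sub_self]
    exact (mul_eq_zero.1 h3).resolve_left (sub_ne_zero.2 h2)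

open WittVector in
lemma witt_dvd_nat {p : ℕ} [hp : Fact p.Prime] {K : Type} [Field K] [CharP K p] [PerfectRing K p]
    (B m : ℕ) (h : (p : WittVector p K) ^ B ∣ (m : WittVector p K)) : p ^ B ∣ m := by
  induction B generalizing m with
  | zero => simp
  | succ B ih =>
    have hpm : p ∣ m := by
      have : (p : WittVector p K) ∣ (m : WittVector p K) := (dvd_pow_self _ (Nat.succ_ne_zero B)).trans h
      rw [← Ideal.mem_span_singleton, mem_span_p_iff_coeff_zero_eq_zero] at this
      have h2 : constantCoeff (m : WittVector p K) = 0 := this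
      rw [map_natCast] at h2
      exact (CharP.cast_eq_zero_iff K p m).1 h2
    obtain ⟨m', rfl⟩ := hpm
    rw [pow_succ']
    refine Nat.mul_dvd_mul_left p (ih m' ?_)
    rw [pow_succ', Nat.cast_mul] at h
    exact (mul_dvd_mul_iff_left (WittVector.p_nonzero p K)).1 h

open WittVector in
theorem ax0 {σ : Type*} [Fintype σ] [DecidableEq σ] {K : Type} [Field K] [Fintype K] [DecidableEq K]
    (P : MvPolynomial σ K) (d b : ℕ) (hd : P.totalDegree ≤ d) (hd1 : 1 ≤ d)
    (h : d * b < Fintype.card σ) :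
    (Fintype.card K) ^ b ∣ (Finset.univ.filter fun x : σ → K => MvPolynomial.eval x P = 0).card := by
  obtain ⟨p, hchar⟩ := CharP.exists K
  obtain ⟨f, hprime, hcard⟩ := FiniteField.card K p
  have : Fact p.Prime := ⟨hprime⟩
  have hf : 0 < (f : ℕ) := f.pos
  obtain ⟨f, hf'⟩ : ∃ f' : ℕ, f' = f := ⟨f, rfl⟩
  rw [← hf'] at hcard hf
  clear hf'
  have : NeZero f := ⟨hf.ne'⟩
  have hp1 := hprime.one_lt
  set q := Fintype.card K with hq
  have hq1 : 1 < q := hcard ▸ Nat.one_lt_pow hf.ne' hp1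
  set B := f * b with hB
  set M := p ^ B * (p ^ f - 1) with hM
  let F : (σ → K) → WittVector p K := fun x =>
    ∑ u ∈ P.support, teichmuller p (P.coeff u) * ∏ j, teichmuller p (x j) ^ (u j)
  have hF0 : ∀ x, constantCoeff (F x) = MvPolynomial.eval x P := by
    intro x
    have hc : ∀ r : K, constantCoeff (teichmuller p r) = r := fun r => teichmuller_coeff_zero p r
    simp only [F, map_sum, map_mul, map_prod, map_pow, hc, MvPolynomial.eval_eq']
  have hkerp : ∀ y : WittVector p K, constantCoeff y = 0 → (p : WittVector p K) ∣ y := by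
    intro y hy
    rw [← Ideal.mem_span_singleton, mem_span_p_iff_coeff_zero_eq_zero]
    exact hy
  -- indicator
  have hind : ∀ x, (p : WittVector p K) ^ B ∣ F x ^ M - (if MvPolynomial.eval x P = 0 then 0 else 1) := by
    intro x
    split_ifs with hx
    · rw [sub_zero]
      have h1 : (p : WittVector p K) ∣ F x := hkerp _ (by rw [hF0, hx])
      refine (pow_dvd_pow_of_dvd h1 B).trans (pow_dvd_pow _ ?_)
      have : B < p ^ B := Nat.lt_pow_self hp1
      rw [hM, ← hcard]
      nlinarith [Nat.le_mul_of_pos_right (p ^ B) (by omega : 0 < q - 1)]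
    · have h1 : (p : WittVector p K) ∣ F x ^ (p ^ f - 1) - 1 := by
        apply hkerp
        rw [map_sub, map_pow, hF0, map_one, ← hcard, FiniteField.pow_card_sub_one_eq_one _ hx, sub_self]
      have h2 := dvd_sub_pow_of_dvd_sub h1 B
      rw [one_pow, ← pow_mul, mul_comm (p ^ f - 1)] at h2
      exact (pow_dvd_pow _ (Nat.le_succ B)).trans h2
  have hsum : (p : WittVector p K) ^ B ∣ ∑ x, F x ^ M := by
    have hexp : ∑ x, F x ^ M = ∑ k ∈ P.support.piAntidiag M,
        ((Nat.multinomial P.support k : WittVector p K) * ∏ u ∈ P.support, teichmuller p (P.coeff u) ^ k u) *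
          ∏ j : σ, ∑ t : K, teichmuller p t ^ (∑ u ∈ P.support, k u * u j) := by
      simp only [F, Finset.sum_pow_eq_sum_piAntidiag]
      rw [Finset.sum_comm]
      refine Finset.sum_congr rfl fun k _ => ?_
      rw [Finset.prod_univ_sum, Fintype.piFinset_univ, Finset.mul_sum]
      refine Finset.sum_congr rfl fun x _ => ?_
      rw [mul_assoc]
      congr 1
      simp only [mul_pow, Finset.prod_mul_distrib]
      congr 1
      simp only [← Finset.prod_pow]
      rw [Finset.prod_comm]
      refine Finset.prod_congr rfl fun j _ => ?_
      rw [← Finset.prod_pow_eq_pow_sum]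
      refine Finset.prod_congr rfl fun u _ => ?_
      rw [← pow_mul, mul_comm]
    rw [hexp]
    refine Finset.dvd_sum fun k hk => ?_
    rw [Finset.mem_piAntidiag] at hk
    by_cases hz : ∃ j, ∑ t : K, teichmuller p t ^ (∑ u ∈ P.support, k u * u j) = 0
    · obtain ⟨j, hj⟩ := hz
      rw [Finset.prod_eq_zero (Finset.mem_univ j) hj, mul_zero]
      exact dvd_zero _
    push Not at hz
    have hdv := fun j => (teich_sum (p := p) (K := K) (∑ u ∈ P.support, k u * u j)).resolve_left (hz j)
    set Z := Finset.univ.filter fun j : σ => ∑ u ∈ P.support, k u * u j = 0 with hZ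
    have hprod : (p : WittVector p K) ^ (f * Z.card) ∣ ∏ j : σ, ∑ t : K, teichmuller p t ^ (∑ u ∈ P.support, k u * u j) := by
      refine dvd_trans ?_ (Finset.prod_dvd_prod_of_subset Z _ _ (Finset.subset_univ _))
      rw [Finset.prod_congr rfl (fun j hj => (hdv j).2 (by simpa [hZ] using hj)), Finset.prod_const,
        ← hq, hcard, pow_mul]
      push_cast
      exact dvd_rfl
    rcases le_or_gt b Z.card with hb | hb
    · refine Dvd.dvd.mul_left (dvd_trans (pow_dvd_pow _ ?_) hprod) _
      exact Nat.mul_le_mul_left _ hb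
    · obtain ⟨c, rfl⟩ : ∃ c, b = Z.card + c := ⟨b - Z.card, by omega⟩
      have hmul : p ^ (f * c) ∣ Nat.multinomial P.support k := by
        refine multinomial_dvd p _ _ f B c hk.1 hf ?_
        refine digit_bound P.support (fun u j => u j) p f hp1 d c ?_ k ?_ ?_ ?_
        · intro u hu
          have := MvPolynomial.le_totalDegree hu
          rw [Finsupp.sum_fintype _ _ (fun _ => rfl)] at this
          exact this.trans hd
        · rw [hk.1]; exact Dvd.intro_left _ rfl
        · intro j; rw [← hcard]; exact (hdv j).1
        · have := Finset.card_filter_add_card_filter_not (s := (Finset.univ : Finset σ))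
            (fun j : σ => ∑ u ∈ P.support, k u * u j = 0)
          rw [Finset.card_univ] at this
          simp only [← ne_eq] at this
          have hzd : Z.card ≤ d * Z.card := Nat.le_mul_of_pos_left _ hd1
          rw [mul_add] at h
          simp only [← hZ] at this
          omega
      rw [hB, mul_add, pow_add, mul_comm]
      refine mul_dvd_mul (Dvd.dvd.mul_right ?_ _) hprod
      have := Nat.cast_dvd_cast (α := WittVector p K) hmul
      simpa using this
  have hnz : (p : WittVector p K) ^ B ∣ ((Finset.univ.filter fun x : σ → K => ¬ MvPolynomial.eval x P = 0).card : WittVector p K) := by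
    have h1 : (p : WittVector p K) ^ B ∣ ∑ x, F x ^ M - ∑ x, (if MvPolynomial.eval x P = 0 then 0 else 1) := by
      rw [← Finset.sum_sub_distrib]
      exact Finset.dvd_sum fun x _ => hind x
    have h2 := (dvd_sub_right hsum).1 h1
    rw [Finset.card_filter]
    push_cast
    simpa only [ite_not] using h2
  have h3 := witt_dvd_nat _ _ hnz
  rw [hB, pow_mul, ← hcard] at h3
  have h4 := Finset.card_filter_add_card_filter_not (s := (Finset.univ : Finset (σ → K)))
            (fun x : σ → K => MvPolynomial.eval x P = 0)
  have h5 : q ^ b ∣ (Finset.univ : Finset (σ → K)).card := by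
    rw [Finset.card_univ, Fintype.card_fun]
    refine pow_dvd_pow _ ?_
    nlinarith
  rw [← h4] at h5
  exact (Nat.dvd_add_left h3).1 h5

end AxK

namespace AxK
set_option linter.unusedSectionVars false

variable {E K : Type} [Fintype E] [DecidableEq E] [Field K] [Fintype K]

/-- number of points of the coordinate subspace `x_e = 0 (e ∈ F)` satisfying `P`. -/
noncomputable def cnt (F : Finset E) (P : (E → K) → Prop) : ℤ :=
  ∑ x : E → K, if (∀ e ∈ F, x e = 0) ∧ P x then 1 else 0

def IsPolyDeg (d : ℕ) (f : (E → K) → K) : Prop :=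
  ∃ p : MvPolynomial E K, p.totalDegree ≤ d ∧ ∀ x, MvPolynomial.eval x p = f x

def ext0 (F : Finset E) (y : {e // e ∉ F} → K) : E → K :=
  fun e => if h : e ∉ F then y ⟨e, h⟩ else 0

lemma cnt_congr {F : Finset E} {P Q : (E → K) → Prop}
    (h : ∀ x, (∀ e ∈ F, x e = 0) → (P x ↔ Q x)) : cnt F P = cnt F Q := by
  unfold cnt
  refine Finset.sum_congr rfl fun x _ => ?_
  by_cases hx : ∀ e ∈ F, x e = 0
  · simp only [h x hx]
  · simp [hx]

lemma cnt_eq (F : Finset E) (P : (E → K) → Prop) :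
    cnt F P = ∑ y : {e // e ∉ F} → K, if P (ext0 F y) then (1 : ℤ) else 0 := by
  unfold cnt
  rw [← Finset.sum_filter, ← Finset.sum_filter]
  refine Finset.sum_bij' (fun x _ => fun e => x e.1) (fun y _ => ext0 F y) ?_ ?_ ?_ ?_ ?_
  · intro x hx
    simp only [Finset.mem_filter, Finset.mem_univ, true_and] at hx ⊢
    convert hx.2 using 1
    ext e
    by_cases h : e ∈ F
    · simp [ext0, h, hx.1 e h]
    · simp [ext0, h]
  · intro y hy
    simp only [Finset.mem_filter, Finset.mem_univ, true_and] at hy ⊢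
    exact ⟨fun e he => by simp [ext0, he], hy⟩
  · intro x hx
    simp only [Finset.mem_filter, Finset.mem_univ, true_and] at hx ⊢
    ext e
    by_cases h : e ∈ F
    · simp [ext0, h, hx.1 e h]
    · simp [ext0, h]
  · intro y hy
    ext e
    simp [ext0, e.2]
  · intros; rfl

lemma cnt_true (F : Finset E) :
    cnt F (fun _ : E → K => True) = (Fintype.card K : ℤ) ^ (Fintype.card E - F.card) := by
  rw [cnt_eq]
  simp

lemma totalDegree_subst {σ τ : Type*} (p : MvPolynomial σ K) (g : σ → MvPolynomial τ K)
    (hg : ∀ s, (g s).totalDegree ≤ 1) : (MvPolynomial.aeval g p).totalDegree ≤ p.totalDegree := by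
  rw [MvPolynomial.aeval_def, MvPolynomial.eval₂_eq]
  refine MvPolynomial.totalDegree_finsetSum_le fun u hu => ?_
  refine (MvPolynomial.totalDegree_mul _ _).trans ?_
  rw [MvPolynomial.algebraMap_eq, MvPolynomial.totalDegree_C, zero_add]
  refine (MvPolynomial.totalDegree_finsetProd _ _).trans ?_
  refine le_trans ?_ (MvPolynomial.le_totalDegree hu)
  refine Finset.sum_le_sum fun i _ => ?_
  refine (MvPolynomial.totalDegree_pow _ _).trans ?_
  nlinarith [hg i]

theorem ax1 (F : Finset E) {f : (E → K) → K} {d : ℕ} (b : ℕ) (hf : IsPolyDeg d f)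
    (h : d * b < Fintype.card E - F.card) (hb : b ≤ Fintype.card E - F.card) :
    (Fintype.card K : ℤ) ^ b ∣ cnt F (fun x => f x = 0) := by
  obtain ⟨p, hp, hpf⟩ := hf
  rcases Nat.eq_zero_or_pos d with rfl | hd
  · have hc := MvPolynomial.totalDegree_eq_zero_iff_eq_C.1 (Nat.le_zero.1 hp)
    have hfc : ∀ x, f x = p.coeff 0 := fun x => by rw [← hpf, hc]; simp
    simp only [hfc]
    by_cases h0 : p.coeff 0 = 0
    · simp only [h0, cnt_true]
      exact pow_dvd_pow _ hb
    · simp [cnt, h0]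
  · let g : E → MvPolynomial {e // e ∉ F} K := fun e => if h : e ∉ F then MvPolynomial.X ⟨e, h⟩ else 0
    have hdeg : (MvPolynomial.aeval g p).totalDegree ≤ d := by
      refine (totalDegree_subst p g fun s => ?_).trans hp
      by_cases hs : s ∈ F <;> simp [g, hs]
    have := ax0 (MvPolynomial.aeval g p) d b hdeg hd (by simpa using h)
    rw [cnt_eq]
    have h2 : ∀ y : {e // e ∉ F} → K, MvPolynomial.eval y (MvPolynomial.aeval g p) = f (ext0 F y) := by
      intro y
      rw [← hpf, MvPolynomial.aeval_def, ← MvPolynomial.coe_aeval_eq_eval,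
        ← MvPolynomial.coe_aeval_eq_eval]
      have : ext0 F y = fun e => MvPolynomial.aeval y (g e) := by
        ext e
        by_cases he : e ∈ F <;> simp [ext0, g, he]
      rw [this]
      simp only [RingHom.coe_coe]
      rw [← MvPolynomial.aeval_def, MvPolynomial.comp_aeval_apply]
    simp only [h2, Finset.card_filter] at this
    have := Int.natCast_dvd_natCast.2 this
    push_cast at this
    exact this

lemma fiber (e : E) (g : (E → K) → ℤ) :
    ∑ x, g x = ∑ x : E → K, if x e = 0 then ∑ t : K, g (Function.update x e t) else 0 := by
  rw [← Finset.sum_filter, ← Finset.sum_product']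
  refine (Finset.sum_bij' (fun z _ => Function.update z.1 e z.2)
    (fun x _ => (Function.update x e 0, x e)) ?_ ?_ ?_ ?_ ?_).symm
  · intros; simp
  · intros; simp
  · rintro ⟨x, t⟩ h
    simp at h
    simp [← h]
  · intros; simp
  · intros; simp

lemma cnt_fiber (F : Finset E) (e : E) (he : e ∉ F) (P : (E → K) → Prop) :
    cnt F P = ∑ x : E → K, if (∀ e' ∈ insert e F, x e' = 0) then
      ∑ t : K, (if P (Function.update x e t) then (1 : ℤ) else 0) else 0 := by
  unfold cnt
  rw [fiber e]
  refine Finset.sum_congr rfl fun x _ => ?_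
  have hup : ∀ t, (∀ e' ∈ F, Function.update x e t e' = 0) ↔ (∀ e' ∈ F, x e' = 0) := by
    intro t
    refine forall₂_congr fun e' he' => ?_
    have hne : e' ≠ e := fun h => he (by rw [← h]; exact he')
    rw [Function.update_of_ne hne]
  simp only [hup, Finset.forall_mem_insert]
  by_cases h2 : ∀ e' ∈ F, x e' = 0
  · simp only [and_iff_right h2, and_iff_left h2]
  · simp only [iff_false_intro h2, false_and, and_false, if_false]
    simp

lemma count_lin (a b : K) : ∑ t : K, (if a * t + b = 0 then (1 : ℤ) else 0) =
    (Fintype.card K : ℤ) * (if a = 0 ∧ b = 0 then 1 else 0) + 1 - (if a = 0 then 1 else 0) := by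
  by_cases ha : a = 0
  · by_cases hb : b = 0 <;> simp [ha, hb]
  · have : ∀ t, a * t + b = 0 ↔ t = -b / a := fun t => by
      constructor
      · intro h; field_simp; linear_combination h
      · rintro rfl; field_simp; ring
    simp [this, ha]

lemma count_lin2 (a b c d : K) :
    ∑ t : K, (if a * t + b = 0 ∧ c * t + d = 0 then (1 : ℤ) else 0) =
    (Fintype.card K : ℤ) * (if a = 0 ∧ b = 0 ∧ c = 0 ∧ d = 0 then 1 else 0)
      + (if a * d - b * c = 0 then 1 else 0) - (if a = 0 ∧ c = 0 then 1 else 0) := by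
  by_cases ha : a = 0
  · by_cases hb : b = 0
    · have := count_lin c d
      by_cases hc : c = 0 <;> by_cases hd : d = 0 <;> simp_all
    · by_cases hc : c = 0 <;> simp [ha, hb, hc]
  · have : ∀ t, (a * t + b = 0 ∧ c * t + d = 0) ↔ (t = -b / a ∧ a * d - b * c = 0) := fun t => by
      constructor
      · rintro ⟨h1, h2⟩
        exact ⟨by field_simp; linear_combination h1, by linear_combination a * h2 - c * h1⟩
      · rintro ⟨rfl, h⟩
        refine ⟨by field_simp; ring, ?_⟩
        field_simp
        linear_combination h
    by_cases h : a * d - b * c = 0 <;> simp [this, ha, h]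

lemma cnt_lin (F : Finset E) (e : E) (he : e ∉ F) (f a b : (E → K) → K)
    (h : ∀ x t, x e = 0 → f (Function.update x e t) = a x * t + b x) :
    cnt F (fun x => f x = 0) = (Fintype.card K : ℤ) * cnt (insert e F) (fun x => a x = 0 ∧ b x = 0)
      + (Fintype.card K : ℤ) ^ (Fintype.card E - (insert e F).card)
      - cnt (insert e F) (fun x => a x = 0) := by
  rw [cnt_fiber F e he, ← cnt_true]
  unfold cnt
  rw [Finset.mul_sum, ← Finset.sum_add_distrib, ← Finset.sum_sub_distrib]
  refine Finset.sum_congr rfl fun x _ => ?_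
  by_cases hx : ∀ e' ∈ insert e F, x e' = 0
  · have hx0 : x e = 0 := hx e (Finset.mem_insert_self _ _)
    rw [if_pos hx]
    simp only [h x _ hx0, count_lin, and_iff_right hx, if_true]
  · simp only [hx, false_and, if_false]; simp

lemma cnt_lin2 (F : Finset E) (e : E) (he : e ∉ F) (f g a b c d : (E → K) → K)
    (h : ∀ x t, x e = 0 → f (Function.update x e t) = a x * t + b x)
    (h' : ∀ x t, x e = 0 → g (Function.update x e t) = c x * t + d x) :
    cnt F (fun x => f x = 0 ∧ g x = 0) =
      (Fintype.card K : ℤ) * cnt (insert e F) (fun x => a x = 0 ∧ b x = 0 ∧ c x = 0 ∧ d x = 0)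
      + cnt (insert e F) (fun x => a x * d x - b x * c x = 0)
      - cnt (insert e F) (fun x => a x = 0 ∧ c x = 0) := by
  rw [cnt_fiber F e he]
  unfold cnt
  rw [Finset.mul_sum, ← Finset.sum_add_distrib, ← Finset.sum_sub_distrib]
  refine Finset.sum_congr rfl fun x _ => ?_
  by_cases hx : ∀ e' ∈ insert e F, x e' = 0
  · have hx0 : x e = 0 := hx e (Finset.mem_insert_self _ _)
    rw [if_pos hx]
    simp only [h x _ hx0, h' x _ hx0, count_lin2, and_iff_right hx]
  · simp only [hx, false_and, if_false]; simp

lemma cnt_mul (F : Finset E) (f g : (E → K) → K) :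
    cnt F (fun x => f x * g x = 0) = cnt F (fun x => f x = 0) + cnt F (fun x => g x = 0)
      - cnt F (fun x => f x = 0 ∧ g x = 0) := by
  unfold cnt
  rw [← Finset.sum_add_distrib, ← Finset.sum_sub_distrib]
  refine Finset.sum_congr rfl fun x _ => ?_
  by_cases hx : ∀ e' ∈ F, x e' = 0
  · by_cases h1 : f x = 0 <;> by_cases h2 : g x = 0 <;> simp [h1, h2]
  · simp only [hx, false_and, if_false]; simp

lemma IsPolyDeg.mul {d d' : ℕ} {f g : (E → K) → K} (hf : IsPolyDeg d f) (hg : IsPolyDeg d' g) :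
    IsPolyDeg (d + d') (fun x => f x * g x) := by
  obtain ⟨p, hp, hpf⟩ := hf
  obtain ⟨r, hr, hrf⟩ := hg
  exact ⟨p * r, (MvPolynomial.totalDegree_mul _ _).trans (add_le_add hp hr), fun x => by simp [hpf, hrf]⟩

/-- a system of two equations of small degree -/
lemma ax_two (F : Finset E) {f g : (E → K) → K} {d d' : ℕ} (hf : IsPolyDeg d f)
    (hg : IsPolyDeg d' g) (h : d + d' < Fintype.card E - F.card) :
    (Fintype.card K : ℤ) ∣ cnt F (fun x => f x = 0 ∧ g x = 0) := by
  have h1 := ax1 F 1 hf (by omega) (by omega)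
  have h2 := ax1 F 1 hg (by omega) (by omega)
  have h3 := ax1 F 1 (hf.mul hg) (by omega) (by omega)
  rw [pow_one] at h1 h2 h3
  have e : cnt F (fun x => f x = 0 ∧ g x = 0) = cnt F (fun x => f x = 0) + cnt F (fun x => g x = 0)
    - cnt F (fun x => f x * g x = 0) := by rw [cnt_mul]; ring
  rw [e]
  exact dvd_sub (dvd_add h1 h2) h3

/-- the denominator reduction step -/
lemma denom_step (F : Finset E) (e : E) (he : e ∉ F) (f g a b c d : (E → K) → K)
    (h : ∀ x t, x e = 0 → f (Function.update x e t) = a x * t + b x)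
    (h' : ∀ x t, x e = 0 → g (Function.update x e t) = c x * t + d x)
    {m : ℕ} (hac : IsPolyDeg m (fun x => a x * c x)) (hm : m < Fintype.card E - (insert e F).card) :
    (Fintype.card K : ℤ) ∣ cnt F (fun x => f x * g x = 0)
      + cnt (insert e F) (fun x => a x * d x - b x * c x = 0) := by
  have h3 := ax1 (insert e F) 1 hac (by omega) (by omega)
  rw [pow_one, cnt_mul] at h3
  rw [cnt_mul, cnt_lin F e he f a b h, cnt_lin F e he g c d h', cnt_lin2 F e he f g a b c d h h']
  obtain ⟨n, hn⟩ : ∃ n, Fintype.card E - (insert e F).card = n + 1 :=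
    ⟨Fintype.card E - (insert e F).card - 1, by omega⟩
  rw [hn, pow_succ]
  obtain ⟨z, hz⟩ := h3
  refine ⟨cnt (insert e F) (fun x => a x = 0 ∧ b x = 0) + cnt (insert e F) (fun x => c x = 0 ∧ d x = 0)
    - cnt (insert e F) (fun x => a x = 0 ∧ b x = 0 ∧ c x = 0 ∧ d x = 0)
    + 2 * (Fintype.card K : ℤ) ^ n - z, ?_⟩
  linear_combination -hz

end AxK

namespace AxK
set_option linter.unusedSectionVars false

section rep
variable {n : Type*} [Fintype n] [DecidableEq n] {R : Type*} [CommRing R]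

/-- replace row `i` by the unit vector at `c` -/
def rep (M : Matrix n n R) (i c : n) : Matrix n n R := M.updateRow i (Pi.single c 1)

def bump (M : Matrix n n R) (r : n) (t : R) : Matrix n n R :=
  M.updateRow r (M r + t • Pi.single r 1)

lemma rep_apply (M : Matrix n n R) (i c a b : n) :
    rep M i c a b = if a = i then (if b = c then 1 else 0) else M a b := by
  simp [rep, updateRow_apply, Pi.single_apply]

lemma bump_apply (M : Matrix n n R) (r : n) (t : R) (a b : n) :
    bump M r t a b = if a = r then M a b + (if b = r then t else 0) else M a b := by
  by_cases h : a = r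
  · subst h; simp [bump, Pi.single_apply]
  · simp [bump, updateRow_apply, h]

lemma det_bump (M : Matrix n n R) (r : n) (t : R) :
    (bump M r t).det = (rep M r r).det * t + M.det := by
  rw [bump, det_updateRow_add, det_updateRow_smul, updateRow_eq_self, rep]
  ring

lemma rep_bump (M : Matrix n n R) {i r : n} (h : i ≠ r) (c : n) (t : R) :
    rep (bump M r t) i c = bump (rep M i c) r t := by
  ext a b
  simp only [rep_apply, bump_apply]
  by_cases h1 : a = i
  · subst h1; simp [h]
  · simp [h1]

lemma rep_comm (M : Matrix n n R) {i j : n} (h : i ≠ j) (c d : n) :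
    rep (rep M i c) j d = rep (rep M j d) i c := by
  ext a b
  simp only [rep_apply]
  by_cases h1 : a = i
  · subst h1; simp [h]
  · simp [h1]

lemma rep_map {S : Type*} [CommRing S] (f : R →+* S) (M : Matrix n n R) (i c : n) :
    (rep M i c).map f = rep (M.map f) i c := by
  ext a b
  simp only [rep_apply, map_apply]
  split_ifs <;> simp

lemma det_rep (M : Matrix n n R) (i c : n) : (rep M i c).det = M.adjugate c i := by
  rw [adjugate_apply, rep]

lemma jacobi_field {F : Type*} [Field F] (M : Matrix n n F) (hM : M.det ≠ 0) {i j : n} (hij : i ≠ j)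
    (k l : n) : M.det * (rep (rep M i k) j l).det =
      (rep M i k).det * (rep M j l).det - (rep M i l).det * (rep M j k).det := by
  have hu : IsUnit M.det := isUnit_iff_ne_zero.2 hM
  set P := M⁻¹ with hP
  let U : Matrix n (Fin 2) F := of fun a b => if a = ![i, j] b then 1 else 0
  let W : Matrix (Fin 2) n F := of fun b a => P (![k, l] b) a - if a = ![i, j] b then 1 else 0
  have h1 : rep (rep M i k) j l * P = 1 + U * W := by
    ext a b
    have hMP : M * P = 1 := mul_nonsing_inv M hu
    rw [Matrix.mul_apply, Matrix.add_apply, Matrix.mul_apply, Fin.sum_univ_two]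
    simp only [rep_apply, U, W, of_apply, Matrix.cons_val_zero, Matrix.cons_val_one]
    by_cases ha : a = j
    · subst ha
      simp [hij.symm, Matrix.one_apply, eq_comm]
    · by_cases hb : a = i
      · subst hb
        simp [hij, Matrix.one_apply, eq_comm]
      · simp only [ha, hb, if_false, ← Matrix.mul_apply, hMP]
        simp
  have h2 : (1 + W * U).det = P k i * P l j - P k j * P l i := by
    rw [det_fin_two]
    simp only [Matrix.add_apply, Matrix.mul_apply, U, W, of_apply, mul_ite, mul_one, mul_zero,
      Finset.sum_ite_eq', Finset.mem_univ, if_true]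
    simp [hij, hij.symm]
  have h3 : (rep (rep M i k) j l).det * P.det = P k i * P l j - P k j * P l i := by
    rw [← det_mul, h1, det_one_add_mul_comm, h2]
  have hPd : P.det * M.det = 1 := by rw [← det_mul, nonsing_inv_mul M hu, det_one]
  have hadj : ∀ c r, (rep M r c).det = M.det * P c r := by
    intro c r
    rw [det_rep, hP, Matrix.inv_def, Ring.inverse_eq_inv', Matrix.smul_apply, smul_eq_mul]
    field_simp
  simp only [hadj]
  linear_combination (M.det^2) * h3 - M.det * (rep (rep M i k) j l).det * hPd

lemma jacobi (M : Matrix n n R) {i j : n} (hij : i ≠ j)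
    (k l : n) : M.det * (rep (rep M i k) j l).det =
      (rep M i k).det * (rep M j l).det - (rep M i l).det * (rep M j k).det := by
  let X := mvPolynomialX n n ℤ
  have hX : X.det ≠ 0 := det_mvPolynomialX_ne_zero n ℤ
  have key : X.det * (rep (rep X i k) j l).det =
      (rep X i k).det * (rep X j l).det - (rep X i l).det * (rep X j k).det := by
    apply IsFractionRing.injective (MvPolynomial (n × n) ℤ) (FractionRing (MvPolynomial (n × n) ℤ))
    set f := algebraMap (MvPolynomial (n × n) ℤ) (FractionRing (MvPolynomial (n × n) ℤ)) with hf
    have := jacobi_field (X.map f) (by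
      rw [← RingHom.mapMatrix_apply, ← RingHom.map_det]
      intro h
      exact hX (IsFractionRing.injective _ (FractionRing (MvPolynomial (n × n) ℤ)) (by rw [h, map_zero]))) hij k l
    simp only [map_mul, map_sub, RingHom.map_det, RingHom.mapMatrix_apply, rep_map]
    exact this
  let g : MvPolynomial (n × n) ℤ →+* R := MvPolynomial.eval₂Hom (Int.castRingHom R) fun p => M p.1 p.2
  have hg : X.map g = M := by
    ext a b
    simp [X, g]
  have := congrArg g key
  simp only [map_mul, map_sub, RingHom.map_det, RingHom.mapMatrix_apply, rep_map, hg] at this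
  exact this

end rep

section PM
variable {E W K : Type*} [Fintype E] [DecidableEq E] [CommRing K]
variable [Fintype W] [DecidableEq W]

def PM (B : Matrix E W K) (x : E → K) : Matrix (E ⊕ W) (E ⊕ W) K :=
  fromBlocks (diagonal x) B Bᵀ 0

lemma PM_symm (B : Matrix E W K) (x : E → K) : (PM B x)ᵀ = PM B x := by
  simp [PM, fromBlocks_transpose]

lemma PM_update (B : Matrix E W K) (x : E → K) (e : E) (t : K) (h : x e = 0) :
    PM B (Function.update x e t) = bump (PM B x) (Sum.inl e) t := by
  ext a b
  rw [bump_apply]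
  rcases a with a | a <;> rcases b with b | b
  · simp only [PM, fromBlocks_apply₁₁, diagonal_apply, Sum.inl.injEq]
    by_cases h1 : a = e
    · subst h1
      by_cases h2 : a = b
      · subst h2; simp [h]
      · simp [h2, Ne.symm h2]
    · simp [h1]
  all_goals simp [PM]

lemma rep_symm (B : Matrix E W K) (x : E → K) (i j : E ⊕ W) :
    (rep (PM B x) i j).det = (rep (PM B x) j i).det := by
  rw [det_rep, det_rep]
  conv_lhs => rw [← PM_symm]
  rw [← adjugate_transpose, transpose_apply]

end PM

end AxK

namespace AxK
set_option linter.unusedSectionVars false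

section deg
variable {s R : Type*} [CommRing R]
variable {F W : Type*} [Fintype F] [DecidableEq F] [Fintype W] [DecidableEq W]

structure Good (A : Matrix (F ⊕ W) (F ⊕ W) (MvPolynomial s R)) (T : Finset F) : Prop where
  h22 : ∀ a b, A (Sum.inr a) (Sum.inr b) = 0
  h12 : ∀ a b, (A (Sum.inl a) (Sum.inr b)).totalDegree = 0
  h21 : ∀ a b, (A (Sum.inr a) (Sum.inl b)).totalDegree = 0
  h11 : ∀ a b, (A (Sum.inl a) (Sum.inl b)).totalDegree ≤ 1
  hT : ∀ a ∈ T, (∀ b, A (Sum.inl a) (Sum.inr b) = 0) ∧ ∀ b, (A (Sum.inl a) (Sum.inl b)).totalDegree = 0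

lemma Good.deg {A : Matrix (F ⊕ W) (F ⊕ W) (MvPolynomial s R)} {T : Finset F} (h : Good A T) :
    A.det.totalDegree ≤ Fintype.card F - (T.card + Fintype.card W) := by
  rw [← det_transpose, det_apply]
  refine MvPolynomial.totalDegree_finsetSum_le fun g _ => ?_
  rw [Units.smul_def, zsmul_eq_mul]
  refine (MvPolynomial.totalDegree_mul _ _).trans ?_
  have : ((↑(↑(Equiv.Perm.sign g) : ℤ) : MvPolynomial s R)).totalDegree = 0 := by
    rw [← map_intCast (MvPolynomial.C : R →+* MvPolynomial s R), MvPolynomial.totalDegree_C]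
  rw [this, zero_add]
  simp only [transpose_apply]
  by_cases hz : ∏ i, A i (g i) = 0
  · rw [hz]; simp
  have hne : ∀ i, A i (g i) ≠ 0 := fun i h0 => hz (Finset.prod_eq_zero (Finset.mem_univ i) h0)
  refine (MvPolynomial.totalDegree_finsetProd _ _).trans ?_
  rw [Fintype.sum_sum_type]
  let S : Finset F := Finset.univ.filter fun e => e ∉ T ∧ (g (Sum.inl e)).isLeft
  have hr : ∀ w, (g (Sum.inr w)).isLeft := by
    intro w
    rcases hgw : g (Sum.inr w) with e | w'
    · rfl
    · exact absurd (by rw [hgw]; exact h.h22 _ _) (hne (Sum.inr w))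
  have hTl : ∀ e ∈ T, (g (Sum.inl e)).isLeft := by
    intro e he
    rcases hgw : g (Sum.inl e) with e' | w'
    · rfl
    · exact absurd (by rw [hgw]; exact (h.hT e he).1 _) (hne (Sum.inl e))
  have h2 : ∑ w, (A (Sum.inr w) (g (Sum.inr w))).totalDegree = 0 := by
    refine Finset.sum_eq_zero fun w _ => ?_
    have := hr w
    rcases hgw : g (Sum.inr w) with e | w'
    · exact h.h21 _ _
    · rw [hgw] at this; simp at this
  have h1 : ∑ e, (A (Sum.inl e) (g (Sum.inl e))).totalDegree ≤ S.card := by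
    rw [Finset.card_filter]
    refine Finset.sum_le_sum fun e _ => ?_
    by_cases heT : e ∈ T
    · have := hTl e heT
      rcases hgw : g (Sum.inl e) with e' | w'
      · rw [(h.hT e heT).2]; simp
      · rw [hgw] at this; simp at this
    · rcases hgw : g (Sum.inl e) with e' | w'
      · simpa [heT] using h.h11 _ _
      · rw [h.h12]; simp
  rw [h2, add_zero]
  refine h1.trans ?_
  have hcard : S.card + T.card + Fintype.card W ≤ Fintype.card F := by
    let Z : Finset (F ⊕ W) := ((S ∪ T).disjSum Finset.univ)
    have hZ : Z.card = S.card + T.card + Fintype.card W := by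
      rw [Finset.card_disjSum, Finset.card_union_of_disjoint]
      · rfl
      · rw [Finset.disjoint_left]
        intro a ha hb
        simp only [S, Finset.mem_filter] at ha
        exact ha.2.1 hb
    rw [← hZ]
    have hsub : Z.map g.toEmbedding ⊆ (Finset.univ : Finset F).map ⟨Sum.inl, Sum.inl_injective⟩ := by
      intro y hy
      rw [Finset.mem_map] at hy
      obtain ⟨z, hz, rfl⟩ := hy
      have : (g z).isLeft := by
        rcases z with e | w
        · simp only [Z, Finset.inl_mem_disjSum, Finset.mem_union] at hz
          rcases hz with hz | hz
          · simp only [S, Finset.mem_filter] at hz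
            exact hz.2.2
          · exact hTl e hz
        · exact hr w
      obtain ⟨e, he⟩ := Sum.isLeft_iff.1 this
      simp [he]
    have := Finset.card_le_card hsub
    rw [Finset.card_map, Finset.card_map, Finset.card_univ] at this
    exact this
  omega

lemma Good.rep {A : Matrix (F ⊕ W) (F ⊕ W) (MvPolynomial s R)} {T : Finset F} (h : Good A T)
    (i c : F) : Good (rep A (Sum.inl i) (Sum.inl c)) (insert i T) := by
  constructor
  · intro a b; rw [rep_apply]; simp [h.h22]
  · intro a b; rw [rep_apply]
    by_cases ha : a = i <;> simp [ha, h.h12]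
  · intro a b; rw [rep_apply]; simp [h.h21]
  · intro a b; rw [rep_apply]
    by_cases ha : a = i
    · by_cases hb : b = c <;> simp [ha, hb]
    · simp [ha, h.h11]
  · intro a ha
    simp only [rep_apply]
    by_cases hi : a = i
    · refine ⟨fun b => by simp [hi], fun b => ?_⟩
      by_cases hb : b = c <;> simp [hi, hb]
    · have haT := h.hT a (by simpa [hi] using ha)
      exact ⟨fun b => by simp [hi, haT.1], fun b => by simp [hi, haT.2]⟩

end deg

section
variable {E K : Type} [Fintype E] [DecidableEq E] [Field K] [Fintype K]
variable {W : Type*} [Fintype W] [DecidableEq W]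

lemma PM_map {E W R S : Type*} [Fintype E] [DecidableEq E] [CommRing R] [CommRing S]
    [Fintype W] [DecidableEq W] (f : R →+* S) (B : Matrix E W R) (x : E → R) :
    (PM B x).map f = PM (B.map f) (fun e => f (x e)) := by
  ext a b
  rcases a with a | a <;> rcases b with b | b <;> simp [PM, diagonal_apply]
  split_ifs <;> simp

lemma good_PM (B : Matrix E W K) :
    Good (PM (B.map (MvPolynomial.C : K →+* MvPolynomial E K)) MvPolynomial.X) ∅ := by
  constructor
  · intro a b; simp [PM]
  · intro a b; simp [PM]
  · intro a b; simp [PM]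
  · intro a b
    by_cases h : a = b <;> simp [PM, h]
  · simp

lemma PMX_eval (B : Matrix E W K) (x : E → K) :
    (PM (B.map (MvPolynomial.C : K →+* MvPolynomial E K)) MvPolynomial.X).map (MvPolynomial.eval x)
      = PM B x := by
  rw [PM_map]
  congr 1
  · ext; simp
  · ext; simp

lemma deg0 (B : Matrix E W K) :
    IsPolyDeg (Fintype.card E - Fintype.card W) (fun x => (PM B x).det) :=
  ⟨_, by simpa using (good_PM B).deg, fun x => by
    rw [RingHom.map_det, RingHom.mapMatrix_apply, PMX_eval]⟩

lemma deg1 (B : Matrix E W K) (i l : E) :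
    IsPolyDeg (Fintype.card E - 1 - Fintype.card W)
      (fun x => (rep (PM B x) (Sum.inl i) (Sum.inl l)).det) :=
  ⟨_, by simpa [Nat.sub_sub] using ((good_PM B).rep i l).deg, fun x => by
    rw [RingHom.map_det, RingHom.mapMatrix_apply, rep_map, PMX_eval]⟩

lemma deg2 (B : Matrix E W K) (i l j k : E) (hij : i ≠ j) :
    IsPolyDeg (Fintype.card E - 2 - Fintype.card W)
      (fun x => (rep (rep (PM B x) (Sum.inl i) (Sum.inl l)) (Sum.inl j) (Sum.inl k)).det) :=
  ⟨_, by
      have := (((good_PM B).rep i l).rep j k).deg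
      rw [Finset.card_insert_of_notMem (by simp [hij.symm])] at this
      simpa [Nat.sub_sub] using this, fun x => by
    rw [RingHom.map_det, RingHom.mapMatrix_apply, rep_map, rep_map, PMX_eval]⟩

lemma deg3 (B : Matrix E W K) (i l j k u v : E) (hij : i ≠ j) (hiu : i ≠ u) (hju : j ≠ u) :
    IsPolyDeg (Fintype.card E - 3 - Fintype.card W)
      (fun x => (rep (rep (rep (PM B x) (Sum.inl i) (Sum.inl l)) (Sum.inl j) (Sum.inl k))
        (Sum.inl u) (Sum.inl v)).det) :=
  ⟨_, by
      have := ((((good_PM B).rep i l).rep j k).rep u v).deg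
      rw [Finset.card_insert_of_notMem (by simp [hju.symm, hiu.symm]),
        Finset.card_insert_of_notMem (by simp [hij.symm])] at this
      simpa [Nat.sub_sub] using this, fun x => by
    rw [RingHom.map_det, RingHom.mapMatrix_apply, rep_map, rep_map, rep_map, PMX_eval]⟩

end

end AxK

namespace AxK
set_option linter.unusedSectionVars false

section kern
variable {n K : Type*} [Fintype n] [DecidableEq n] [Field K]

lemma rep_ker (S : Matrix n n K) (i : n) (v : n → K) :
    rep S i i *ᵥ v = 0 ↔ v i = 0 ∧ ∀ r, r ≠ i → (S *ᵥ v) r = 0 := by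
  have h1 : ∀ r, (rep S i i *ᵥ v) r = if r = i then v i else (S *ᵥ v) r := by
    intro r
    by_cases h : r = i
    · subst h; simp [mulVec, rep, dotProduct, Pi.single_apply]
    · simp [mulVec, rep, h]
  constructor
  · intro h
    refine ⟨by have := congrFun h i; rw [h1] at this; simpa using this, fun r hr => ?_⟩
    have := congrFun h r; rw [h1] at this; simpa [hr] using this
  · rintro ⟨h, h'⟩
    ext r
    rw [h1]
    by_cases hr : r = i
    · simp [hr, h]
    · simp [hr, h' r hr]

lemma rep_ker2 (S : Matrix n n K) {i l : n} (hil : i ≠ l) (v : n → K) :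
    rep (rep S i i) l l *ᵥ v = 0 ↔ v i = 0 ∧ v l = 0 ∧ ∀ r, r ≠ i → r ≠ l → (S *ᵥ v) r = 0 := by
  rw [rep_ker]
  have h1 : ∀ r, (rep S i i *ᵥ v) r = if r = i then v i else (S *ᵥ v) r := by
    intro r
    by_cases h : r = i
    · subst h; simp [mulVec, rep, dotProduct, Pi.single_apply]
    · simp [mulVec, rep, h]
  simp only [h1]
  constructor
  · rintro ⟨h, h'⟩
    exact ⟨by simpa using h' i hil, h, fun r hr hr' => by simpa [hr] using h' r hr'⟩
  · rintro ⟨h, h', h''⟩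
    refine ⟨h', fun r hr => ?_⟩
    by_cases hri : r = i
    · simp [hri, h]
    · simp [hri, h'' r hri hr]

lemma pair_symm (S : Matrix n n K) (hS : Sᵀ = S) (u v : n → K) :
    u ⬝ᵥ (S *ᵥ v) = v ⬝ᵥ (S *ᵥ u) := by
  rw [dotProduct_mulVec, ← mulVec_transpose, hS, dotProduct_comm]

lemma pair_two (f g : n → K) {i l : n} (hil : i ≠ l) (h : ∀ r, r ≠ i → r ≠ l → g r = 0) :
    f ⬝ᵥ g = f i * g i + f l * g l := by
  rw [dotProduct, ← Finset.sum_subset (Finset.subset_univ {i, l}), Finset.sum_pair hil]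
  intro r _ hr
  simp only [Finset.mem_insert, Finset.mem_singleton, not_or] at hr
  rw [h r hr.1 hr.2, mul_zero]

lemma kern_aux (S : Matrix n n K) (hS : Sᵀ = S) {i l : n} (hil : i ≠ l)
    (hA : (rep (rep S i i) l l).det = 0) (hB : (rep S i i).det = 0)
    (v : n → K) (hv : S *ᵥ v = 0) (hvi : v i ≠ 0) :
    ∃ v : n → K, v ≠ 0 ∧ S *ᵥ v = 0 ∧ v i = 0 ∧ v l = 0 := by
  obtain ⟨u, hu0, hu⟩ := exists_mulVec_eq_zero_iff.2 hA
  obtain ⟨z, hz0, hz⟩ := exists_mulVec_eq_zero_iff.2 hB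
  rw [rep_ker2 S hil] at hu
  rw [rep_ker] at hz
  obtain ⟨hui, hul, hu⟩ := hu
  obtain ⟨hzi, hz⟩ := hz
  have h1 := pair_symm S hS v z
  rw [hv, dotProduct_zero, pair_two v _ hil (fun r h _ => hz r h), hz l hil.symm, mul_zero, add_zero] at h1
  have hSz : S *ᵥ z = 0 := by
    ext r
    by_cases hr : r = i
    · subst hr
      simpa [hvi] using h1
    · exact hz r hr
  by_cases hzl : z l = 0
  · exact ⟨z, hz0, hSz, hzi, hzl⟩
  have h2 := pair_symm S hS z u
  rw [hSz, dotProduct_zero, pair_two z _ hil hu, hzi, zero_mul, zero_add] at h2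
  have hb : (S *ᵥ u) l = 0 := by simpa [hzl] using h2
  have h3 := pair_symm S hS v u
  rw [hv, dotProduct_zero, pair_two v _ hil hu, hb, mul_zero, add_zero] at h3
  have ha : (S *ᵥ u) i = 0 := by simpa [hvi] using h3
  refine ⟨u, hu0, ?_, hui, hul⟩
  ext r
  by_cases hr : r = i
  · rw [hr, ha]; rfl
  · by_cases hr' : r = l
    · rw [hr', hb]; rfl
    · exact hu r hr hr'

lemma kern (S : Matrix n n K) (hS : Sᵀ = S) {i l : n} (hil : i ≠ l) :
    ((rep (rep S i i) l l).det = 0 ∧ (rep S i i).det = 0 ∧ (rep S l l).det = 0 ∧ S.det = 0) ↔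
    ∃ v : n → K, v ≠ 0 ∧ S *ᵥ v = 0 ∧ v i = 0 ∧ v l = 0 := by
  constructor
  · rintro ⟨hA, hB, hC, hD⟩
    obtain ⟨v, hv0, hv⟩ := exists_mulVec_eq_zero_iff.2 hD
    by_cases h1 : v i = 0
    · by_cases h2 : v l = 0
      · exact ⟨v, hv0, hv, h1, h2⟩
      · obtain ⟨u, hu⟩ := kern_aux S hS hil.symm (by rwa [rep_comm _ hil.symm]) hC v hv h2
        exact ⟨u, hu.1, hu.2.1, hu.2.2.2, hu.2.2.1⟩
    · exact kern_aux S hS hil hA hB v hv h1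
  · rintro ⟨v, hv0, hv, h1, h2⟩
    refine ⟨?_, ?_, ?_, ?_⟩ <;> rw [← exists_mulVec_eq_zero_iff]
    · exact ⟨v, hv0, (rep_ker2 S hil v).2 ⟨h1, h2, fun r _ _ => by rw [hv]; rfl⟩⟩
    · exact ⟨v, hv0, (rep_ker S i v).2 ⟨h1, fun r _ => by rw [hv]; rfl⟩⟩
    · exact ⟨v, hv0, (rep_ker S l v).2 ⟨h2, fun r _ => by rw [hv]; rfl⟩⟩
    · exact ⟨v, hv0, hv⟩

end kern

section count
variable {K : Type} [Field K] [Fintype K]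

lemma card_ker {U U' : Type*} [AddCommGroup U] [Module K U] [AddCommGroup U'] [Module K U']
    [Fintype U] (f : U →ₗ[K] U') :
    (∑ u : U, if f u = 0 then (1 : ℤ) else 0) =
      (Fintype.card K : ℤ) ^ Module.finrank K (LinearMap.ker f) := by
  have h := Module.card_eq_pow_finrank (K := K) (V := LinearMap.ker f)
  rw [Finset.sum_boole]
  have : (Finset.univ.filter fun u => f u = 0).card = Fintype.card (LinearMap.ker f) := by
    rw [Fintype.card_subtype]
    simp
  rw [this]
  exact_mod_cast h

lemma card_ker_dvd {U U' : Type*} [AddCommGroup U] [Module K U] [AddCommGroup U'] [Module K U']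
    [Fintype U] [Module.Finite K U] [Module.Finite K U'] (f : U →ₗ[K] U')
    (h : Module.finrank K U' < Module.finrank K U) :
    (Fintype.card K : ℤ) ∣ ∑ u : U, if f u = 0 then (1 : ℤ) else 0 := by
  rw [card_ker]
  have h1 := LinearMap.finrank_range_add_finrank_ker f
  have h2 := Submodule.finrank_le (LinearMap.range f)
  exact dvd_pow_self _ (by omega)

lemma ind_mod {U U' : Type*} [AddCommGroup U] [Module K U] [AddCommGroup U'] [Module K U']
    [Fintype U] (f : U →ₗ[K] U') :
    (Fintype.card K : ℤ) ∣ (if ∃ v, v ≠ 0 ∧ f v = 0 then (1 : ℤ) else 0) - 1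
      + ∑ u : U, if f u = 0 then (1 : ℤ) else 0 := by
  by_cases h : ∃ v, v ≠ 0 ∧ f v = 0
  · rw [if_pos h, sub_self, zero_add, card_ker]
    refine dvd_pow_self _ ?_
    obtain ⟨v, hv, hf⟩ := h
    intro h0
    rw [Submodule.finrank_eq_zero] at h0
    exact hv (by simpa [h0] using (LinearMap.mem_ker.2 hf))
  · rw [if_neg h, card_ker]
    have : LinearMap.ker f = ⊥ := by
      rw [LinearMap.ker_eq_bot']
      intro m hm
      by_contra hm0
      exact h ⟨m, hm0, hm⟩
    rw [this]
    simp

variable {E : Type} {W : Type*} [Fintype E] [DecidableEq E] [Fintype W] [DecidableEq W]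

lemma PM_mulVec (B : Matrix E W K) (x : E → K) (a : E → K) (b : W → K) :
    PM B x *ᵥ (Sum.elim a b) = 0 ↔ (∀ e, a e * x e + (B *ᵥ b) e = 0) ∧ Bᵀ *ᵥ a = 0 := by
  rw [PM, fromBlocks_mulVec]
  simp only [Sum.elim_comp_inl, Sum.elim_comp_inr, zero_mulVec, add_zero]
  constructor
  · intro h
    refine ⟨fun e => ?_, ?_⟩
    · have := congrFun h (Sum.inl e)
      simpa [mulVec_diagonal, mul_comm] using this
    · ext w
      exact congrFun h (Sum.inr w)
  · rintro ⟨h1, h2⟩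
    ext (e | w)
    · simpa [mulVec_diagonal, mul_comm] using h1 e
    · simp [h2]

theorem KC (B : Matrix E W K) {i l : E} (hil : i ≠ l) (hw : 3 ≤ Fintype.card W)
    (hN : 3 ≤ Fintype.card E) :
    (Fintype.card K : ℤ) ∣ cnt {i, l} (fun x =>
      (rep (rep (PM B x) (Sum.inl i) (Sum.inl i)) (Sum.inl l) (Sum.inl l)).det = 0 ∧
      (rep (PM B x) (Sum.inl i) (Sum.inl i)).det = 0 ∧
      (rep (PM B x) (Sum.inl l) (Sum.inl l)).det = 0 ∧ (PM B x).det = 0) := by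
  have hil' : (Sum.inl i : E ⊕ W) ≠ Sum.inl l := fun h => hil (Sum.inl_injective h)
  have e1 : cnt {i, l} (fun x =>
      (rep (rep (PM B x) (Sum.inl i) (Sum.inl i)) (Sum.inl l) (Sum.inl l)).det = 0 ∧
      (rep (PM B x) (Sum.inl i) (Sum.inl i)).det = 0 ∧
      (rep (PM B x) (Sum.inl l) (Sum.inl l)).det = 0 ∧ (PM B x).det = 0) =
      cnt {i, l} (fun x => ∃ v : E ⊕ W → K, v ≠ 0 ∧ PM B x *ᵥ v = 0 ∧ v (Sum.inl i) = 0 ∧ v (Sum.inl l) = 0) :=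
    cnt_congr fun x _ => kern (PM B x) (PM_symm B x) hil'
  rw [e1]
  obtain ⟨f, hf⟩ : ∃ f : (E → K) → (E ⊕ W → K) →ₗ[K] (E ⊕ W → K) × (K × K),
      ∀ x v, f x v = 0 ↔ PM B x *ᵥ v = 0 ∧ v (Sum.inl i) = 0 ∧ v (Sum.inl l) = 0 :=
    ⟨fun x => (Matrix.mulVecLin (PM B x)).prod
      ((LinearMap.proj (Sum.inl i)).prod (LinearMap.proj (Sum.inl l))), by
    intro x v
    simp [Prod.ext_iff]⟩
  have hS : (Fintype.card K : ℤ) ∣ ∑ x : E → K, if (∀ e ∈ ({i, l} : Finset E), x e = 0) then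
      (∑ v : E ⊕ W → K, if f x v = 0 then (1 : ℤ) else 0) else 0 := by
    have e2 : (∑ x : E → K, if (∀ e ∈ ({i, l} : Finset E), x e = 0) then
        (∑ v : E ⊕ W → K, if f x v = 0 then (1 : ℤ) else 0) else 0) =
        ∑ a : E → K, if (Bᵀ *ᵥ a = 0 ∧ a i = 0 ∧ a l = 0) then
          ∑ z : (E → K) × (W → K), (if ((∀ e, a e * z.1 e + (B *ᵥ z.2) e = 0) ∧ z.1 i = 0 ∧ z.1 l = 0)
            then (1 : ℤ) else 0) else 0 := by
      have e3 : ∀ x : E → K, (∑ v : E ⊕ W → K, if f x v = 0 then (1 : ℤ) else 0) =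
          ∑ a : E → K, ∑ b : W → K, if f x (Sum.elim a b) = 0 then (1 : ℤ) else 0 := by
        intro x
        rw [← Finset.sum_product', Finset.univ_product_univ]
        exact Fintype.sum_equiv (Equiv.sumArrowEquivProdArrow E W K) _ _ (fun v => by
          have : v = Sum.elim ((Equiv.sumArrowEquivProdArrow E W K v).1)
            ((Equiv.sumArrowEquivProdArrow E W K v).2) := by
            ext (e | w) <;> rfl
          rw [← this])
      simp only [e3, Fintype.sum_prod_type]
      have e4 : ∀ (p : Prop) [Decidable p] (s : ((E → K) → ℤ)), (if p then ∑ a, s a else 0)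
         = ∑ a, if p then s a else 0 := by
        intro p _ s; split_ifs <;> simp
      have e4' : ∀ (p : Prop) [Decidable p] (s : ((W → K) → ℤ)), (if p then ∑ a, s a else 0)
         = ∑ a, if p then s a else 0 := by
        intro p _ s; split_ifs <;> simp
      simp only [e4, e4']
      rw [Finset.sum_comm]
      refine Finset.sum_congr rfl fun a _ => Finset.sum_congr rfl fun x _ => Finset.sum_congr rfl fun b _ => ?_
      simp only [hf, PM_mulVec, Sum.elim_inl, Finset.mem_insert, Finset.mem_singleton, forall_eq_or_imp, forall_eq]
      rw [← ite_and, ← ite_and]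
      refine if_congr ?_ rfl rfl
      tauto
    rw [e2]
    refine Finset.dvd_sum fun a _ => ?_
    split_ifs
    · let g : ((E → K) × (W → K)) →ₗ[K] (E → K) × (K × K) :=
        LinearMap.prod (LinearMap.coprod (Matrix.mulVecLin (diagonal a)) (Matrix.mulVecLin B))
          (((LinearMap.proj i).comp (LinearMap.fst K (E → K) (W → K))).prod
            ((LinearMap.proj l).comp (LinearMap.fst K (E → K) (W → K))))
      have hg : ∀ z, g z = 0 ↔ (∀ e, a e * z.1 e + (B *ᵥ z.2) e = 0) ∧ z.1 i = 0 ∧ z.1 l = 0 := by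
        intro z
        simp [g, Prod.ext_iff, funext_iff, mulVec_diagonal]
      have := card_ker_dvd g (by simp; omega)
      simp only [hg] at this
      convert this
    · exact dvd_zero _
  have hI : (Fintype.card K : ℤ) ∣ ∑ x : E → K, if (∀ e ∈ ({i, l} : Finset E), x e = 0) then
      ((if ∃ v, v ≠ 0 ∧ f x v = 0 then (1 : ℤ) else 0) - 1
      + ∑ v : E ⊕ W → K, if f x v = 0 then (1 : ℤ) else 0) else 0 := by
    refine Finset.dvd_sum fun x _ => ?_
    by_cases h1 : ∀ e ∈ ({i, l} : Finset E), x e = 0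
    · rw [if_pos h1]; convert ind_mod (f x)
      rfl
    · rw [if_neg h1]; exact dvd_zero _
  have hT : (Fintype.card K : ℤ) ∣ cnt {i, l} (fun _ : E → K => True) := by
    rw [cnt_true, Finset.card_pair hil]
    exact dvd_pow_self _ (by omega)
  have e5 : cnt {i, l} (fun x => ∃ v : E ⊕ W → K, v ≠ 0 ∧ PM B x *ᵥ v = 0 ∧ v (Sum.inl i) = 0 ∧ v (Sum.inl l) = 0)
      = (∑ x : E → K, if (∀ e ∈ ({i, l} : Finset E), x e = 0) then
      ((if ∃ v, v ≠ 0 ∧ f x v = 0 then (1 : ℤ) else 0) - 1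
      + ∑ v : E ⊕ W → K, if f x v = 0 then (1 : ℤ) else 0) else 0)
      + cnt {i, l} (fun _ : E → K => True) - ∑ x : E → K, if (∀ e ∈ ({i, l} : Finset E), x e = 0) then
      (∑ v : E ⊕ W → K, if f x v = 0 then (1 : ℤ) else 0) else 0 := by
    unfold cnt
    rw [← Finset.sum_add_distrib, ← Finset.sum_sub_distrib]
    refine Finset.sum_congr rfl fun x _ => ?_
    by_cases hx : ∀ e ∈ ({i, l} : Finset E), x e = 0
    · simp only [if_pos hx, and_iff_right hx, hf, if_true]
      ring
    · rw [if_neg hx, if_neg hx, if_neg (fun h => hx h.1), if_neg (fun h => hx h.1)]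
      ring
  rw [e5]
  exact dvd_sub (dvd_add hI hT) hS

end count

end AxK

namespace AxK
set_option linter.unusedSectionVars false

variable {K : Type} [Field K] [Fintype K]
variable {E : Type} {W : Type*} [Fintype E] [DecidableEq E] [Fintype W] [DecidableEq W]

lemma lin0 (B : Matrix E W K) (i : E) (x : E → K) (t : K) (h : x i = 0) :
    (PM B (Function.update x i t)).det = (rep (PM B x) (Sum.inl i) (Sum.inl i)).det * t + (PM B x).det := by
  rw [PM_update B x i t h, det_bump]

lemma lin1 (B : Matrix E W K) (i : E) (a b : E) (ha : a ≠ i) (x : E → K) (t : K) (h : x i = 0) :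
    (rep (PM B (Function.update x i t)) (Sum.inl a) (Sum.inl b)).det =
      (rep (rep (PM B x) (Sum.inl a) (Sum.inl b)) (Sum.inl i) (Sum.inl i)).det * t
        + (rep (PM B x) (Sum.inl a) (Sum.inl b)).det := by
  rw [PM_update B x i t h, rep_bump _ (by simpa using ha), det_bump]

lemma lin2 (B : Matrix E W K) (i : E) (a b c d : E) (ha : a ≠ i) (hc : c ≠ i)
    (x : E → K) (t : K) (h : x i = 0) :
    (rep (rep (PM B (Function.update x i t)) (Sum.inl a) (Sum.inl b)) (Sum.inl c) (Sum.inl d)).det =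
      (rep (rep (rep (PM B x) (Sum.inl a) (Sum.inl b)) (Sum.inl c) (Sum.inl d)) (Sum.inl i) (Sum.inl i)).det * t
        + (rep (rep (PM B x) (Sum.inl a) (Sum.inl b)) (Sum.inl c) (Sum.inl d)).det := by
  rw [PM_update B x i t h, rep_bump _ (by simpa using ha), rep_bump _ (by simpa using hc), det_bump]

theorem propB (B : Matrix E W K) {i l j : E} (hil : i ≠ l) (hij : i ≠ j) (hlj : l ≠ j)
    (hw : 3 ≤ Fintype.card W) (hN : 5 ≤ Fintype.card E) (hNw : Fintype.card E ≤ 2 * Fintype.card W)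
    (h1 : (Fintype.card K : ℤ) ^ 3 ∣ cnt {i} (fun x => (rep (PM B x) (Sum.inl i) (Sum.inl i)).det = 0))
    (h2 : (Fintype.card K : ℤ) ^ 3 ∣ cnt {l} (fun x => (rep (PM B x) (Sum.inl l) (Sum.inl l)).det = 0))
    (h3 : (Fintype.card K : ℤ) ^ 3 ∣ cnt {i, l} (fun x =>
      (rep (rep (PM B x) (Sum.inl i) (Sum.inl i)) (Sum.inl l) (Sum.inl l)).det = 0)) :
    (Fintype.card K : ℤ) ^ 3 ∣ cnt ∅ (fun x => (PM B x).det = 0) - (Fintype.card K : ℤ) ^ 2 *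
      cnt {j, i, l} (fun x =>
        (rep (rep (PM B x) (Sum.inl i) (Sum.inl l)) (Sum.inl j) (Sum.inl j)).det = 0 ∧
        (rep (PM B x) (Sum.inl i) (Sum.inl l)).det = 0) := by
  have hil' : (Sum.inl i : E ⊕ W) ≠ Sum.inl l := fun h => hil (Sum.inl_injective h)
  set q := (Fintype.card K : ℤ) with hq
  have hq0 : q ≠ 0 := by rw [hq]; exact_mod_cast Fintype.card_ne_zero
  have A1 := cnt_lin (∅ : Finset E) i (by simp) (fun x => (PM B x).det)
    (fun x => (rep (PM B x) (Sum.inl i) (Sum.inl i)).det) (fun x => (PM B x).det) (lin0 B i)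
  have A2 := cnt_lin2 ({i} : Finset E) l (by simp [hil.symm]) 
    (fun x => (rep (PM B x) (Sum.inl i) (Sum.inl i)).det) (fun x => (PM B x).det)
    (fun x => (rep (rep (PM B x) (Sum.inl i) (Sum.inl i)) (Sum.inl l) (Sum.inl l)).det)
    (fun x => (rep (PM B x) (Sum.inl i) (Sum.inl i)).det) (fun x => (rep (PM B x) (Sum.inl l) (Sum.inl l)).det) (fun x => (PM B x).det)
    (lin1 B l i i hil) (lin0 B l)
  have A3 := cnt_lin ({l} : Finset E) i (by simp [hil]) 
    (fun x => (rep (PM B x) (Sum.inl l) (Sum.inl l)).det) (fun x => (rep (rep (PM B x) (Sum.inl l) (Sum.inl l)) (Sum.inl i) (Sum.inl i)).det)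
    (fun x => (rep (PM B x) (Sum.inl l) (Sum.inl l)).det) (lin1 B i l l hil.symm)
  have A4 := cnt_lin ({i, l} : Finset E) j (by simp [hij.symm, hlj.symm]) 
    (fun x => (rep (PM B x) (Sum.inl i) (Sum.inl l)).det) (fun x => (rep (rep (PM B x) (Sum.inl i) (Sum.inl l)) (Sum.inl j) (Sum.inl j)).det)
    (fun x => (rep (PM B x) (Sum.inl i) (Sum.inl l)).det) (lin1 B j i l hij)
  have A5 := KC B hil hw (by omega)
  have A6 := ax1 ({j, i, l} : Finset E) 2 (deg2 B i l j j hij)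
    (by rw [Finset.card_insert_of_notMem (by simp [hij.symm, hlj.symm]), Finset.card_pair hil]; omega)
    (by rw [Finset.card_insert_of_notMem (by simp [hij.symm, hlj.symm]), Finset.card_pair hil]; omega)
  rw [Finset.card_insert_of_notMem (by simp [hij.symm, hlj.symm]), Finset.card_pair hil] at A4
  rw [Finset.pair_comm l i] at A2
  rw [insert_empty_eq, Finset.card_singleton] at A1
  rw [Finset.card_pair hil] at A3
  have e1 : cnt {i, l} (fun x => (rep (rep (PM B x) (Sum.inl i) (Sum.inl i)) (Sum.inl l) (Sum.inl l)).det *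
      (PM B x).det - (rep (PM B x) (Sum.inl i) (Sum.inl i)).det * (rep (PM B x) (Sum.inl l) (Sum.inl l)).det = 0)
      = cnt {i, l} (fun x => (rep (PM B x) (Sum.inl i) (Sum.inl l)).det = 0) := by
    refine cnt_congr fun x _ => ?_
    have h := jacobi (PM B x) hil' (Sum.inl i) (Sum.inl l)
    rw [rep_symm B x (Sum.inl l) (Sum.inl i)] at h
    rw [show (rep (rep (PM B x) (Sum.inl i) (Sum.inl i)) (Sum.inl l) (Sum.inl l)).det *
      (PM B x).det - (rep (PM B x) (Sum.inl i) (Sum.inl i)).det * (rep (PM B x) (Sum.inl l) (Sum.inl l)).det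
      = -((rep (PM B x) (Sum.inl i) (Sum.inl l)).det * (rep (PM B x) (Sum.inl i) (Sum.inl l)).det) by
        linear_combination h]
    simp
  rw [e1] at A2
  simp only [fun x : E → K => rep_comm (PM B x) hil'.symm (Sum.inl l) (Sum.inl i)] at A3
  rw [← hq] at A1 A2 A3 A4 A5 A6
  obtain ⟨m, hm⟩ : ∃ m, Fintype.card E = m + 5 := ⟨Fintype.card E - 5, by omega⟩
  rw [hm, show m + 5 - 1 = m + 1 + 3 by omega, pow_add q (m+1)] at A1
  rw [hm, show m + 5 - 2 = m + 3 by omega, pow_add q m] at A3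
  rw [hm, show m + 5 - (2 + 1) = m + 2 by omega, pow_add q m] at A4
  obtain ⟨z1, h1⟩ := h1
  obtain ⟨z2, h2⟩ := h2
  obtain ⟨z3, h3⟩ := h3
  obtain ⟨z5, A5⟩ := A5
  obtain ⟨z6, A6⟩ := A6
  have A7 : cnt {i, l} (fun x => (rep (rep (PM B x) (Sum.inl i) (Sum.inl i)) (Sum.inl l) (Sum.inl l)).det = 0
      ∧ (rep (PM B x) (Sum.inl l) (Sum.inl l)).det = 0) = q ^ 2 * (z2 - q ^ m + z3) := by
    apply mul_left_cancel₀ hq0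
    linear_combination -A3 + h2 + h3
  rw [A7, A5] at A2
  rw [h1, A2, A4, A6] at A1
  rw [A1]
  refine ⟨z5 - (z2 - q ^ m + z3) + q ^ m - z6 + q ^ (m+1) - z1, ?_⟩
  ring

end AxK

namespace AxK
set_option linter.unusedSectionVars false

variable {K : Type} [Field K] [Fintype K]
variable {W : Type*} [Fintype W] [DecidableEq W]

def repR {E W R : Type*} [CommRing R] [DecidableEq E] [DecidableEq W] (T : Finset E)
    (M : Matrix (E ⊕ W) (E ⊕ W) R) : Matrix (E ⊕ W) (E ⊕ W) R :=
  of fun a b => if (∃ e ∈ T, a = Sum.inl e) then (1 : Matrix (E ⊕ W) (E ⊕ W) R) a b else M a b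

lemma repR_det {E W R : Type*} [CommRing R] [Fintype E] [DecidableEq E] [Fintype W] [DecidableEq W]
    (T : Finset E) (B : Matrix E W R) (x : E → R) :
    (repR T (PM B x)).det =
      (PM (B.submatrix (fun e : {e // e ∉ T} => e.1) id) (fun e => x e.1)).det := by
  let p : E ⊕ W → Prop := fun a => ∃ e ∈ T, a = Sum.inl e
  rw [twoBlockTriangular_det' _ p]
  · have h1 : toSquareBlockProp (repR T (PM B x)) p = 1 := by
      ext ⟨a, ha⟩ ⟨b, hb⟩
      have ha' : ∃ e ∈ T, a = Sum.inl e := ha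
      simp [toSquareBlockProp, repR, ha', Matrix.one_apply, Subtype.ext_iff]
    rw [h1, det_one, one_mul]
    let f : {e // e ∉ T} ⊕ W → {a : E ⊕ W // ¬ p a} :=
      Sum.elim (fun e => ⟨Sum.inl e.1, by rintro ⟨e', h, h'⟩; exact e.2 (Sum.inl_injective h' ▸ h)⟩)
        (fun w => ⟨Sum.inr w, by rintro ⟨e', h, h'⟩; simp at h'⟩)
    have hf : Function.Bijective f := by
      constructor
      · rintro (⟨a, ha⟩ | a) (⟨b, hb⟩ | b) h <;> simpa [f] using h
      · rintro ⟨e | w, h⟩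
        · have he : e ∉ T := fun h' => h ⟨e, h', rfl⟩
          exact ⟨Sum.inl ⟨e, he⟩, rfl⟩
        · exact ⟨Sum.inr w, rfl⟩
    rw [← det_submatrix_equiv_self (Equiv.ofBijective f hf)]
    congr 1
    ext a b
    rcases a with ⟨a, ha⟩ | a
    · rcases b with ⟨b, hb⟩ | b <;>
        simp [toSquareBlockProp, repR, f, PM, ha, diagonal_apply]
    · rcases b with ⟨b, hb⟩ | b <;>
        simp [toSquareBlockProp, repR, f, PM]
  · intro a ha b hb
    have ha' : ∃ e ∈ T, a = Sum.inl e := ha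
    have : a ≠ b := fun h => hb (h ▸ ha)
    simp [repR, ha', Matrix.one_apply, this]

lemma repR_cnt {E : Type} [Fintype E] [DecidableEq E] (T : Finset E) (B : Matrix E W K) :
    cnt T (fun x => (repR T (PM B x)).det = 0) =
      cnt ∅ (fun y => (PM (B.submatrix (fun e : {e // e ∉ T} => e.1) id) y).det = 0) := by
  rw [cnt_eq, cnt_eq]
  simp only [repR_det]
  have h1 : ∀ y : {e // e ∉ T} → K, (fun e : {e // e ∉ T} => ext0 T y e.1) = y := by
    intro y; ext e; simp [ext0, e.2]
  simp only [h1]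
  refine Fintype.sum_equiv (Equiv.arrowCongr (Equiv.subtypeUnivEquiv (by simp)).symm (Equiv.refl K)) _ _ ?_
  intro y
  congr! 4

lemma rep_eq1 {E W R : Type*} [CommRing R] [Fintype E] [DecidableEq E] [Fintype W] [DecidableEq W]
    (M : Matrix (E ⊕ W) (E ⊕ W) R) (i : E) :
    rep M (Sum.inl i) (Sum.inl i) = repR {i} M := by
  ext a b
  by_cases h : a = Sum.inl i <;> simp [rep_apply, repR, h, Matrix.one_apply, eq_comm]

lemma rep_eq2 {E W R : Type*} [CommRing R] [Fintype E] [DecidableEq E] [Fintype W] [DecidableEq W]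
    (M : Matrix (E ⊕ W) (E ⊕ W) R) (i l : E) :
    rep (rep M (Sum.inl i) (Sum.inl i)) (Sum.inl l) (Sum.inl l) = repR {i, l} M := by
  ext a b
  by_cases h : a = Sum.inl i <;> by_cases h' : a = Sum.inl l <;>
    simp [rep_apply, repR, h, h', Matrix.one_apply, eq_comm] <;> (rintro rfl; rfl)

theorem lemmaA (hw : 3 ≤ Fintype.card W) : ∀ (n : ℕ) (E : Type) [Fintype E] [DecidableEq E]
    (B : Matrix E W K), Fintype.card E = n → 3 ≤ n → n < 2 * Fintype.card W →
    (Fintype.card K : ℤ) ^ 3 ∣ cnt ∅ (fun x : E → K => (PM B x).det = 0) := by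
  intro n
  induction n using Nat.strong_induction_on with
  | _ n ih =>
  intro E _ _ B hE hn hnw
  by_cases hsmall : n ≤ Fintype.card W + 1
  · have hd := deg0 B
    rw [hE] at hd
    have hz : (n - Fintype.card W = 0 ∨ (n - Fintype.card W = 1 ∧ 3 < n)) := by omega
    refine ax1 ∅ 3 hd ?_ ?_ <;> rw [hE, Finset.card_empty]
    · rcases hz with hz | ⟨hz, h⟩ <;> rw [hz] <;> omega
    · omega
  · have h3 : 2 < Fintype.card E := by omega
    obtain ⟨i, l, j, hil, hij, hlj⟩ := Fintype.two_lt_card_iff.1 h3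
    have hA1 : ∀ T : Finset E, 1 ≤ T.card → T.card ≤ 2 → (Fintype.card K : ℤ) ^ 3 ∣
        cnt T (fun x => (repR T (PM B x)).det = 0) := by
      intro T hT hT2
      rw [repR_cnt]
      have hc : Fintype.card {e // e ∉ T} = n - T.card := by simp [hE]
      exact ih (n - T.card) (by omega) _ _ hc (by omega) (by omega)
    have hB := propB B hil hij hlj hw (by omega) (by omega)
      (by simp only [rep_eq1]; exact hA1 {i} (by simp) (by simp))
      (by simp only [rep_eq1]; exact hA1 {l} (by simp) (by simp))
      (by simp only [rep_eq2]; exact hA1 {i, l} (by simp [hil]) (by rw [Finset.card_pair hil]))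
    have hC := ax_two ({j, i, l} : Finset E) (deg2 B i l j j hij) (deg1 B i l)
      (by rw [Finset.card_insert_of_notMem (by simp [hij.symm, hlj.symm]), Finset.card_pair hil]; omega)
    obtain ⟨z, hz⟩ := hC
    rw [hz] at hB
    obtain ⟨y, hy⟩ := hB
    exact ⟨y + z, by linear_combination hy⟩

theorem lemmaA' {E : Type} [Fintype E] [DecidableEq E] (B : Matrix E W K)
    (hw : 3 ≤ Fintype.card W) (T : Finset E) (h : 3 ≤ Fintype.card E - T.card)
    (h' : Fintype.card E - T.card < 2 * Fintype.card W) :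
    (Fintype.card K : ℤ) ^ 3 ∣ cnt T (fun x => (repR T (PM B x)).det = 0) := by
  rw [repR_cnt]
  exact lemmaA hw _ _ _ (by simp) h h'

end AxK

namespace AxK
set_option linter.unusedSectionVars false

section five
variable {K : Type} [Field K] [Fintype K]
variable {E : Type} {W : Type*} [Fintype E] [DecidableEq E] [Fintype W] [DecidableEq W]

theorem five_step (B : Matrix E W K) {i j k l m : E} (hij : i ≠ j) (hik : i ≠ k) (hil : i ≠ l)
    (him : i ≠ m) (hjk : j ≠ k) (hjl : j ≠ l) (hjm : j ≠ m) (hkl : k ≠ l) (hkm : k ≠ m) (hlm : l ≠ m)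
    (hw : 3 ≤ Fintype.card W) (hN : 6 ≤ Fintype.card E) (hNw : Fintype.card E ≤ 2 * Fintype.card W) :
    (Fintype.card K : ℤ) ^ 3 ∣ cnt ∅ (fun x => (PM B x).det = 0) + (Fintype.card K : ℤ) ^ 2 *
      cnt {m, k, j, i, l} (fun x =>
        (rep (rep (rep (PM B x) (Sum.inl i) (Sum.inl l)) (Sum.inl j) (Sum.inl k)) (Sum.inl m) (Sum.inl m)).det
        * (rep (rep (PM B x) (Sum.inl i) (Sum.inl l)) (Sum.inl k) (Sum.inl j)).det
        - (rep (rep (PM B x) (Sum.inl i) (Sum.inl l)) (Sum.inl j) (Sum.inl k)).det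
        * (rep (rep (rep (PM B x) (Sum.inl i) (Sum.inl l)) (Sum.inl k) (Sum.inl j)) (Sum.inl m) (Sum.inl m)).det
         = 0) := by
  have hB := propB B hil hij hjl.symm hw (by omega) (by omega)
      (by simp only [rep_eq1]; exact lemmaA' B hw {i} (by simp; omega) (by simp; omega))
      (by simp only [rep_eq1]; exact lemmaA' B hw {l} (by simp; omega) (by simp; omega))
      (by simp only [rep_eq2]; exact lemmaA' B hw {i, l} (by rw [Finset.card_pair hil]; omega)
            (by rw [Finset.card_pair hil]; omega))
  have c3 : ({j, i, l} : Finset E).card = 3 := by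
    rw [Finset.card_insert_of_notMem (by simp [hij.symm, hjl]), Finset.card_pair hil]
  have hk4 : k ∉ ({j, i, l} : Finset E) := by simp [hjk.symm, hik.symm, hkl]
  have c4 : ({k, j, i, l} : Finset E).card = 4 := by
    rw [Finset.card_insert_of_notMem hk4, c3]
  have hm5 : m ∉ ({k, j, i, l} : Finset E) := by simp [hjm.symm, him.symm, hlm.symm, hkm.symm]
  have c5 : ({m, k, j, i, l} : Finset E).card = 5 := by
    rw [Finset.card_insert_of_notMem hm5, c4]
  have hC := cnt_lin2 ({j, i, l} : Finset E) k hk4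
    (fun x => (rep (rep (PM B x) (Sum.inl i) (Sum.inl l)) (Sum.inl j) (Sum.inl j)).det)
    (fun x => (rep (PM B x) (Sum.inl i) (Sum.inl l)).det)
    (fun x => (rep (rep (rep (PM B x) (Sum.inl i) (Sum.inl l)) (Sum.inl j) (Sum.inl j))
      (Sum.inl k) (Sum.inl k)).det)
    (fun x => (rep (rep (PM B x) (Sum.inl i) (Sum.inl l)) (Sum.inl j) (Sum.inl j)).det)
    (fun x => (rep (rep (PM B x) (Sum.inl i) (Sum.inl l)) (Sum.inl k) (Sum.inl k)).det)
    (fun x => (rep (PM B x) (Sum.inl i) (Sum.inl l)).det)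
    (lin2 B k i l j j hik hjk) (lin1 B k i l hik)
  have hD := ax_two ({k, j, i, l} : Finset E) (deg3 B i l j j k k hij hik hjk) (deg2 B i l k k hik)
    (by rw [c4]; omega)
  have e1 : cnt ({k, j, i, l} : Finset E) (fun x =>
      (rep (rep (rep (PM B x) (Sum.inl i) (Sum.inl l)) (Sum.inl j) (Sum.inl j)) (Sum.inl k) (Sum.inl k)).det
      * (rep (PM B x) (Sum.inl i) (Sum.inl l)).det
      - (rep (rep (PM B x) (Sum.inl i) (Sum.inl l)) (Sum.inl j) (Sum.inl j)).det
      * (rep (rep (PM B x) (Sum.inl i) (Sum.inl l)) (Sum.inl k) (Sum.inl k)).det = 0) =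
      cnt ({k, j, i, l} : Finset E) (fun x =>
      (rep (rep (PM B x) (Sum.inl i) (Sum.inl l)) (Sum.inl j) (Sum.inl k)).det *
      (rep (rep (PM B x) (Sum.inl i) (Sum.inl l)) (Sum.inl k) (Sum.inl j)).det = 0) := by
    refine cnt_congr fun x _ => ?_
    have h := jacobi (rep (PM B x) (Sum.inl i) (Sum.inl l)) (i := Sum.inl j) (j := Sum.inl k)
      (by simpa using hjk) (Sum.inl j) (Sum.inl k)
    rw [← neg_eq_zero]
    refine Eq.congr_left ?_
    linear_combination -h
  have hF := denom_step ({k, j, i, l} : Finset E) m hm5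
    (fun x => (rep (rep (PM B x) (Sum.inl i) (Sum.inl l)) (Sum.inl j) (Sum.inl k)).det)
    (fun x => (rep (rep (PM B x) (Sum.inl i) (Sum.inl l)) (Sum.inl k) (Sum.inl j)).det)
    _ _ _ _ (lin2 B m i l j k him hjm) (lin2 B m i l k j him hkm)
    ((deg3 B i l j k m m hij him hjm).mul (deg3 B i l k j m m hik him hkm))
    (by rw [c5]; omega)
  rw [e1] at hC
  rw [hC] at hB
  obtain ⟨y, hy⟩ := hB
  obtain ⟨z, hz⟩ := hD
  obtain ⟨u, hu⟩ := hF
  rw [hz] at hy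
  refine ⟨y + u - z + cnt ({k, j, i, l} : Finset E) (fun x =>
      (rep (rep (rep (PM B x) (Sum.inl i) (Sum.inl l)) (Sum.inl j) (Sum.inl j)) (Sum.inl k) (Sum.inl k)).det = 0
      ∧ (rep (rep (PM B x) (Sum.inl i) (Sum.inl l)) (Sum.inl j) (Sum.inl j)).det = 0
      ∧ (rep (rep (PM B x) (Sum.inl i) (Sum.inl l)) (Sum.inl k) (Sum.inl k)).det = 0
      ∧ (rep (PM B x) (Sum.inl i) (Sum.inl l)).det = 0), ?_⟩
  linear_combination hy + (Fintype.card K : ℤ) ^ 2 * hu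

end five

section minor
variable {R : Type*} [CommRing R]

lemma minor_gen {n S Q : Type*} [Fintype n] [DecidableEq n] [Fintype S] [DecidableEq S]
    [Fintype Q] [DecidableEq Q] (f g : S ⊕ Q ≃ n) (A : Matrix n n R)
    (hA : ∀ s b, A (f (Sum.inl s)) (g b) = if b = Sum.inl s then 1 else 0) :
    (A.submatrix (f ∘ Sum.inr) (g ∘ Sum.inr)).det =
      ((Equiv.Perm.sign (g.trans f.symm) : ℤˣ) : ℤ) * A.det := by
  have h1 : A.submatrix f g = (A.submatrix f f).submatrix id (g.trans f.symm) := by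
    ext a b; simp
  have h2 : A.submatrix f g = fromBlocks 1 0 (A.submatrix (f ∘ Sum.inr) (g ∘ Sum.inl))
      (A.submatrix (f ∘ Sum.inr) (g ∘ Sum.inr)) := by
    ext a b
    rcases a with a | a <;> rcases b with b | b <;> simp [hA, Matrix.one_apply, eq_comm]
  have h3 : (A.submatrix f g).det = (A.submatrix (f ∘ Sum.inr) (g ∘ Sum.inr)).det := by
    rw [h2, det_fromBlocks_zero₁₂, det_one, one_mul]
  rw [← h3, h1, det_permute', det_submatrix_equiv_self]

variable {W : Type*} [Fintype W] [DecidableEq W]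

lemma minor_one {a : ℕ} (A : Matrix (Fin (a+1) ⊕ W) (Fin (a+1) ⊕ W) R) (p : Fin (a+1)) :
    (A.submatrix (Sum.map p.succAbove id) (Sum.map p.succAbove id)).det
      = (rep A (Sum.inl p) (Sum.inl p)).det := by
  let f : Unit ⊕ (Fin a ⊕ W) → Fin (a+1) ⊕ W :=
    Sum.elim (fun _ => Sum.inl p) (Sum.map p.succAbove id)
  have hf : Function.Bijective f := by
    rw [Fintype.bijective_iff_injective_and_card]
    constructor
    · rintro (x | x | x) (y | y | y) h <;>
        simp_all [f, Fin.succAbove_ne, (Fin.succAbove_ne _ _).symm]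
    · simp; ring
  have := minor_gen (Equiv.ofBijective f hf) (Equiv.ofBijective f hf) (rep A (Sum.inl p) (Sum.inl p)) (by
    intro s b
    rcases b with b | b | b <;> simp [f, rep_apply, Fin.succAbove_ne])
  simp only [Equiv.self_trans_symm, Equiv.Perm.sign_refl] at this
  rw [Units.val_one, Int.cast_one, one_mul] at this
  rw [← this]
  congr 1
  ext x y
  rcases x with x | x <;> rcases y with y | y <;>
    simp [f, rep_apply, Fin.succAbove_ne]

lemma minor_two {N a : ℕ} (hN : N = a + 2) (r g : Fin a → Fin N) (hr : Function.Injective r)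
    (hg : Function.Injective g) {i j k l : Fin N} (hij : i ≠ j) (hkl : l ≠ k)
    (hri : ∀ s, r s ≠ i) (hrj : ∀ s, r s ≠ j) (hgk : ∀ s, g s ≠ k) (hgl : ∀ s, g s ≠ l) :
    ∃ u : ℤˣ, ∀ M : Matrix (Fin N ⊕ W) (Fin N ⊕ W) R,
      (M.submatrix (Sum.map r id) (Sum.map g id)).det = ((u : ℤ) : R) *
        (rep (rep M (Sum.inl i) (Sum.inl l)) (Sum.inl j) (Sum.inl k)).det := by
  let f1 : Fin 2 ⊕ (Fin a ⊕ W) → Fin N ⊕ W :=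
    Sum.elim (fun s => Sum.inl (![i, j] s)) (Sum.map r id)
  let f2 : Fin 2 ⊕ (Fin a ⊕ W) → Fin N ⊕ W :=
    Sum.elim (fun s => Sum.inl (![l, k] s)) (Sum.map g id)
  have vf1 : ∀ x s, r x ≠ ![i, j] s := by
    intro x s
    fin_cases s
    · exact hri x
    · exact hrj x
  have wf1 : Function.Injective ![i, j] := by
    intro x y h
    fin_cases x <;> fin_cases y <;> first | rfl | exact absurd h hij | exact absurd h.symm hij
  have hf1 : Function.Bijective f1 := by
    rw [Fintype.bijective_iff_injective_and_card]
    constructor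
    · rintro (x | x | x) (y | y | y) h
      · rw [wf1 (Sum.inl_injective h)]
      · exact absurd (Sum.inl_injective h).symm (vf1 _ _)
      · exact absurd h (by simp [f1])
      · exact absurd (Sum.inl_injective h) (vf1 _ _)
      · rw [hr (Sum.inl_injective h)]
      · exact absurd h (by simp [f1])
      · exact absurd h (by simp [f1])
      · exact absurd h (by simp [f1])
      · rw [show x = y from Sum.inr_injective h]
    · simp [hN]; ring
  have vf2 : ∀ x s, g x ≠ ![l, k] s := by
    intro x s
    fin_cases s
    · exact hgl x
    · exact hgk x
  have wf2 : Function.Injective ![l, k] := by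
    intro x y h
    fin_cases x <;> fin_cases y <;> first | rfl | exact absurd h hkl | exact absurd h.symm hkl
  have hf2 : Function.Bijective f2 := by
    rw [Fintype.bijective_iff_injective_and_card]
    constructor
    · rintro (x | x | x) (y | y | y) h
      · rw [wf2 (Sum.inl_injective h)]
      · exact absurd (Sum.inl_injective h).symm (vf2 _ _)
      · exact absurd h (by simp [f2])
      · exact absurd (Sum.inl_injective h) (vf2 _ _)
      · rw [hg (Sum.inl_injective h)]
      · exact absurd h (by simp [f2])
      · exact absurd h (by simp [f2])
      · exact absurd h (by simp [f2])
      · rw [show x = y from Sum.inr_injective h]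
    · simp [hN]; ring
  refine ⟨Equiv.Perm.sign ((Equiv.ofBijective f2 hf2).trans (Equiv.ofBijective f1 hf1).symm), fun M => ?_⟩
  rw [← minor_gen]
  · congr 1
    ext x y
    rcases x with x | x <;> rcases y with y | y <;>
      simp [f1, f2, rep_apply, hri, hrj]
  · intro s b
    have hb : f2 b = Sum.inl (![l, k] s) ↔ b = Sum.inl s := by
      rw [show (Sum.inl (![l, k] s) : Fin N ⊕ W) = f2 (Sum.inl s) from rfl, hf2.1.eq_iff]
    fin_cases s
    · simp only [Equiv.ofBijective_apply, rep_apply]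
      simp only [Fin.zero_eta, Matrix.cons_val_zero] at hb
      rw [show f1 (Sum.inl ((fun i => i) ⟨0, by norm_num⟩)) = Sum.inl i from rfl]
      simp [hij, hb]
    · simp only [Equiv.ofBijective_apply, rep_apply]
      simp only [Fin.mk_one, Matrix.cons_val_one, Matrix.cons_val_zero] at hb
      rw [show f1 (Sum.inl ((fun i => i) ⟨1, by norm_num⟩)) = Sum.inl j from rfl]
      simp [hb]

end minor
end AxK

namespace AxK
set_option linter.unusedSectionVars false

section link
variable {R : Type*} [CommRing R] {W : Type*} [Fintype W] [DecidableEq W]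

lemma minorDet_eq {N a : ℕ} (M : Matrix (Fin N ⊕ W) (Fin N ⊕ W) R) (I J : Finset (Fin N))
    (r g : Fin a → Fin N) (hr : StrictMono r) (hg : StrictMono g) (hrI : ∀ s, r s ∉ I)
    (hgJ : ∀ s, g s ∉ J) (hI : Iᶜ.card = a) (hJ : Jᶜ.card = a) :
    minorDet M I J = (M.submatrix (Sum.map r id) (Sum.map g id)).det := by
  subst hI
  rw [minorDet, dif_pos hJ]
  have h1 := Finset.orderEmbOfFin_unique (s := Iᶜ) rfl (f := r) (fun s => by simpa using hrI s) hr
  have h2 := Finset.orderEmbOfFin_unique (s := Jᶜ) hJ (f := g) (fun s => by simpa using hgJ s) hg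
  rw [h1, h2]
  rfl

lemma minorDet_map {S : Type*} [CommRing S] (f : R →+* S) {N : ℕ}
    (M : Matrix (Fin N ⊕ W) (Fin N ⊕ W) R) (I J : Finset (Fin N)) :
    f (minorDet M I J) = minorDet (M.map f) I J := by
  unfold minorDet
  split_ifs with h
  · rw [RingHom.map_det]
    rfl
  · simp

lemma link2 {N a : ℕ} (hN : N = a + 3) (r g : Fin (a+1) → Fin N) (hr : StrictMono r)
    (hg : StrictMono g) {i j k l m : Fin N} (hij : i ≠ j) (hkl : k ≠ l) (hmi : m ≠ i) (hmj : m ≠ j)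
    (hmk : m ≠ k) (hml : m ≠ l)
    (hri : ∀ s, r s ≠ i) (hrj : ∀ s, r s ≠ j) (hgk : ∀ s, g s ≠ k) (hgl : ∀ s, g s ≠ l)
    (p : Fin (a+1)) (hrp : r p = m) (hgp : g p = m) :
    ∃ u : ℤˣ, ∀ M : Matrix (Fin N ⊕ W) (Fin N ⊕ W) R,
      minorDet M {i, j} {k, l} = ((u : ℤ) : R) *
        (rep (rep M (Sum.inl i) (Sum.inl l)) (Sum.inl j) (Sum.inl k)).det ∧
      minorDet M {i, j, m} {k, l, m} = ((u : ℤ) : R) *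
        (rep (rep (rep M (Sum.inl i) (Sum.inl l)) (Sum.inl j) (Sum.inl k)) (Sum.inl m) (Sum.inl m)).det := by
  obtain ⟨u, hu⟩ := minor_two (R := R) (W := W) (N := N) (a := a + 1) (by omega) r g hr.injective hg.injective
    hij hkl.symm hri hrj hgk hgl
  refine ⟨u, fun M => ⟨?_, ?_⟩⟩
  · rw [minorDet_eq M {i, j} {k, l} r g hr hg (by simp [hri, hrj]) (by simp [hgk, hgl])
      (by rw [Finset.card_compl, Finset.card_pair hij, Fintype.card_fin]; omega)
      (by rw [Finset.card_compl, Finset.card_pair hkl, Fintype.card_fin]; omega), hu]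
  · have hrm : ∀ s, r (p.succAbove s) ≠ m := fun s h =>
      Fin.succAbove_ne p s (hr.injective (h.trans hrp.symm))
    have hgm : ∀ s, g (p.succAbove s) ≠ m := fun s h =>
      Fin.succAbove_ne p s (hg.injective (h.trans hgp.symm))
    rw [minorDet_eq M {i, j, m} {k, l, m} (r ∘ p.succAbove) (g ∘ p.succAbove)
      (hr.comp (Fin.strictMono_succAbove p)) (hg.comp (Fin.strictMono_succAbove p))
      (by simp [hri, hrj, hrm]) (by simp [hgk, hgl, hgm])
      (by rw [Finset.card_compl, Finset.card_insert_of_notMem (by simp [hij, hmi.symm]),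
            Finset.card_pair hmj.symm, Fintype.card_fin]; omega)
      (by rw [Finset.card_compl, Finset.card_insert_of_notMem (by simp [hkl, hmk.symm]),
            Finset.card_pair hml.symm, Fintype.card_fin]; omega)]
    have e1 : M.submatrix (Sum.map (r ∘ p.succAbove) id) (Sum.map (g ∘ p.succAbove) id) =
        (M.submatrix (Sum.map r id) (Sum.map g id)).submatrix (Sum.map p.succAbove id)
          (Sum.map p.succAbove id) := by
      ext x y
      rcases x with x | x <;> rcases y with y | y <;> rfl
    have e2 : rep (M.submatrix (Sum.map r id) (Sum.map g id)) (Sum.inl p) (Sum.inl p) =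
        (rep M (Sum.inl m) (Sum.inl m)).submatrix (Sum.map r id) (Sum.map g id) := by
      ext x y
      have h1 : ∀ x, r x = m ↔ x = p := fun x => by rw [← hrp, hr.injective.eq_iff]
      have h2 : ∀ x, g x = m ↔ x = p := fun x => by rw [← hgp, hg.injective.eq_iff]
      rcases x with x | x <;> rcases y with y | y <;> simp [rep_apply, h1, h2]
    rw [e1, minor_one, e2, hu, rep_comm M (i := Sum.inl m) (j := Sum.inl i) (by simpa using hmi),
      rep_comm _ (i := Sum.inl m) (j := Sum.inl j) (by simpa using hmj)]

/-- the sign variant -/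
def NM {E W R : Type*} [CommRing R] [DecidableEq E] (B : Matrix E W R) (x : E → R) :
    Matrix (E ⊕ W) (E ⊕ W) R :=
  fromBlocks (diagonal x) B (-Bᵀ) 0

lemma NM_minor {N : ℕ} (B : Matrix (Fin N) W R) (x : Fin N → R) (I J : Finset (Fin N)) :
    minorDet (NM B x) I J = (-1) ^ (Fintype.card W) * minorDet (PM B x) I J := by
  unfold minorDet
  split_ifs with h
  · set A := of fun (r c : Fin (Iᶜ : Finset (Fin N)).card ⊕ W) =>
        PM B x (Sum.map (fun i => ((Iᶜ.orderIsoOfFin rfl i : {x // x ∈ (Iᶜ : Finset (Fin N))}) : Fin N)) id r)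
          (Sum.map (fun j => ((Jᶜ.orderIsoOfFin h j : {x // x ∈ (Jᶜ : Finset (Fin N))}) : Fin N)) id c) with hA
    have := det_mul_column (Sum.elim (fun _ => 1) (fun _ => -1)) A
    rw [Fintype.prod_sum_type] at this
    simp only [Sum.elim_inl, Sum.elim_inr, Finset.prod_const, one_pow, one_mul, Finset.card_univ] at this
    rw [← this]
    congr 1
    ext a b
    rcases a with a | a <;> rcases b with b | b <;> simp [hA, NM, PM]
  · simp

lemma NM_det {E : Type*} [Fintype E] [DecidableEq E] (B : Matrix E W R) (x : E → R) :
    (NM B x).det = (-1) ^ (Fintype.card W) * (PM B x).det := by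
  have := det_mul_column (Sum.elim (fun _ => 1) (fun _ => -1)) (PM B x)
  rw [Fintype.prod_sum_type] at this
  simp only [Sum.elim_inl, Sum.elim_inr, Finset.prod_const, one_pow, one_mul, Finset.card_univ] at this
  rw [← this]
  congr 1
  ext a b
  rcases a with a | a <;> rcases b with b | b <;> simp [NM, PM]

end link

section fz
variable {V : Type*} [Fintype V] [DecidableEq V] {N : ℕ}
    (G : SimpleGraph V) (ε : Fin N ≃ G.edgeSet) (src tgt : G.edgeSet → V) (v₀ : V)

/-- incidence matrix -/
def inc (R : Type*) [CommRing R] : Matrix (Fin N) {u : V // u ≠ v₀} R :=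
  of fun i w => if src (ε i) = ↑w then 1 else if tgt (ε i) = ↑w then -1 else 0

lemma MG_map {S : Type*} [CommRing S] (f : MvPolynomial (Fin N) ℤ →+* S) (T : Finset (Fin N))
    (hT : ∀ e ∈ T, f (MvPolynomial.X e) = 0) :
    (MGmatrix G ε src tgt v₀ T).map f = NM (inc G ε src tgt v₀ S) (fun e => f (MvPolynomial.X e)) := by
  ext a b
  rcases a with a | a <;> rcases b with b | b
  · simp only [MGmatrix, NM, map_apply, fromBlocks_apply₁₁, diagonal_apply]
    by_cases h1 : a = b
    · subst h1
      by_cases h2 : a ∈ T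
      · simp [h2, hT a h2]
      · simp [h2]
    · simp [h1]
  · simp only [MGmatrix, NM, map_apply, fromBlocks_apply₁₂, inc, of_apply]
    split_ifs <;> simp
  · simp only [MGmatrix, NM, map_apply, fromBlocks_apply₂₁, inc, of_apply, Matrix.neg_apply, transpose_apply]
    split_ifs <;> simp
  · simp [MGmatrix, NM]

lemma five_link (hN : 5 ≤ N) {S : Type*} [CommRing S] (f : MvPolynomial (Fin N) ℤ →+* S)
    {i j k l m : Fin N} (hi : (i : ℕ) = 0) (hj : (j : ℕ) = 1) (hk : (k : ℕ) = 2)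
    (hl : (l : ℕ) = 3) (hm : (m : ℕ) = 4) (h0 : f (MvPolynomial.X m) = 0) :
    ∃ u : ℤˣ, ∀ M, M = PM (inc G ε src tgt v₀ S) (fun e => f (MvPolynomial.X e)) →
      f (fiveInv G ε src tgt v₀ i j k l m) = ((u : ℤ) : S) * (
        (rep (rep (rep M (Sum.inl i) (Sum.inl l)) (Sum.inl j) (Sum.inl k)) (Sum.inl m) (Sum.inl m)).det
        * (rep (rep M (Sum.inl i) (Sum.inl l)) (Sum.inl k) (Sum.inl j)).det
        - (rep (rep M (Sum.inl i) (Sum.inl l)) (Sum.inl j) (Sum.inl k)).det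
        * (rep (rep (rep M (Sum.inl i) (Sum.inl l)) (Sum.inl k) (Sum.inl j)) (Sum.inl m) (Sum.inl m)).det) := by
  obtain ⟨a, rfl⟩ : ∃ a, N = a + 5 := ⟨N - 5, by omega⟩
  let r01 : Fin (a+2+1) → Fin (a+5) := fun p => ⟨p + 2, by omega⟩
  let r23 : Fin (a+2+1) → Fin (a+5) := fun p => ⟨if (p : ℕ) < 2 then p else p + 2, by split_ifs <;> omega⟩
  let r02 : Fin (a+2+1) → Fin (a+5) := fun p => ⟨if (p : ℕ) < 1 then p + 1 else p + 2, by split_ifs <;> omega⟩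
  let r13 : Fin (a+2+1) → Fin (a+5) := fun p =>
    ⟨if (p : ℕ) < 1 then p else if (p : ℕ) < 2 then p + 1 else p + 2, by split_ifs <;> omega⟩
  have s01 : StrictMono r01 := fun p p' h => by
    have h' : (p : ℕ) < p' := h
    simp only [r01, Fin.lt_def]; omega
  have s23 : StrictMono r23 := fun p p' h => by
    have h' : (p : ℕ) < p' := h
    simp only [r23, Fin.lt_def]; split_ifs <;> omega
  have s02 : StrictMono r02 := fun p p' h => by
    have h' : (p : ℕ) < p' := h
    simp only [r02, Fin.lt_def]; split_ifs <;> omega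
  have s13 : StrictMono r13 := fun p p' h => by
    have h' : (p : ℕ) < p' := h
    simp only [r13, Fin.lt_def]; split_ifs <;> omega
  have hij : i ≠ j := fun h => by rw [h] at hi; omega
  have hik : i ≠ k := fun h => by rw [h] at hi; omega
  have hjl : j ≠ l := fun h => by rw [h] at hj; omega
  have hkl : k ≠ l := fun h => by rw [h] at hk; omega
  have hmi : m ≠ i := fun h => by rw [h] at hm; omega
  have hmj : m ≠ j := fun h => by rw [h] at hm; omega
  have hmk : m ≠ k := fun h => by rw [h] at hm; omega
  have hml : m ≠ l := fun h => by rw [h] at hm; omega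
  obtain ⟨u, hu⟩ := link2 (R := S) (W := {u : V // u ≠ v₀}) (N := a + 5) (a := a + 2) (by omega) r01 r23 s01 s23
    hij hkl hmi hmj hmk hml
    (fun s h => by have := congrArg Fin.val h; simp only [r01] at this; omega)
    (fun s h => by have := congrArg Fin.val h; simp only [r01] at this; omega)
    (fun s h => by have := congrArg Fin.val h; simp only [r23] at this; split_ifs at this <;> omega)
    (fun s h => by have := congrArg Fin.val h; simp only [r23] at this; split_ifs at this <;> omega)
    ⟨2, by omega⟩ (by ext; simp [r01, hm]) (by ext; simp [r23, hm])
  obtain ⟨v, hv⟩ := link2 (R := S) (W := {u : V // u ≠ v₀}) (N := a + 5) (a := a + 2) (by omega) r02 r13 s02 s13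
    hik hjl hmi hmk hmj hml
    (fun s h => by have := congrArg Fin.val h; simp only [r02] at this; split_ifs at this <;> omega)
    (fun s h => by have := congrArg Fin.val h; simp only [r02] at this; split_ifs at this <;> omega)
    (fun s h => by have := congrArg Fin.val h; simp only [r13] at this; split_ifs at this <;> omega)
    (fun s h => by have := congrArg Fin.val h; simp only [r13] at this; split_ifs at this <;> omega)
    ⟨2, by omega⟩ (by ext; simp [r02, hm]) (by ext; simp [r13, hm])
  refine ⟨-(u * v), fun M hM => ?_⟩
  have hs : ((-1 : S) ^ Fintype.card {u : V // u ≠ v₀}) * ((-1 : S) ^ Fintype.card {u : V // u ≠ v₀}) = 1 := by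
    rw [← pow_add, ← two_mul, pow_mul]; simp
  rw [fiveInv, det_fin_two]
  simp only [of_apply, cons_val', cons_val_zero, cons_val_one, dodgson, map_sub, map_mul, minorDet_map]
  rw [MG_map G ε src tgt v₀ f {m} (by simpa using h0), MG_map G ε src tgt v₀ f ∅ (by simp)]
  simp only [cons_val_fin_one, NM_minor, ← hM, (hu M).1, (hu M).2, (hv M).1, (hv M).2]
  push_cast
  linear_combination ((u : ℤ) : S) * ((v : ℤ) : S) *
    ((rep (rep M (Sum.inl i) (Sum.inl l)) (Sum.inl j) (Sum.inl k)).det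
        * (rep (rep (rep M (Sum.inl i) (Sum.inl l)) (Sum.inl k) (Sum.inl j)) (Sum.inl m) (Sum.inl m)).det
     - (rep (rep (rep M (Sum.inl i) (Sum.inl l)) (Sum.inl j) (Sum.inl k)) (Sum.inl m) (Sum.inl m)).det
        * (rep (rep M (Sum.inl i) (Sum.inl l)) (Sum.inl k) (Sum.inl j)).det) * hs

end fz
end AxK

set_option linter.unusedSectionVars false

namespace AxK

section expand
variable {E W R : Type*} [CommRing R] [Fintype E] [DecidableEq E] [Fintype W] [DecidableEq W]

lemma PM_expand (B : Matrix E W R) (x : E → R) :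
    (PM B x).det = ∑ T : Finset E, (∏ e ∈ T, x e) * (repR T (PM B 0)).det := by
  let c : E ⊕ W → R := Sum.elim x 0
  obtain ⟨P0, hP0⟩ : ∃ P0 : E ⊕ W → E ⊕ W → R, P0 = fun a b => PM B 0 a b := ⟨_, rfl⟩
  obtain ⟨I1, hI1⟩ : ∃ I1 : E ⊕ W → E ⊕ W → R, I1 = fun a b => (1 : Matrix (E ⊕ W) (E ⊕ W) R) a b := ⟨_, rfl⟩
  have h0 : PM B x = of ((fun i => c i • I1 i) + P0) := by
    ext a b
    rw [of_apply, hP0, hI1]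
    rcases a with a | a <;> rcases b with b | b <;>
      simp [PM, c, diagonal_apply, Matrix.one_apply]
  have h1 : (PM B x).det = detRowAlternating.toMultilinearMap ((fun i => c i • I1 i) + P0) := by rw [h0]; rfl
  rw [h1, MultilinearMap.map_add_univ]
  have h2 : ∀ s : Finset (E ⊕ W), detRowAlternating.toMultilinearMap
      (s.piecewise (fun i => c i • I1 i) P0) =
      (∏ i ∈ s, c i) * det (of (s.piecewise I1 P0)) := by
    intro s
    have := MultilinearMap.map_piecewise_smul (detRowAlternating (n := E ⊕ W) (R := R)).toMultilinearMap c
      (s.piecewise I1 P0) s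
    rw [smul_eq_mul] at this
    refine Eq.trans ?_ this
    congr 1
    funext i
    by_cases hi : i ∈ s <;> simp [hi]
  simp only [h2]
  let emb : Finset E ↪ Finset (E ⊕ W) := ⟨fun T => T.map ⟨Sum.inl, Sum.inl_injective⟩, Finset.map_injective _⟩
  have h3 : ∀ s : Finset (E ⊕ W), s ∉ Finset.univ.map emb →
      (∏ i ∈ s, c i) * det (of (s.piecewise I1 P0)) = 0 := by
    intro s hs
    have : ∃ w, Sum.inr w ∈ s := by
      by_contra hc
      push Not at hc
      apply hs
      simp only [Finset.mem_map, Finset.mem_univ, true_and]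
      refine ⟨Finset.univ.filter fun e => Sum.inl e ∈ s, ?_⟩
      ext (a | a)
      · simp [emb]
      · simp [emb, hc a]
    obtain ⟨w, hw⟩ := this
    rw [Finset.prod_eq_zero hw (by simp [c]), zero_mul]
  rw [← Finset.sum_subset (Finset.subset_univ (Finset.univ.map emb)) (fun s _ hs => h3 s hs),
    Finset.sum_map]
  refine Finset.sum_congr rfl fun T _ => ?_
  congr 1
  · simp [emb, c]
  · congr 1
    ext a b
    have : (a ∈ emb T) ↔ ∃ e ∈ T, a = Sum.inl e := by simp [emb, eq_comm]
    by_cases h : a ∈ emb T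
    · have h' := this.1 h
      simp only [of_apply, repR, h', if_true]
      rw [Finset.piecewise_eq_of_mem _ _ _ h, hI1]
    · simp only [of_apply, repR]
      rw [Finset.piecewise_eq_of_notMem _ _ _ h, hP0, if_neg (fun h' => h (this.2 h'))]

noncomputable def swapC (W R : Type*) [CommRing R] [Fintype W] [DecidableEq W] : R :=
  (fromBlocks 0 1 1 0 : Matrix (W ⊕ W) (W ⊕ W) R).det

lemma swapC_sq : swapC W R * swapC W R = 1 := by
  rw [swapC, ← det_mul, fromBlocks_multiply]
  simp

lemma PM_zero_sq (e : W ≃ E) (B : Matrix E W R) :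
    (PM B 0).det = swapC W R * ((B.submatrix e id).det * (B.submatrix e id).det) := by
  rw [← det_submatrix_equiv_self (Equiv.sumCongr e (Equiv.refl W))]
  have : (PM B 0).submatrix (Equiv.sumCongr e (Equiv.refl W)) (Equiv.sumCongr e (Equiv.refl W)) =
      fromBlocks (B.submatrix e id) 0 0 (B.submatrix e id)ᵀ * fromBlocks 0 1 1 0 := by
    rw [fromBlocks_multiply]
    ext a b
    rcases a with a | a <;> rcases b with b | b <;> simp [PM]
  rw [this, det_mul, det_fromBlocks_zero₂₁, det_transpose, swapC]
  ring

end expand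

section ker
variable {E W F : Type*} [Field F] [Fintype E] [DecidableEq E] [Fintype W] [DecidableEq W]

lemma PM_ker1 (B : Matrix E W F) (v : W → F) (hv : v ≠ 0) (h : B *ᵥ v = 0) : (PM B 0).det = 0 := by
  refine exists_mulVec_eq_zero_iff.1 ⟨Sum.elim 0 v, ?_, ?_⟩
  · intro h0
    apply hv
    funext w
    exact congrFun h0 (Sum.inr w)
  · rw [PM, fromBlocks_mulVec]
    have h1 : (Sum.elim (0 : E → F) v) ∘ Sum.inl = 0 := rfl
    have h2 : (Sum.elim (0 : E → F) v) ∘ Sum.inr = v := rfl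
    rw [h1, h2, h]
    simp

lemma PM_ker2 (B : Matrix E W F) (v : E → F) (hv : v ≠ 0) (h : Bᵀ *ᵥ v = 0) : (PM B 0).det = 0 := by
  refine exists_mulVec_eq_zero_iff.1 ⟨Sum.elim v 0, ?_, ?_⟩
  · intro h0
    apply hv
    funext w
    exact congrFun h0 (Sum.inl w)
  · rw [PM, fromBlocks_mulVec]
    have h1 : (Sum.elim v (0 : W → F)) ∘ Sum.inl = v := rfl
    have h2 : (Sum.elim v (0 : W → F)) ∘ Sum.inr = 0 := rfl
    rw [h1, h2, h]
    simp

lemma exists_ker_card {A C : Type*} [Fintype A] [Fintype C] (B : Matrix A C F)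
    (h : Fintype.card A < Fintype.card C) : ∃ v, v ≠ 0 ∧ B *ᵥ v = 0 := by
  have := LinearMap.ker_ne_bot_of_finrank_lt (f := B.mulVecLin) (by simpa using h)
  obtain ⟨v, hv, hv0⟩ := (Submodule.ne_bot_iff _).1 this
  exact ⟨v, hv0, by simpa using hv⟩

lemma PM_card (B : Matrix E W F) (h : Fintype.card E ≠ Fintype.card W) : (PM B 0).det = 0 := by
  rcases lt_or_gt_of_ne h with h | h
  · obtain ⟨v, hv, hv0⟩ := exists_ker_card B h
    exact PM_ker1 B v hv hv0
  · obtain ⟨v, hv, hv0⟩ := exists_ker_card Bᵀ h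
    exact PM_ker2 B v hv hv0
end ker
end AxK

set_option linter.unusedSectionVars false

namespace AxK

section graph
variable {V E : Type*} [Fintype V] [DecidableEq V] [Fintype E] [DecidableEq E]

def incM (s t : E → V) (v₀ : V) (R : Type*) [CommRing R] : Matrix E {u : V // u ≠ v₀} R :=
  of fun i w => if s i = ↑w then 1 else if t i = ↑w then -1 else 0

lemma incM_mulVec (s t : E → V) (hst : ∀ e, s e ≠ t e) (v₀ : V) {R : Type*} [CommRing R] (v : V → R)
    (hv : v v₀ = 0) (e : E) :
    (incM s t v₀ R *ᵥ (fun w => v w.1)) e = v (s e) - v (t e) := by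
  have h1 : ∀ w : {u : V // u ≠ v₀}, incM s t v₀ R e w * v w.1 =
      (if s e = w.1 then v w.1 else 0) - (if t e = w.1 then v w.1 else 0) := by
    intro w
    have := hst e
    simp only [incM, of_apply]
    by_cases ha : s e = w.1
    · have hb : ¬ t e = w.1 := fun h => this (ha.trans h.symm)
      simp [ha, hb]
    · by_cases hb : t e = w.1 <;> simp [ha, hb]
  have h2 : ∀ u : V, ∑ w : {u : V // u ≠ v₀}, (if u = w.1 then v w.1 else 0) = v u := by
    intro u
    by_cases hu : u = v₀
    · subst hu
      rw [hv]
      refine Finset.sum_eq_zero fun w _ => ?_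
      rw [if_neg (fun h => w.2 h.symm)]
    · rw [Finset.sum_eq_single ⟨u, hu⟩]
      · simp
      · intro w _ hw
        rw [if_neg (fun h => hw (Subtype.ext h.symm))]
      · simp
  simp only [mulVec, dotProduct, h1, Finset.sum_sub_distrib, h2]

variable (H : SimpleGraph V) (s t : E → V) (v₀ : V)

lemma ker_of_connected (hH : H.Connected) (hadj : ∀ u v, H.Adj u v → ∃ e, s(u, v) = s(s e, t e))
    (hst : ∀ e, s e ≠ t e) {R : Type*} [CommRing R] (v : {u : V // u ≠ v₀} → R)
    (h : incM s t v₀ R *ᵥ v = 0) : v = 0 := by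
  let v' : V → R := fun u => if hu : u ≠ v₀ then v ⟨u, hu⟩ else 0
  have hv' : v = fun w => v' w.1 := by
    funext w; simp [v', w.2]
  have h0 : v' v₀ = 0 := by simp [v']
  rw [hv'] at h
  have he : ∀ e, v' (s e) = v' (t e) := fun e => by
    have := congrFun h e
    rw [incM_mulVec s t hst v₀ v' h0] at this
    exact sub_eq_zero.1 this
  have hA : ∀ a b, H.Adj a b → v' a = v' b := by
    intro a b hab
    obtain ⟨e, h⟩ := hadj a b hab
    rcases Sym2.eq_iff.1 h with ⟨h1, h2⟩ | ⟨h1, h2⟩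
    · rw [h1, h2, he]
    · rw [h1, h2, he]
  have hR : ∀ a b, H.Walk a b → v' a = v' b := by
    intro a b p
    induction p with
    | nil => rfl
    | cons h _ ih => exact (hA _ _ h).trans ih
  rw [hv']
  funext w
  obtain ⟨p⟩ := hH.preconnected w.1 v₀
  rw [hR _ _ p, h0]
  rfl

lemma ker_of_not_connected (hH : ¬ H.Connected) (hadj : ∀ e, H.Adj (s e) (t e))
    (R : Type*) [CommRing R] [Nontrivial R] :
    ∃ v, v ≠ 0 ∧ incM s t v₀ R *ᵥ v = 0 := by
  let v' : V → R := fun u => if H.Reachable v₀ u then 0 else 1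
  have h0 : v' v₀ = 0 := by simp [v']
  refine ⟨fun w => v' w.1, ?_, ?_⟩
  · intro h
    apply hH
    have : ∀ u, H.Reachable v₀ u := by
      intro u
      by_cases hu : u = v₀
      · subst hu; rfl
      · have := congrFun h ⟨u, hu⟩
        by_contra hc
        simp [v', hc] at this
    have hne : Nonempty V := ⟨v₀⟩
    exact ⟨fun a b => (this a).symm.trans (this b)⟩
  · funext e
    rw [incM_mulVec s t (fun e => (hadj e).ne) v₀ v' h0]
    have : H.Reachable v₀ (s e) ↔ H.Reachable v₀ (t e) :=
      ⟨fun h => h.trans (hadj e).reachable, fun h => h.trans (hadj e).symm.reachable⟩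
    simp [v', this]

lemma incM_map {R S : Type*} [CommRing R] [CommRing S] (f : R →+* S) :
    (incM s t v₀ R).map f = incM s t v₀ S := by
  ext a b
  simp only [incM, map_apply, of_apply]
  split_ifs <;> simp

lemma det_of_connected (hH : H.Connected) (hadj : ∀ u v, H.Adj u v → ∃ e, s(u, v) = s(s e, t e))
    (hst : ∀ e, s e ≠ t e) (r : {u : V // u ≠ v₀} ≃ E) (R : Type*) [CommRing R] :
    ((incM s t v₀ R).submatrix r id).det * ((incM s t v₀ R).submatrix r id).det = 1 := by
  have hZ : ((incM s t v₀ ℤ).submatrix r id).det.natAbs = 1 := by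
    by_contra hc
    obtain ⟨p, hp, hpd⟩ := Nat.exists_prime_and_dvd hc
    have : Fact p.Prime := ⟨hp⟩
    have h1 : ((incM s t v₀ (ZMod p)).submatrix r id).det = 0 := by
      have : ((incM s t v₀ (ZMod p)).submatrix r id) =
        ((incM s t v₀ ℤ).submatrix r id).map (Int.castRingHom (ZMod p)) := by
        rw [← submatrix_map, incM_map]
      rw [this, ← RingHom.mapMatrix_apply, ← RingHom.map_det]
      exact (ZMod.intCast_zmod_eq_zero_iff_dvd _ _).2 (Int.natCast_dvd.2 hpd)
    obtain ⟨v, hv, hv0⟩ := exists_mulVec_eq_zero_iff.2 h1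
    apply hv
    refine ker_of_connected H s t v₀ hH hadj hst v ?_
    funext e
    have := congrFun hv0 (r.symm e)
    simpa [mulVec, dotProduct] using this
  have : ((incM s t v₀ R).submatrix r id) =
      ((incM s t v₀ ℤ).submatrix r id).map (Int.castRingHom R) := by
    rw [← submatrix_map, incM_map]
  have this2 := Int.natAbs_mul_self' ((incM s t v₀ ℤ).submatrix r id).det
  rw [hZ] at this2
  rw [this, ← RingHom.mapMatrix_apply, ← RingHom.map_det, ← map_mul, ← this2]
  simp

lemma tree_det (hadj : ∀ u v, H.Adj u v ↔ ∃ e, s(u, v) = s(s e, t e))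
    (hinj : ∀ e e', s(s e, t e) = s(s e', t e') → e = e')
    (K : Type*) [Field K] :
    (PM (incM s t v₀ K) 0).det = if H.IsTree then swapC {u : V // u ≠ v₀} K else 0 := by
  have hadj' : ∀ e, H.Adj (s e) (t e) := fun e => (hadj _ _).2 ⟨e, rfl⟩
  have hst : ∀ e, s e ≠ t e := fun e => (hadj' e).ne
  have hcE : Nat.card H.edgeSet = Fintype.card E := by
    rw [← Nat.card_eq_fintype_card]
    symm
    refine Nat.card_congr (Equiv.ofBijective (fun e => ⟨s(s e, t e), hadj' e⟩) ⟨?_, ?_⟩)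
    · intro e e' h
      exact hinj _ _ (Subtype.ext_iff.1 h)
    · rintro ⟨z, hz⟩
      induction z using Sym2.ind with
      | _ u v =>
        obtain ⟨e, he⟩ := (hadj u v).1 hz
        exact ⟨e, Subtype.ext he.symm⟩
  have hcW : Fintype.card {u : V // u ≠ v₀} + 1 = Fintype.card V := by
    have : 0 < Fintype.card V := Fintype.card_pos_iff.2 ⟨v₀⟩
    rw [Fintype.card_subtype_compl, Fintype.card_subtype_eq]; omega
  have htree : H.IsTree ↔ H.Connected ∧ Fintype.card E = Fintype.card {u : V // u ≠ v₀} := by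
    rw [SimpleGraph.isTree_iff_connected_and_card, hcE, Nat.card_eq_fintype_card, ← hcW]
    simp
  by_cases hT : H.IsTree
  · rw [if_pos hT]
    obtain ⟨h1, h2⟩ := htree.1 hT
    rw [PM_zero_sq (Fintype.equivOfCardEq h2.symm),
      det_of_connected H s t v₀ h1 (fun u v => (hadj u v).1) hst, mul_one]
  · rw [if_neg hT]
    by_cases h2 : Fintype.card E = Fintype.card {u : V // u ≠ v₀}
    · have h1 : ¬ H.Connected := fun h => hT (htree.2 ⟨h, h2⟩)
      obtain ⟨v, hv, hv0⟩ := ker_of_not_connected H s t v₀ h1 hadj' K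
      exact PM_ker1 _ v hv hv0
    · exact PM_card _ h2

end graph

section final
variable {V : Type*} [Fintype V] [DecidableEq V] {N : ℕ}
    (G : SimpleGraph V) (ε : Fin N ≃ G.edgeSet) (src tgt : G.edgeSet → V) (v₀ : V)

lemma matrix_tree (ho : IsOrientation G src tgt) {K : Type} [Field K] (x : Fin N → K) :
    (PM (inc G ε src tgt v₀ K) x).det =
      swapC {u : V // u ≠ v₀} K * MvPolynomial.aeval (fun e => x (ε.symm e)) (graphPoly G) := by
  rw [PM_expand, graphPoly, map_sum, Finset.mul_sum]
  let iF : Fintype G.edgeSet := Fintype.ofFinite _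
  let φ : Finset (Fin N) ≃ Finset G.edgeSet :=
    (Equiv.finsetCongr ε).trans (Equiv.ofBijective (fun T => Tᶜ) compl_bijective)
  refine Fintype.sum_equiv φ _ _ ?_
  intro T
  rw [repR_det]
  have h0 : (fun e : {e // e ∉ T} => (0 : Fin N → K) e.1) = 0 := rfl
  rw [h0]
  have h1 : (inc G ε src tgt v₀ K).submatrix (fun e : {e // e ∉ T} => e.1) id =
    incM (fun e : {e // e ∉ T} => src (ε e.1)) (fun e => tgt (ε e.1)) v₀ K := rfl
  rw [h1, tree_det (SimpleGraph.fromEdgeSet (Subtype.val '' (φ T : Set G.edgeSet)))]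
  · split_ifs with h
    · rw [map_prod]
      have : (φ T)ᶜ = T.map ε.toEmbedding := by
        simp [φ, Equiv.finsetCongr_apply]
      have h2 : (∏ e ∈ (φ T)ᶜ, MvPolynomial.aeval (fun e => x (ε.symm e)) (MvPolynomial.X e : MvPolynomial G.edgeSet ℤ)) = ∏ e ∈ T, x e := by
        rw [this, Finset.prod_map]
        simp
      rw [← h2, mul_comm]
      congr!
    · simp
  · intro u v
    have hm : ∀ e, e ∈ φ T ↔ ε.symm e ∉ T := by
      intro e
      simp [φ, Equiv.finsetCongr_apply]
    rw [SimpleGraph.fromEdgeSet_adj]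
    constructor
    · rintro ⟨⟨e, he, h⟩, _⟩
      refine ⟨⟨ε.symm e, (hm e).1 he⟩, ?_⟩
      simp only [Equiv.apply_symm_apply]
      rw [← h, ho e]
    · rintro ⟨⟨e, he⟩, h⟩
      have h3 : (ε e : Sym2 V) = s(u, v) := by rw [h, ho]
      refine ⟨⟨ε e, ?_, h3⟩, ?_⟩
      · exact (hm _).2 (by simpa using he)
      · have := (ε e).2
        rw [h3] at this
        exact G.ne_of_adj this
  · intro e e' h
    have : (ε e.1 : Sym2 V) = ε e'.1 := by rw [ho, ho]; exact h
    exact Subtype.ext (ε.injective (Subtype.ext this))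

lemma Xcount_eq (ho : IsOrientation G src tgt) {K : Type} [Field K] [Fintype K] :
    (Xcount G K : ℤ) = cnt ∅ (fun x : Fin N → K => (PM (inc G ε src tgt v₀ K) x).det = 0) := by
  have hc : swapC {u : V // u ≠ v₀} K ≠ 0 := fun h => by
    have := swapC_sq (W := {u : V // u ≠ v₀}) (R := K)
    rw [h] at this; simp at this
  simp only [matrix_tree G ε src tgt v₀ ho, mul_eq_zero, hc, false_or]
  rw [Xcount, cnt]
  simp only [Finset.notMem_empty, false_imp_iff, implies_true, true_and]
  rw [Finset.sum_boole, ← Fintype.card_subtype, ← Nat.card_eq_fintype_card]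
  rw [Nat.cast_inj]
  refine Nat.card_congr ?_
  refine Equiv.subtypeEquiv (Equiv.arrowCongr ε.symm (Equiv.refl K)) ?_
  intro x
  have : (fun e => (Equiv.arrowCongr ε.symm (Equiv.refl K)) x (ε.symm e)) = x := by
    funext e; simp [Equiv.arrowCongr]
  rw [this]

end final
end AxK

set_option linter.unusedSectionVars false

namespace AxK

section deg
open MvPolynomial
variable {s : Type*}

lemma coeff_lin_a {a b : MvPolynomial s ℤ} {e : s} (hb : e ∉ b.vars) (u : s →₀ ℕ) :
    coeff (u + Finsupp.single e 1) (a * X e + b) = coeff u a := by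
  rw [coeff_add, coeff_mul_X]
  have : coeff (u + Finsupp.single e 1) b = 0 := by
    by_contra h
    apply hb
    rw [mem_vars_iff_mem_support]
    exact ⟨_, mem_support_iff.2 h, by simp⟩
  rw [this, add_zero]

lemma coeff_lin_b {a b : MvPolynomial s ℤ} {e : s} (hb : e ∉ b.vars) {u : s →₀ ℕ} (hu : u ∈ b.support) :
    coeff u (a * X e + b) = coeff u b := by
  rw [coeff_add, coeff_mul_X', if_neg, zero_add]
  intro h
  exact hb ((mem_vars_iff_mem_support _).2 ⟨u, hu, h⟩)

lemma lin_zero {a b : MvPolynomial s ℤ} {e : s} (hb : e ∉ b.vars) (h : a * X e + b = 0) :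
    a = 0 ∧ b = 0 := by
  have ha : a = 0 := by
    ext u
    rw [← coeff_lin_a (a := a) hb u, h]; simp
  subst ha
  simpa using h

lemma lin_deg_a {a b : MvPolynomial s ℤ} {e : s} (hb : e ∉ b.vars) (ha : a ≠ 0) :
    a.totalDegree + 1 ≤ (a * X e + b).totalDegree := by
  obtain ⟨u, hu, hd⟩ := Finset.exists_mem_eq_sup a.support (support_nonempty.2 ha)
    (fun m => Multiset.card m.toMultiset)
  have h1 : u + Finsupp.single e 1 ∈ (a * X e + b).support := by
    rw [mem_support_iff, coeff_lin_a hb]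
    exact mem_support_iff.1 hu
  have h2 := le_totalDegree h1
  rw [totalDegree_eq, hd]
  refine le_trans (le_of_eq ?_) h2
  have := Finsupp.card_toMultiset (u + Finsupp.single e 1)
  rw [map_add] at this
  refine Eq.trans ?_ this
  simp

lemma lin_deg_b {a b : MvPolynomial s ℤ} {e : s} (hb : e ∉ b.vars) :
    b.totalDegree ≤ (a * X e + b).totalDegree := by
  refine Finset.sup_le fun u hu => ?_
  refine le_totalDegree ?_
  rw [mem_support_iff, coeff_lin_b hb hu]
  exact mem_support_iff.1 hu

lemma step_deg {a b c d P : MvPolynomial s ℤ} {e : s} (hb : e ∉ b.vars) (hd : e ∉ d.vars)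
    (hP : P = (a * X e + b) * (c * X e + d)) :
    (a * c).totalDegree ≤ P.totalDegree - 2 ∧ (a * d - b * c).totalDegree ≤ P.totalDegree - 1 := by
  by_cases hP0 : P = 0
  · rw [hP0] at hP
    rcases mul_eq_zero.1 hP.symm with h | h
    · obtain ⟨rfl, rfl⟩ := lin_zero hb h
      simp
    · obtain ⟨rfl, rfl⟩ := lin_zero hd h
      simp
  · have hf : a * X e + b ≠ 0 := fun h => hP0 (by rw [hP, h, zero_mul])
    have hg : c * X e + d ≠ 0 := fun h => hP0 (by rw [hP, h, mul_zero])
    have hdeg : P.totalDegree = (a * X e + b).totalDegree + (c * X e + d).totalDegree := by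
      rw [hP, totalDegree_mul_of_isDomain hf hg]
    have hB := lin_deg_b (a := a) hb
    have hD := lin_deg_b (a := c) hd
    have hac : (a * c).totalDegree ≤ P.totalDegree - 2 := by
      by_cases ha : a = 0
      · subst ha; simp
      by_cases hc : c = 0
      · subst hc; simp
      have := lin_deg_a hb ha
      have := lin_deg_a hd hc
      have := totalDegree_mul a c
      omega
    refine ⟨hac, (totalDegree_sub _ _).trans (max_le ?_ ?_)⟩
    · by_cases ha : a = 0
      · subst ha; simp
      have := lin_deg_a hb ha
      have := totalDegree_mul a d
      omega
    · by_cases hc : c = 0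
      · subst hc; simp
      have := lin_deg_a hd hc
      have := totalDegree_mul b c
      omega
end deg

section dod
variable {V : Type*} [Fintype V] [DecidableEq V] {N : ℕ}
    (G : SimpleGraph V) (ε : Fin N ≃ G.edgeSet) (src tgt : G.edgeSet → V) (v₀ : V)

lemma dodgson_deg (I J T : Finset (Fin N)) : (dodgson G ε src tgt v₀ I J T).totalDegree ≤
    (N - I.card) - Fintype.card {u : V // u ≠ v₀} := by
  rw [dodgson, minorDet]
  split_ifs with h
  · refine (Good.deg (T := ∅) ?_).trans (by simp [Finset.card_compl])
    refine ⟨?_, ?_, ?_, ?_, ?_⟩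
    · intro a b; simp [MGmatrix]
    · intro a b
      simp only [MGmatrix, of_apply, Sum.map_inl, Sum.map_inr, fromBlocks_apply₁₂]
      split_ifs <;> simp
    · intro a b
      simp only [MGmatrix, of_apply, Sum.map_inl, Sum.map_inr, fromBlocks_apply₂₁, Matrix.neg_apply,
        transpose_apply, MvPolynomial.totalDegree_neg]
      split_ifs <;> simp
    · intro a b
      simp only [MGmatrix, of_apply, Sum.map_inl, fromBlocks_apply₁₁, diagonal_apply]
      split_ifs <;> simp
    · simp
  · simp

lemma fiveInv_deg (h5 : 5 ≤ N) (hw : N ≤ 2 * Fintype.card {u : V // u ≠ v₀}) {i j k l m : Fin N}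
    (hi : (i : ℕ) = 0) (hj : (j : ℕ) = 1) (hk : (k : ℕ) = 2) (hm : (m : ℕ) = 4) :
    (fiveInv G ε src tgt v₀ i j k l m).totalDegree ≤ N - 5 := by
  rw [fiveInv, det_fin_two_of]
  have hij : i ≠ j := fun h => by rw [h] at hi; omega
  have hik : i ≠ k := fun h => by rw [h] at hi; omega
  have him : i ≠ m := fun h => by rw [h] at hi; omega
  have hjm : j ≠ m := fun h => by rw [h] at hj; omega
  have hkm : k ≠ m := fun h => by rw [h] at hk; omega
  have c1 : ({i, j} : Finset (Fin N)).card = 2 := Finset.card_pair hij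
  have c2 : ({i, k} : Finset (Fin N)).card = 2 := Finset.card_pair hik
  have c3 : ({i, j, m} : Finset (Fin N)).card = 3 := Finset.card_eq_three.2 ⟨i, j, m, hij, him, hjm, rfl⟩
  have c4 : ({i, k, m} : Finset (Fin N)).card = 3 := Finset.card_eq_three.2 ⟨i, k, m, hik, him, hkm, rfl⟩
  have d1 := dodgson_deg G ε src tgt v₀ {i, j} {k, l} {m}
  have d2 := dodgson_deg G ε src tgt v₀ {i, k} {j, l} {m}
  have d3 := dodgson_deg G ε src tgt v₀ {i, j, m} {k, l, m} ∅
  have d4 := dodgson_deg G ε src tgt v₀ {i, k, m} {j, l, m} ∅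
  rw [c1] at d1
  rw [c2] at d2
  rw [c3] at d3
  rw [c4] at d4
  refine (MvPolynomial.totalDegree_sub _ _).trans (max_le ?_ ?_) <;>
    refine (MvPolynomial.totalDegree_mul _ _).trans ?_ <;> omega
end dod

section steps
variable {N : ℕ} {K : Type} [Field K] [Fintype K]

/-- the first `k` indices -/
def ini (N k : ℕ) : Finset (Fin N) := Finset.univ.filter fun i => (i : ℕ) < k

lemma mem_ini {k : ℕ} {i : Fin N} : i ∈ ini N k ↔ (i : ℕ) < k := by simp [ini]

lemma ini_succ {k : ℕ} (hk : k < N) : ini N (k + 1) = insert ⟨k, hk⟩ (ini N k) := by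
  ext i
  rw [Finset.mem_insert, mem_ini, mem_ini, Fin.ext_iff]
  simp only
  omega

lemma card_ini {k : ℕ} (hk : k ≤ N) : (ini N k).card = k := by
  rw [ini, Fin.card_filter_val_lt, min_eq_right hk]

lemma restricted_eq (P : MvPolynomial (Fin N) ℤ) (k : ℕ) :
    (restrictedCount P k K : ℤ) = cnt (ini N k) (fun x : Fin N → K => MvPolynomial.aeval x P = 0) := by
  rw [cnt_eq, restrictedCount, Finset.sum_boole, ← Fintype.card_subtype, ← Nat.card_eq_fintype_card,
    Nat.cast_inj]
  refine Nat.card_congr ?_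
  let r : {i : Fin N // k ≤ (i : ℕ)} ≃ {e // e ∉ ini N k} :=
    Equiv.subtypeEquivRight (fun i => by rw [mem_ini, not_lt])
  refine Equiv.subtypeEquiv (Equiv.arrowCongr r (Equiv.refl K)) ?_
  intro y
  have : (fun i : Fin N => if h : k ≤ (i : ℕ) then y ⟨i, h⟩ else 0) =
      ext0 (ini N k) ((Equiv.arrowCongr r (Equiv.refl K)) y) := by
    funext i
    by_cases h : k ≤ (i : ℕ)
    · have h' : i ∉ ini N k := by rw [mem_ini, not_lt]; exact h
      rw [dif_pos h, ext0, dif_pos h']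
      rfl
    · have h' : ¬ i ∉ ini N k := by rw [mem_ini, not_lt]; exact h
      rw [dif_neg h, ext0, dif_neg h']
  rw [this]

lemma aeval_upd {a : MvPolynomial (Fin N) ℤ} {e : Fin N} (h : e ∉ a.vars) (x : Fin N → K) (t : K) :
    MvPolynomial.aeval (Function.update x e t) a = MvPolynomial.aeval x a := by
  rw [MvPolynomial.aeval_def, MvPolynomial.aeval_def]
  refine MvPolynomial.eval₂Hom_congr' rfl ?_ rfl
  intro i hi _
  rw [Function.update_of_ne]
  rintro rfl
  exact h hi

lemma isPolyDeg_aeval (a : MvPolynomial (Fin N) ℤ) {m : ℕ} (h : a.totalDegree ≤ m) :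
    IsPolyDeg m (fun x : Fin N → K => MvPolynomial.aeval x a) := by
  refine ⟨MvPolynomial.map (Int.castRingHom K) a, (Finset.sup_mono (MvPolynomial.support_map_subset _ _)).trans h, fun x => ?_⟩
  rw [MvPolynomial.eval_map]
  rfl

lemma red_step {k : ℕ} (hk : k < N) (hk2 : k + 1 < N) {P Q a b c d : MvPolynomial (Fin N) ℤ}
    (ha : (⟨k, hk⟩ : Fin N) ∉ a.vars) (hb : (⟨k, hk⟩ : Fin N) ∉ b.vars)
    (hc : (⟨k, hk⟩ : Fin N) ∉ c.vars) (hd : (⟨k, hk⟩ : Fin N) ∉ d.vars)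
    (hP : P = (a * MvPolynomial.X ⟨k, hk⟩ + b) * (c * MvPolynomial.X ⟨k, hk⟩ + d))
    (hQ : Q = a * d - b * c ∨ Q = -(a * d - b * c)) (hdeg : P.totalDegree ≤ N - k) :
    Q.totalDegree ≤ N - (k + 1) ∧
    (Fintype.card K : ℤ) ∣ (restrictedCount P k K : ℤ) + (restrictedCount Q (k + 1) K : ℤ) := by
  obtain ⟨h1, h2⟩ := step_deg hb hd hP
  constructor
  · have : Q.totalDegree = (a * d - b * c).totalDegree := by
      rcases hQ with h | h <;> rw [h]
      rw [MvPolynomial.totalDegree_neg]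
    omega
  · have hQ' : ∀ x : Fin N → K, MvPolynomial.aeval x Q = 0 ↔
        MvPolynomial.aeval x a * MvPolynomial.aeval x d - MvPolynomial.aeval x b * MvPolynomial.aeval x c = 0 := by
      intro x
      rcases hQ with h | h <;> rw [h]
      · rw [map_sub, map_mul, map_mul]
      · rw [map_neg, neg_eq_zero, map_sub, map_mul, map_mul]
    rw [restricted_eq, restricted_eq]
    simp only [hQ', hP, map_mul]
    rw [ini_succ hk]
    have hac : IsPolyDeg (N - k - 2) (fun x : Fin N → K => MvPolynomial.aeval x a * MvPolynomial.aeval x c) := by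
      have := isPolyDeg_aeval (K := K) (a * c) (m := N - k - 2) (by omega)
      simpa only [map_mul] using this
    refine denom_step (ini N k) ⟨k, hk⟩ (by rw [mem_ini]; simp) _ _ _ _ _ _ ?_ ?_ hac ?_
    · intro x t _
      simp [aeval_upd ha, aeval_upd hb]
    · intro x t _
      simp [aeval_upd hc, aeval_upd hd]
    · rw [← ini_succ hk, card_ini (by omega), Fintype.card_fin]
      omega
end steps
end AxK

theorem stmt11 {V : Type*} [Fintype V] [DecidableEq V] {N : ℕ} (G : SimpleGraph V)
    (hG : G.Connected) (hN5 : 5 ≤ N) (ε : Fin N ≃ G.edgeSet)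
    (hh : 2 * ((N : ℤ) - (Fintype.card V : ℤ) + 1) ≤ (N : ℤ))
    (src tgt : G.edgeSet → V) (ho : IsOrientation G src tgt) (v₀ : V)
    (n : ℕ) (hn : n < N) (D : ℕ → MvPolynomial (Fin N) ℤ)
    (hD : IsDenomReduction G ε src tgt v₀ n D)
    (K : Type) [Field K] [Fintype K] :
    (Xcount G K : ℤ) ≡ (-1) ^ n * (Fintype.card K : ℤ) ^ 2 * (restrictedCount (D n) n K : ℤ)
      [ZMOD ((Fintype.card K : ℤ)) ^ 3] := by
  obtain ⟨h5n, -, ⟨h5, hD5⟩, -, hstep⟩ := hD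
  have hcW : Fintype.card {u : V // u ≠ v₀} + 1 = Fintype.card V := by
    have : 0 < Fintype.card V := Fintype.card_pos_iff.2 ⟨v₀⟩
    rw [Fintype.card_subtype_compl, Fintype.card_subtype_eq]; omega
  have hNw : N ≤ 2 * Fintype.card {u : V // u ≠ v₀} := by omega
  obtain ⟨i, hi⟩ : ∃ i : Fin N, i = ⟨0, by omega⟩ := ⟨_, rfl⟩
  obtain ⟨j, hj⟩ : ∃ i : Fin N, i = ⟨1, by omega⟩ := ⟨_, rfl⟩
  obtain ⟨k, hk⟩ : ∃ i : Fin N, i = ⟨2, by omega⟩ := ⟨_, rfl⟩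
  obtain ⟨l, hl⟩ : ∃ i : Fin N, i = ⟨3, by omega⟩ := ⟨_, rfl⟩
  obtain ⟨m, hm⟩ : ∃ i : Fin N, i = ⟨4, by omega⟩ := ⟨_, rfl⟩
  rw [← hi, ← hj, ← hk, ← hl, ← hm] at hD5
  have vi : (i : ℕ) = 0 := by rw [hi]
  have vj : (j : ℕ) = 1 := by rw [hj]
  have vk : (k : ℕ) = 2 := by rw [hk]
  have vl : (l : ℕ) = 3 := by rw [hl]
  have vm : (m : ℕ) = 4 := by rw [hm]
  have hdeg5 : (D 5).totalDegree ≤ N - 5 := by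
    have := AxK.fiveInv_deg G ε src tgt v₀ h5 hNw (l := l) vi vj vk vm
    rcases hD5 with h | h <;> rw [h]
    · exact this
    · rw [MvPolynomial.totalDegree_neg]; exact this
  have hF : ({m, k, j, i, l} : Finset (Fin N)) = AxK.ini N 5 := by
    ext a
    simp only [Finset.mem_insert, Finset.mem_singleton, AxK.mem_ini, Fin.ext_iff]
    omega
  -- the initial step
  have h1 : (Fintype.card K : ℤ) ^ 3 ∣ (Xcount G K : ℤ)
      + (Fintype.card K : ℤ) ^ 2 * (restrictedCount (D 5) 5 K : ℤ) := by
    have := AxK.five_step (AxK.inc G ε src tgt v₀ K) (i := i) (j := j) (k := k) (l := l) (m := m)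
      (by rw [Ne, Fin.ext_iff]; omega) (by rw [Ne, Fin.ext_iff]; omega) (by rw [Ne, Fin.ext_iff]; omega)
      (by rw [Ne, Fin.ext_iff]; omega) (by rw [Ne, Fin.ext_iff]; omega) (by rw [Ne, Fin.ext_iff]; omega)
      (by rw [Ne, Fin.ext_iff]; omega) (by rw [Ne, Fin.ext_iff]; omega) (by rw [Ne, Fin.ext_iff]; omega)
      (by rw [Ne, Fin.ext_iff]; omega) (by omega) (by rw [Fintype.card_fin]; omega)
      (by rw [Fintype.card_fin]; omega)
    rw [← AxK.Xcount_eq G ε src tgt v₀ ho, hF] at this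
    rw [AxK.restricted_eq]
    convert this using 3
    refine AxK.cnt_congr fun x hx => ?_
    have hxm : (MvPolynomial.aeval x : MvPolynomial (Fin N) ℤ →ₐ[ℤ] K).toRingHom (MvPolynomial.X m) = 0 := by
      simpa using hx m (by rw [AxK.mem_ini]; omega)
    obtain ⟨u, hu⟩ := AxK.five_link G ε src tgt v₀ h5
      (MvPolynomial.aeval x : MvPolynomial (Fin N) ℤ →ₐ[ℤ] K).toRingHom vi vj vk vl vm hxm
    have hu2 := hu _ rfl
    have hX : (fun e => (MvPolynomial.aeval x : MvPolynomial (Fin N) ℤ →ₐ[ℤ] K).toRingHom (MvPolynomial.X e)) = x := by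
      funext e; simp
    rw [hX] at hu2
    have hunit : ((u : ℤ) : K) ≠ 0 := by
      rcases Int.units_eq_one_or u with h | h <;> rw [h] <;> simp
    have h3 : MvPolynomial.aeval x (D 5) = 0 ↔
        (MvPolynomial.aeval x : MvPolynomial (Fin N) ℤ →ₐ[ℤ] K).toRingHom (fiveInv G ε src tgt v₀ i j k l m) = 0 := by
      rcases hD5 with h | h <;> rw [h]
      · rfl
      · rw [map_neg, neg_eq_zero]; rfl
    rw [h3, hu2, mul_eq_zero]
    simp only [hunit, false_or]
  -- induction
  have hind : ∀ r, 5 + r ≤ n → (D (5 + r)).totalDegree ≤ N - (5 + r) ∧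
      (Fintype.card K : ℤ) ∣ (restrictedCount (D 5) 5 K : ℤ)
        - (-1) ^ r * (restrictedCount (D (5 + r)) (5 + r) K : ℤ) := by
    intro r
    induction r with
    | zero => intro _; simpa using hdeg5
    | succ r ih =>
      intro hr
      obtain ⟨d1, d2⟩ := ih (by omega)
      obtain ⟨hk', a, b, c, d, ha, hb, hc, hd, hP, hQ⟩ := hstep (5 + r) (by omega) (by omega)
      obtain ⟨e1, e2⟩ := AxK.red_step (K := K) hk' (by omega) ha hb hc hd hP hQ d1
      refine ⟨e1, ?_⟩
      obtain ⟨z, hz⟩ := d2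
      obtain ⟨y, hy⟩ := e2
      refine ⟨z + (-1) ^ r * y, ?_⟩
      rw [← add_assoc]
      linear_combination hz + (-1) ^ r * hy
  obtain ⟨r, rfl⟩ := Nat.exists_eq_add_of_le h5n
  obtain ⟨z, hz⟩ := (hind r le_rfl).2
  obtain ⟨y, hy⟩ := h1
  apply Int.ModEq.symm
  rw [Int.modEq_iff_dvd]
  refine ⟨y - z, ?_⟩
  rw [pow_add]
  linear_combination hy - (Fintype.card K : ℤ) ^ 2 * hz
end

section
/- Let G be a connected finite simple graph, let i, j, k, l, m be five distinct edges of G, and let σ be any permutation of {i, j, k, l, m}. Then det [[Ψ^{σ(i)σ(j),σ(k)σ(l)}_{G,σ(m)}, Ψ^{σ(i)σ(k),σ(j)σ(l)}_{G,σ(m)}], [Ψ^{σ(i)σ(j)σ(m),σ(k)σ(l)σ(m)}_{G}, Ψ^{σ(i)σ(k)σ(m),σ(j)σ(l)σ(m)}_{G}]] equals ± det [[Ψ^{ij,kl}_{G,m}, Ψ^{ik,jl}_{G,m}], [Ψ^{ijm,klm}_{G}, Ψ^{ikm,jlm}_{G}]]; that is, the five-invariant ⁵Ψ_G(i,j,k,l,m)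 is well-defined up to sign under permutation of the five edges. -/
open scoped Classical
open Matrix

theorem aux_det_rows {ι κ R : Type*} [CommRing R] [Fintype ι] [DecidableEq ι] [Fintype κ]
    [DecidableEq κ] (X : Matrix ι ι R) (r : κ → ι) (hr : Function.Injective r)
    (h : ∀ i, i ∉ Set.range r → ∀ j, X i j = if i = j then 1 else 0) :
    X.det = (X.submatrix r r).det := by
  rw [Matrix.twoBlockTriangular_det X (fun i => i ∈ Set.range r)]
  · have h1 : (X.toSquareBlockProp fun i => ¬ (i ∈ Set.range r)) = 1 := by
      ext i j
      rw [Matrix.toSquareBlockProp_def, Matrix.of_apply, h i.1 i.2 j.1, Matrix.one_apply]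
      simp [Subtype.ext_iff]
    rw [h1, Matrix.det_one, mul_one]
    let E : κ ≃ {i // i ∈ Set.range r} := Equiv.ofInjective r hr
    have h5 := Matrix.det_submatrix_equiv_self E (X.toSquareBlockProp fun i => i ∈ Set.range r)
    have h6 : (X.toSquareBlockProp fun i => i ∈ Set.range r).submatrix E E = X.submatrix r r := rfl
    rw [h6] at h5
    rw [h5]
    congr!
  · intro i hi j hj
    rw [h i hi j, if_neg]
    rintro rfl
    exact hi hj

theorem aux_laplace {R W' : Type*} [CommRing R] [Fintype W'] [DecidableEq W'] {n : ℕ}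
    (A : Matrix (Fin (n+1) ⊕ W') (Fin (n+1) ⊕ W') R) (p q : Fin (n+1))
    (h : ∀ c, A (Sum.inl p) c = if c = Sum.inl q then 1 else 0) :
    A.det = (-1) ^ ((p : ℕ) + q) *
      (A.submatrix (Sum.map p.succAbove id) (Sum.map q.succAbove id)).det := by
  let P : Equiv.Perm (Fin (n+1) ⊕ W') := Equiv.sumCongr p.cycleRange.symm (1 : Equiv.Perm W')
  let Q : Equiv.Perm (Fin (n+1) ⊕ W') := Equiv.sumCongr q.cycleRange.symm (1 : Equiv.Perm W')
  have hP : Equiv.Perm.sign P = (-1) ^ (p : ℕ) := by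
    have := Equiv.Perm.sign_sumCongr (p.cycleRange.symm) (1 : Equiv.Perm W')
    simpa [P] using this
  have hQ : Equiv.Perm.sign Q = (-1) ^ (q : ℕ) := by
    have := Equiv.Perm.sign_sumCongr (q.cycleRange.symm) (1 : Equiv.Perm W')
    simpa [Q] using this
  have h1 : (A.submatrix P Q).det = (-1) ^ ((p : ℕ) + q) * A.det := by
    have : A.submatrix P Q = (A.submatrix P id).submatrix id Q := rfl
    rw [this, Matrix.det_permute', Matrix.det_permute, hP, hQ]
    push_cast
    ring
  have h2 := aux_det_rows (A.submatrix P Q) (Sum.map Fin.succ id : Fin n ⊕ W' → Fin (n+1) ⊕ W')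
    (Sum.map_injective.2 ⟨Fin.succ_injective _, Function.injective_id⟩) (by
      intro i hi j
      have hi0 : i = Sum.inl 0 := by
        rcases i with i | i
        · rcases Fin.eq_zero_or_eq_succ i with rfl | ⟨k, rfl⟩
          · rfl
          · exact absurd ⟨Sum.inl k, rfl⟩ hi
        · exact absurd ⟨Sum.inr i, rfl⟩ hi
      subst hi0
      have : P (Sum.inl 0) = Sum.inl p := by simp [P]
      rw [Matrix.submatrix_apply, this, h]
      have hq : (Sum.inl q : Fin (n+1) ⊕ W') = Q (Sum.inl 0) := by simp [Q]
      rw [hq]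
      simp only [EmbeddingLike.apply_eq_iff_eq, eq_comm])
  have h3 : (A.submatrix P Q).submatrix (Sum.map Fin.succ id : Fin n ⊕ W' → Fin (n+1) ⊕ W')
      (Sum.map Fin.succ id) = A.submatrix (Sum.map p.succAbove id) (Sum.map q.succAbove id) := by
    ext r c
    rcases r with r | r <;> rcases c with c | c <;> simp [P, Q]
  rw [h3] at h2
  rw [← h2, h1, ← mul_assoc, ← pow_add, Even.neg_one_pow ⟨_, rfl⟩, one_mul]

theorem aux_minor {R W' : Type*} [CommRing R] [Fintype W'] [DecidableEq W'] {N n : ℕ}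
    (M : Matrix (Fin N ⊕ W') (Fin N ⊕ W') R) (I J : Finset (Fin N))
    (f g : Fin n → Fin N) (hf : StrictMono f) (hg : StrictMono g)
    (hI : (Iᶜ).card = n) (hJ : (Jᶜ).card = n)
    (hfI : ∀ x, f x ∈ Iᶜ) (hgJ : ∀ x, g x ∈ Jᶜ) :
    minorDet M I J = (M.submatrix (Sum.map f id) (Sum.map g id)).det := by
  subst hI
  rw [minorDet, dif_pos hJ]
  have h1 := Finset.orderEmbOfFin_unique rfl hfI hf
  have h2 := Finset.orderEmbOfFin_unique hJ hgJ hg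
  rw [h1, h2]
  rfl

theorem aux_pos {N n : ℕ} (I : Finset (Fin N)) (f : Fin n → Fin N) (hf : StrictMono f)
    (hI : (Iᶜ).card = n) (hfI : ∀ x, f x ∈ Iᶜ) (p : Fin n) :
    (Iᶜ.filter (· < f p)).card = p := by
  have hr : Finset.univ.image f = Iᶜ := by
    apply Finset.eq_of_subset_of_card_le
    · intro x hx
      obtain ⟨y, -, rfl⟩ := Finset.mem_image.1 hx
      exact hfI y
    · rw [Finset.card_image_of_injective _ hf.injective, hI]; simp
  rw [← hr, Finset.filter_image, Finset.card_image_of_injective _ hf.injective]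
  simp only [hf.lt_iff_lt]
  have : (Finset.univ.filter (· < p)) = Finset.Iio p := by ext; simp
  rw [this, Fin.card_Iio]

theorem aux_step {R W' : Type*} [CommRing R] [Fintype W'] [DecidableEq W'] {N : ℕ}
    (M : Matrix (Fin N ⊕ W') (Fin N ⊕ W') R) (I J : Finset (Fin N)) (hIJ : I.card = J.card)
    (a b : Fin N) (ha : a ∉ I) (hb : b ∉ J) :
    minorDet M (insert a I) (insert b J) =
      (-1) ^ ((Iᶜ.filter (· < a)).card + (Jᶜ.filter (· < b)).card) *
        minorDet (M.updateRow (Sum.inl a) (Pi.single (Sum.inl b) 1)) I J := by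
  have hpos : 0 < (Iᶜ).card := Finset.card_pos.2 ⟨a, by simpa using ha⟩
  obtain ⟨n, hI⟩ : ∃ n, (Iᶜ).card = n + 1 := ⟨_, (Nat.succ_pred_eq_of_pos hpos).symm⟩
  have hJ : (Jᶜ).card = n + 1 := by rw [← hI, Finset.card_compl, Finset.card_compl, hIJ]
  have hfI : ∀ x, Iᶜ.orderEmbOfFin hI x ∈ Iᶜ := fun x => Finset.orderEmbOfFin_mem _ _ _
  have hgJ : ∀ x, Jᶜ.orderEmbOfFin hJ x ∈ Jᶜ := fun x => Finset.orderEmbOfFin_mem _ _ _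
  have hf := (Iᶜ.orderEmbOfFin hI).strictMono
  have hg := (Jᶜ.orderEmbOfFin hJ).strictMono
  obtain ⟨p, hp⟩ : ∃ p, Iᶜ.orderEmbOfFin hI p = a := by
    have : a ∈ Set.range (Iᶜ.orderEmbOfFin hI) := by
      rw [Finset.range_orderEmbOfFin]; simpa using ha
    exact this
  obtain ⟨q, hq⟩ : ∃ q, Jᶜ.orderEmbOfFin hJ q = b := by
    have : b ∈ Set.range (Jᶜ.orderEmbOfFin hJ) := by
      rw [Finset.range_orderEmbOfFin]; simpa using hb
    exact this
  generalize (⇑(Iᶜ.orderEmbOfFin hI)) = f at *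
  generalize (⇑(Jᶜ.orderEmbOfFin hJ)) = g at *
  have h1 := aux_pos I f hf hI hfI p
  have h2 := aux_pos J g hg hJ hgJ q
  rw [hp] at h1
  rw [hq] at h2
  rw [h1, h2, aux_minor _ I J f g hf hg hI hJ hfI hgJ]
  rw [aux_minor M (insert a I) (insert b J) (f ∘ p.succAbove) (g ∘ q.succAbove)
    (hf.comp (Fin.strictMono_succAbove p)) (hg.comp (Fin.strictMono_succAbove q))]
  · rw [aux_laplace _ p q, ← mul_assoc, ← pow_add, Even.neg_one_pow ⟨_, rfl⟩, one_mul]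
    · congr 1
      ext r c
      have hne : ∀ x, f (p.succAbove x) ≠ a := fun x hx =>
        Fin.succAbove_ne p x (hf.injective (hx.trans hp.symm))
      rcases r with r | r <;> rcases c with c | c <;>
        simp [Matrix.updateRow_apply, hne]
    · intro c
      rcases c with c | c
      · simp [hp, ← hq, Pi.single_apply, hg.injective.eq_iff]
      · simp [hp]
  · rw [Finset.card_compl, Finset.card_insert_of_notMem ha]
    rw [Finset.card_compl] at hI; omega
  · rw [Finset.card_compl, Finset.card_insert_of_notMem hb]
    rw [Finset.card_compl] at hJ; omega
  · intro x
    have hne : f (p.succAbove x) ≠ a := fun hx =>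
        Fin.succAbove_ne p x (hf.injective (hx.trans hp.symm))
    have := hfI (p.succAbove x)
    simp_all
  · intro x
    have hne : g (q.succAbove x) ≠ b := fun hx =>
        Fin.succAbove_ne q x (hg.injective (hx.trans hq.symm))
    have := hgJ (q.succAbove x)
    simp_all

theorem aux_empty {R W' : Type*} [CommRing R] [Fintype W'] [DecidableEq W'] {N : ℕ}
    (M : Matrix (Fin N ⊕ W') (Fin N ⊕ W') R) : minorDet M ∅ ∅ = M.det := by
  rw [aux_minor M ∅ ∅ id id strictMono_id strictMono_id (by simp) (by simp) (by simp) (by simp)]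
  simp

/-- determinant with rows `i, j` replaced by basis vectors `k, l` -/
noncomputable def aux_D {R W' : Type*} [CommRing R] [Fintype W'] [DecidableEq W'] {N : ℕ}
    (M : Matrix (Fin N ⊕ W') (Fin N ⊕ W') R) (i j k l : Fin N) : R :=
  ((M.updateRow (Sum.inl i) (Pi.single (Sum.inl k) 1)).updateRow (Sum.inl j)
    (Pi.single (Sum.inl l) 1)).det

theorem aux_two {R W' : Type*} [CommRing R] [Fintype W'] [DecidableEq W'] {N : ℕ}
    (i j k l : Fin N) (hij : i ≠ j) (hkl : k ≠ l) :
    ∃ n : ℕ, ∀ M : Matrix (Fin N ⊕ W') (Fin N ⊕ W') R,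
      minorDet M {i, j} {k, l} = (-1) ^ n * aux_D M i j k l := by
  refine ⟨((({j} : Finset (Fin N))ᶜ.filter (· < i)).card +
    (({l} : Finset (Fin N))ᶜ.filter (· < k)).card) + (((∅ : Finset (Fin N))ᶜ.filter (· < j)).card +
    ((∅ : Finset (Fin N))ᶜ.filter (· < l)).card), fun M => ?_⟩
  rw [aux_step M {j} {l} (by simp) i k (by simpa using hij) (by simpa using hkl)]
  have := aux_step (M.updateRow (Sum.inl i) (Pi.single (Sum.inl k) 1)) ∅ ∅ rfl j l
    (by simp) (by simp)
  rw [LawfulSingleton.insert_empty_eq, LawfulSingleton.insert_empty_eq, aux_empty] at this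
  rw [this, ← mul_assoc, ← pow_add]
  rfl

theorem aux_card {N : ℕ} (I : Finset (Fin N)) (m : Fin N) :
    (I.filter (· < m)).card + (Iᶜ.filter (· < m)).card = (Finset.univ.filter (· < m)).card := by
  rw [← Finset.card_union_of_disjoint, ← Finset.filter_union, Finset.union_compl]
  exact Finset.disjoint_filter_filter disjoint_compl_right

theorem aux_card2 {N : ℕ} (i j m : Fin N) (h : i ≠ j) :
    ((({i, j} : Finset (Fin N))).filter (· < m)).card =
      (if i < m then 1 else 0) + (if j < m then 1 else 0) := by
  rw [Finset.card_filter, Finset.sum_pair h]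

/-- sign -/
noncomputable def aux_t {N : ℕ} (i j k l m : Fin N) : ℕ :=
  ((({i, j} : Finset (Fin N))ᶜ).filter (· < m)).card +
    ((({k, l} : Finset (Fin N))ᶜ).filter (· < m)).card

theorem aux_t_eq {N : ℕ} (i j k l m : Fin N) (hij : i ≠ j) (hkl : k ≠ l) (hik : i ≠ k)
    (hjl : j ≠ l) : aux_t i j k l m = aux_t i k j l m := by
  have h1 := aux_card {i, j} m
  have h2 := aux_card {k, l} m
  have h3 := aux_card {i, k} m
  have h4 := aux_card {j, l} m
  rw [aux_card2 _ _ _ ‹_›] at h1 h2 h3 h4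
  unfold aux_t
  omega

theorem aux_three {R W' : Type*} [CommRing R] [Fintype W'] [DecidableEq W'] {N : ℕ}
    (M : Matrix (Fin N ⊕ W') (Fin N ⊕ W') R)
    (i j k l m : Fin N) (hij : i ≠ j) (hkl : k ≠ l) (him : i ≠ m) (hjm : j ≠ m) (hkm : k ≠ m)
    (hlm : l ≠ m) :
    minorDet M {i, j, m} {k, l, m} = (-1) ^ (aux_t i j k l m) *
      minorDet (M.updateRow (Sum.inl m) (Pi.single (Sum.inl m) 1)) {i, j} {k, l} := by
  have h1 : ({i, j, m} : Finset (Fin N)) = insert m {i, j} := by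
    ext x; simp only [Finset.mem_insert, Finset.mem_singleton]; tauto
  have h2 : ({k, l, m} : Finset (Fin N)) = insert m {k, l} := by
    ext x; simp only [Finset.mem_insert, Finset.mem_singleton]; tauto
  rw [h1, h2, aux_step]
  · rfl
  · rw [Finset.card_pair hij, Finset.card_pair hkl]
  · simp [him.symm, hjm.symm]
  · simp [hkm.symm, hlm.symm]

theorem aux_D_lin {R W' : Type*} [CommRing R] [Fintype W'] [DecidableEq W'] {N : ℕ}
    (M : Matrix (Fin N ⊕ W') (Fin N ⊕ W') R) (c : R)
    (i j k l m : Fin N) (him : i ≠ m) (hjm : j ≠ m) :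
    aux_D (M.updateRow (Sum.inl m) (M (Sum.inl m) + c • Pi.single (Sum.inl m) 1)) i j k l =
      aux_D M i j k l +
        c * aux_D (M.updateRow (Sum.inl m) (Pi.single (Sum.inl m) 1)) i j k l := by
  unfold aux_D
  have key : ∀ u, ((M.updateRow (Sum.inl m) u).updateRow (Sum.inl i)
      (Pi.single (Sum.inl k) 1)).updateRow (Sum.inl j) (Pi.single (Sum.inl l) 1) =
      ((M.updateRow (Sum.inl i)
      (Pi.single (Sum.inl k) 1)).updateRow (Sum.inl j) (Pi.single (Sum.inl l) 1)).updateRow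
        (Sum.inl m) u := by
    intro u
    ext r s
    simp only [Matrix.updateRow_apply]
    split_ifs <;> simp_all
  rw [key, key, Matrix.det_updateRow_add, Matrix.det_updateRow_smul, ← key,
    Matrix.updateRow_eq_self]

/-- the five invariant of a general matrix -/
noncomputable def aux_F {R W' : Type*} [CommRing R] [Fintype W'] [DecidableEq W'] {N : ℕ}
    (M : Matrix (Fin N ⊕ W') (Fin N ⊕ W') R) (v : Fin 5 → Fin N) : R :=
  aux_D M (v 0) (v 1) (v 2) (v 3) *
    aux_D (M.updateRow (Sum.inl (v 4)) (Pi.single (Sum.inl (v 4)) 1)) (v 0) (v 2) (v 1) (v 3)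
  - aux_D M (v 0) (v 2) (v 1) (v 3) *
    aux_D (M.updateRow (Sum.inl (v 4)) (Pi.single (Sum.inl (v 4)) 1)) (v 0) (v 1) (v 2) (v 3)

theorem aux_five {R W' : Type*} [CommRing R] [Fintype W'] [DecidableEq W'] {N : ℕ}
    (M : Matrix (Fin N ⊕ W') (Fin N ⊕ W') R) (c : R)
    (v : Fin 5 → Fin N) (hv : Function.Injective v) :
    ∃ n : ℕ, Matrix.det
    !![minorDet (M.updateRow (Sum.inl (v 4)) (M (Sum.inl (v 4)) +
          c • Pi.single (Sum.inl (v 4)) 1)) {v 0, v 1} {v 2, v 3},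
       minorDet (M.updateRow (Sum.inl (v 4)) (M (Sum.inl (v 4)) +
          c • Pi.single (Sum.inl (v 4)) 1)) {v 0, v 2} {v 1, v 3};
       minorDet M {v 0, v 1, v 4} {v 2, v 3, v 4},
       minorDet M {v 0, v 2, v 4} {v 1, v 3, v 4}] = (-1) ^ n * aux_F M v := by
  have hne : ∀ a b : Fin 5, a ≠ b → v a ≠ v b := fun a b h => hv.ne h
  obtain ⟨n1, h1⟩ := aux_two (R := R) (W' := W') (v 0) (v 1) (v 2) (v 3)
    (hne _ _ (by decide)) (hne _ _ (by decide))
  obtain ⟨n2, h2⟩ := aux_two (R := R) (W' := W') (v 0) (v 2) (v 1) (v 3)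
    (hne _ _ (by decide)) (hne _ _ (by decide))
  refine ⟨n1 + n2 + aux_t (v 0) (v 1) (v 2) (v 3) (v 4), ?_⟩
  rw [Matrix.det_fin_two_of, aux_three M (v 0) (v 1) (v 2) (v 3) (v 4),
    aux_three M (v 0) (v 2) (v 1) (v 3) (v 4), ← aux_t_eq]
  · rw [h1, h2, h1, h2, aux_D_lin, aux_D_lin, aux_F]
    · ring
    all_goals exact hne _ _ (by decide)
  all_goals exact hne _ _ (by decide)

/-- pentad -/
def aux_P {K : Type*} [CommRing K] {N : ℕ} (b : Fin N → Fin N → K) (v : Fin 5 → Fin N) : K :=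
  (b (v 2) (v 0) * b (v 3) (v 1) - b (v 2) (v 1) * b (v 3) (v 0)) *
    Matrix.det !![b (v 1) (v 0), b (v 1) (v 2), b (v 1) (v 4);
      b (v 3) (v 0), b (v 3) (v 2), b (v 3) (v 4);
      b (v 4) (v 0), b (v 4) (v 2), b (v 4) (v 4)] -
  (b (v 1) (v 0) * b (v 3) (v 2) - b (v 1) (v 2) * b (v 3) (v 0)) *
    Matrix.det !![b (v 2) (v 0), b (v 2) (v 1), b (v 2) (v 4);
      b (v 3) (v 0), b (v 3) (v 1), b (v 3) (v 4);
      b (v 4) (v 0), b (v 4) (v 1), b (v 4) (v 4)]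

theorem aux_det3 {K : Type*} [CommRing K] (a b c d e f g h i : K) :
    Matrix.det !![a, b, c; d, e, f; g, h, i] =
      a * e * i - a * f * h - b * d * i + b * f * g + c * d * h - c * e * g := by
  simp [Matrix.det_fin_three]

theorem aux_P_swap {K : Type*} [CommRing K] {N : ℕ} (b : Fin N → Fin N → K)
    (hb : ∀ x y, b x y = b y x) (i : Fin 4) (v : Fin 5 → Fin N) :
    aux_P b (v ∘ Equiv.swap i.castSucc i.succ) = - aux_P b v := by
  have e0 : (v ∘ Equiv.swap (0 : Fin 5) 1) = ![v 1, v 0, v 2, v 3, v 4] := by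
    ext x; fin_cases x <;> rfl
  have e1 : (v ∘ Equiv.swap (1 : Fin 5) 2) = ![v 0, v 2, v 1, v 3, v 4] := by
    ext x; fin_cases x <;> rfl
  have e2 : (v ∘ Equiv.swap (2 : Fin 5) 3) = ![v 0, v 1, v 3, v 2, v 4] := by
    ext x; fin_cases x <;> rfl
  have e3 : (v ∘ Equiv.swap (3 : Fin 5) 4) = ![v 0, v 1, v 2, v 4, v 3] := by
    ext x; fin_cases x <;> rfl
  have key : ∀ p q r s t : Fin N, aux_P b ![p, q, r, s, t] =
     (b r p * b s q - b r q * b s p) *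
    Matrix.det !![b q p, b q r, b q t;
      b s p, b s r, b s t; b t p, b t r, b t t] -
  (b q p * b s r - b q r * b s p) *
    Matrix.det !![b r p, b r q, b r t; b s p, b s q, b s t; b t p, b t q, b t t] := by
    intros; rfl
  have key' : aux_P b v = aux_P b ![v 0, v 1, v 2, v 3, v 4] := rfl
  rw [key']
  generalize v 0 = v0 at *
  generalize v 1 = v1 at *
  generalize v 2 = v2 at *
  generalize v 3 = v3 at *
  generalize v 4 = v4 at *
  have := hb v1 v0
  have := hb v2 v0
  have := hb v3 v0
  have := hb v4 v0
  have := hb v2 v1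
  have := hb v3 v1
  have := hb v4 v1
  have := hb v3 v2
  have := hb v4 v2
  have := hb v4 v3
  fin_cases i
  · refine (congrArg (aux_P b) e0).trans ?_
    simp only [key, aux_det3, *]; ring
  · refine (congrArg (aux_P b) e1).trans ?_
    simp only [key, aux_det3, *]; ring
  · refine (congrArg (aux_P b) e2).trans ?_
    simp only [key, aux_det3, *]; ring
  · refine (congrArg (aux_P b) e3).trans ?_
    simp only [key, aux_det3, *]; ring

theorem aux_P_perm {K : Type*} [CommRing K] {N : ℕ} (b : Fin N → Fin N → K)
    (hb : ∀ x y, b x y = b y x) (σ : Equiv.Perm (Fin 5)) :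
    ∀ (v : Fin 5 → Fin N), aux_P b (v ∘ σ) = aux_P b v ∨ aux_P b (v ∘ σ) = - aux_P b v := by
  have hσ : σ ∈ Submonoid.closure
      (Set.range fun i : Fin 4 => Equiv.swap i.castSucc i.succ) := by
    rw [Equiv.Perm.mclosure_swap_castSucc_succ]; trivial
  induction hσ using Submonoid.closure_induction with
  | mem x hx =>
    obtain ⟨i, rfl⟩ := hx
    exact fun v => Or.inr (aux_P_swap b hb i v)
  | one => exact fun v => Or.inl rfl
  | mul x y _ _ hx hy =>
    intro v
    have : v ∘ ⇑(x * y) = (v ∘ x) ∘ y := rfl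
    rw [this]
    rcases hy (v ∘ x) with h | h <;> rcases hx v with h' | h' <;> rw [h, h'] <;> simp

theorem aux_inv {ι K : Type*} [Field K] [Fintype ι] [DecidableEq ι] {n : ℕ}
    (M M' : Matrix ι ι K) (hM : M.det ≠ 0) (r c : Fin n → ι) (hr : Function.Injective r)
    (h1 : ∀ a, M' (r a) = Pi.single (c a) 1) (h2 : ∀ x, x ∉ Set.range r → M' x = M x) :
    M'.det = M.det * (M⁻¹.submatrix c r).det := by
  have hu : IsUnit M.det := isUnit_iff_ne_zero.2 hM
  have h3 := aux_det_rows (M' * M⁻¹) r hr (by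
    intro i hi j
    rw [← Matrix.one_apply, ← Matrix.mul_nonsing_inv M hu, Matrix.mul_apply, Matrix.mul_apply,
      h2 i hi])
  have h4 : (M' * M⁻¹).submatrix r r = M⁻¹.submatrix c r := by
    ext a b
    rw [Matrix.submatrix_apply, Matrix.mul_apply, h1]
    simp [Pi.single_apply]
  rw [← h4, ← h3, Matrix.det_mul, mul_left_comm, ← Matrix.det_mul, Matrix.mul_nonsing_inv M hu,
    Matrix.det_one, mul_one]

theorem aux_D_inv {K W' : Type*} [Field K] [Fintype W'] [DecidableEq W'] {N : ℕ}
    (M : Matrix (Fin N ⊕ W') (Fin N ⊕ W') K) (hM : M.det ≠ 0) (i j k l : Fin N) (hij : i ≠ j) :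
    aux_D M i j k l = M.det * (M⁻¹ (Sum.inl k) (Sum.inl i) * M⁻¹ (Sum.inl l) (Sum.inl j) -
      M⁻¹ (Sum.inl k) (Sum.inl j) * M⁻¹ (Sum.inl l) (Sum.inl i)) := by
  rw [aux_D, aux_inv M _ hM ![Sum.inl i, Sum.inl j] ![Sum.inl k, Sum.inl l],
    Matrix.det_fin_two]
  · rfl
  · intro a b hab
    fin_cases a <;> fin_cases b <;> simp_all
  · intro a
    ext s
    fin_cases a <;> simp [Matrix.updateRow_apply, hij]
  · intro x hx
    ext s
    have hi : x ≠ Sum.inl i := fun h => hx ⟨0, h.symm⟩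
    have hj : x ≠ Sum.inl j := fun h => hx ⟨1, h.symm⟩
    simp [Matrix.updateRow_apply, hi, hj]

theorem aux_D_inv' {K W' : Type*} [Field K] [Fintype W'] [DecidableEq W'] {N : ℕ}
    (M : Matrix (Fin N ⊕ W') (Fin N ⊕ W') K) (hM : M.det ≠ 0) (i j k l m : Fin N) (hij : i ≠ j)
    (him : i ≠ m) (hjm : j ≠ m) (b : Fin N → Fin N → K)
    (hb : ∀ x y, b x y = M⁻¹ (Sum.inl x) (Sum.inl y)) :
    aux_D (M.updateRow (Sum.inl m) (Pi.single (Sum.inl m) 1)) i j k l =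
      M.det * Matrix.det !![b k i, b k j, b k m; b l i, b l j, b l m; b m i, b m j, b m m] := by
  rw [aux_D, aux_inv M _ hM ![Sum.inl i, Sum.inl j, Sum.inl m] ![Sum.inl k, Sum.inl l, Sum.inl m]]
  · congr 2
    ext x y
    fin_cases x <;> fin_cases y <;> simp [hb]
  · intro a b hab
    fin_cases a <;> fin_cases b <;> simp_all
  · intro a
    ext s
    fin_cases a <;> simp [Matrix.updateRow_apply, hij, him.symm, hjm.symm]
  · intro x hx
    ext s
    have hi : x ≠ Sum.inl i := fun h => hx ⟨0, h.symm⟩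
    have hj : x ≠ Sum.inl j := fun h => hx ⟨1, h.symm⟩
    have hm : x ≠ Sum.inl m := fun h => hx ⟨2, h.symm⟩
    simp [Matrix.updateRow_apply, hi, hj, hm]

/-- sign diagonal -/
def aux_S (R : Type*) [CommRing R] (W' : Type*) (N : ℕ) : Fin N ⊕ W' → R :=
  Sum.elim (fun _ => 1) (fun _ => -1)

theorem aux_F_field {K W' : Type*} [Field K] [Fintype W'] [DecidableEq W'] {N : ℕ}
    (M : Matrix (Fin N ⊕ W') (Fin N ⊕ W') K) (hM : M.det ≠ 0)
    (hs : ∀ x y, M y x = aux_S K W' N x * M x y * aux_S K W' N y)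
    (v : Fin 5 → Fin N) (hv : Function.Injective v) (σ : Equiv.Perm (Fin 5)) :
    aux_F M (v ∘ σ) = aux_F M v ∨ aux_F M (v ∘ σ) = - aux_F M v := by
  let b : Fin N → Fin N → K := fun x y => M⁻¹ (Sum.inl x) (Sum.inl y)
  have hb : ∀ x y, b x y = b y x := by
    let D : Matrix (Fin N ⊕ W') (Fin N ⊕ W') K := Matrix.diagonal (aux_S K W' N)
    have hDD : D * D = 1 := by
      rw [Matrix.diagonal_mul_diagonal, ← Matrix.diagonal_one]
      congr 1
      ext x
      rcases x with x | x <;> simp [aux_S]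
    have hD : D⁻¹ = D := Matrix.inv_eq_right_inv hDD
    have hT : Mᵀ = D * M * D := by
      ext x y
      rw [Matrix.mul_diagonal, Matrix.diagonal_mul, Matrix.transpose_apply]
      exact hs x y
    have h1 : (M⁻¹)ᵀ = D * M⁻¹ * D := by
      rw [Matrix.transpose_nonsing_inv, hT, Matrix.mul_inv_rev, Matrix.mul_inv_rev, hD,
        Matrix.mul_assoc]
    intro x y
    have h2 := congrFun (congrFun h1 (Sum.inl y)) (Sum.inl x)
    rw [Matrix.mul_diagonal, Matrix.diagonal_mul, Matrix.transpose_apply] at h2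
    simpa [aux_S, b] using h2
  have key : ∀ w : Fin 5 → Fin N, Function.Injective w →
      aux_F M w = M.det ^ 2 * aux_P b w := by
    intro w hw
    have hne : ∀ a b : Fin 5, a ≠ b → w a ≠ w b := fun a b h => hw.ne h
    rw [aux_F, aux_D_inv M hM, aux_D_inv M hM, aux_D_inv' M hM _ _ _ _ _ _ _ _ b (fun _ _ => rfl),
      aux_D_inv' M hM _ _ _ _ _ _ _ _ b (fun _ _ => rfl), aux_P]
    · simp only [b]
      ring
    all_goals exact hne _ _ (by decide)
  rw [key _ (hv.comp σ.injective), key _ hv]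
  rcases aux_P_perm b hb σ v with h | h <;> rw [h]
  · exact Or.inl rfl
  · right; ring

theorem aux_D_map {R S W' : Type*} [CommRing R] [CommRing S] [Fintype W'] [DecidableEq W'] {N : ℕ}
    (f : R →+* S) (M : Matrix (Fin N ⊕ W') (Fin N ⊕ W') R) (i j k l : Fin N) :
    aux_D (M.map f) i j k l = f (aux_D M i j k l) := by
  rw [aux_D, aux_D, RingHom.map_det]
  congr 1
  ext x y
  simp only [Matrix.updateRow_apply, RingHom.mapMatrix_apply, Matrix.map_apply, Pi.single_apply]
  split_ifs <;> simp

theorem aux_F_map {R S W' : Type*} [CommRing R] [CommRing S] [Fintype W'] [DecidableEq W'] {N : ℕ}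
    (f : R →+* S) (M : Matrix (Fin N ⊕ W') (Fin N ⊕ W') R) (v : Fin 5 → Fin N) :
    aux_F (M.map f) v = f (aux_F M v) := by
  have : (M.map f).updateRow (Sum.inl (v 4)) (Pi.single (Sum.inl (v 4)) 1) =
      (M.updateRow (Sum.inl (v 4)) (Pi.single (Sum.inl (v 4)) 1)).map f := by
    ext x y
    simp only [Matrix.updateRow_apply, Matrix.map_apply, Pi.single_apply]
    split_ifs <;> simp
  simp only [aux_F, this, aux_D_map, map_sub, map_mul]

theorem aux_F_domain {R W' : Type*} [CommRing R] [IsDomain R] [Fintype W'] [DecidableEq W'] {N : ℕ}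
    (M : Matrix (Fin N ⊕ W') (Fin N ⊕ W') R)
    (hs : ∀ x y, M y x = aux_S R W' N x * M x y * aux_S R W' N y)
    (v : Fin 5 → Fin N) (hv : Function.Injective v) (σ : Equiv.Perm (Fin 5)) :
    aux_F M (v ∘ σ) = aux_F M v ∨ aux_F M (v ∘ σ) = - aux_F M v := by
  let A := Matrix.charmatrix (-M)
  let f := algebraMap (Polynomial R) (FractionRing (Polynomial R))
  have hf : Function.Injective f := IsFractionRing.injective _ _
  have hA : A.det ≠ 0 := (Matrix.charpoly_monic (-M)).ne_zero
  have h1 : (A.map f).det ≠ 0 := by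
    have := RingHom.map_det f A
    rw [RingHom.mapMatrix_apply] at this
    rw [← this]
    exact fun h => hA (hf (h.trans (map_zero f).symm))
  have hAs : ∀ x y, A y x = aux_S (Polynomial R) W' N x * A x y * aux_S (Polynomial R) W' N y := by
    intro x y
    by_cases hxy : x = y
    · subst hxy
      rcases x with x | x <;> simp [aux_S]
    · have h := hs x y
      simp only [A]
      rw [Matrix.charmatrix_apply_ne _ _ _ hxy, Matrix.charmatrix_apply_ne _ _ _ (Ne.symm hxy),
        Matrix.neg_apply, Matrix.neg_apply, h]
      rcases x with x | x <;> rcases y with y | y <;> simp [aux_S]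
  have hAs' : ∀ x y, (A.map f) y x = aux_S _ W' N x * (A.map f) x y * aux_S _ W' N y := by
    intro x y
    rw [Matrix.map_apply, Matrix.map_apply, hAs x y]
    rcases x with x | x <;> rcases y with y | y <;> simp [aux_S]
  have h2 := aux_F_field (A.map f) h1 hAs' v hv σ
  rw [aux_F_map, aux_F_map, ← map_neg, hf.eq_iff, hf.eq_iff] at h2
  let g := Polynomial.evalRingHom (0 : R)
  have h3 : A.map g = M := by
    ext x y
    by_cases hxy : x = y
    · subst hxy
      simp [A, g, Matrix.charmatrix_apply_eq]
    · simp [A, g, Matrix.charmatrix_apply_ne _ _ _ hxy]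
  rw [← h3, aux_F_map, aux_F_map, ← map_neg]
  rcases h2 with h | h
  · exact Or.inl (congrArg g h)
  · exact Or.inr (congrArg g h)

theorem aux_fiveInv {V : Type*} [Fintype V] [DecidableEq V] {N : ℕ} (G : SimpleGraph V)
    (ε : Fin N ≃ G.edgeSet) (src tgt : G.edgeSet → V) (v₀ : V)
    (v : Fin 5 → Fin N) (hv : Function.Injective v) :
    ∃ n : ℕ, fiveInv G ε src tgt v₀ (v 0) (v 1) (v 2) (v 3) (v 4) =
      (-1) ^ n * aux_F (MGmatrix G ε src tgt v₀ ∅) v := by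
  obtain ⟨n, hn⟩ := aux_five (MGmatrix G ε src tgt v₀ ∅) (- MvPolynomial.X (v 4)) v hv
  refine ⟨n, ?_⟩
  rw [← hn, fiveInv]
  have : MGmatrix G ε src tgt v₀ {v 4} = (MGmatrix G ε src tgt v₀ ∅).updateRow (Sum.inl (v 4))
      (MGmatrix G ε src tgt v₀ ∅ (Sum.inl (v 4)) +
        (- MvPolynomial.X (v 4)) • Pi.single (Sum.inl (v 4)) 1) := by
    ext1 x y
    rw [Matrix.updateRow_apply]
    split_ifs with h
    · subst h
      rcases y with y | y
      · by_cases hy : y = v 4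
        · subst hy; simp [MGmatrix]
        · simp [MGmatrix, Matrix.diagonal_apply_ne _ (Ne.symm hy), Pi.single_apply, hy]
      · simp [MGmatrix]
    · rcases x with x | x <;> rcases y with y | y
      · have hx : x ≠ v 4 := fun h' => h (by rw [h'])
        simp [MGmatrix, Matrix.diagonal_apply, hx]
      all_goals simp [MGmatrix]
  simp only [dodgson, this]

theorem stmt12 {V : Type*} [Fintype V] [DecidableEq V] {N : ℕ} (G : SimpleGraph V)
    (hG : G.Connected) (ε : Fin N ≃ G.edgeSet)
    (src tgt : G.edgeSet → V) (ho : IsOrientation G src tgt) (v₀ : V)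
    (e : Fin 5 → Fin N) (he : Function.Injective e) (σ : Equiv.Perm (Fin 5)) :
    fiveInv G ε src tgt v₀ (e (σ 0)) (e (σ 1)) (e (σ 2)) (e (σ 3)) (e (σ 4)) =
      fiveInv G ε src tgt v₀ (e 0) (e 1) (e 2) (e 3) (e 4) ∨
    fiveInv G ε src tgt v₀ (e (σ 0)) (e (σ 1)) (e (σ 2)) (e (σ 3)) (e (σ 4)) =
      - fiveInv G ε src tgt v₀ (e 0) (e 1) (e 2) (e 3) (e 4) := by
  have hs : ∀ x y, MGmatrix G ε src tgt v₀ ∅ y x = aux_S _ _ N x *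
      MGmatrix G ε src tgt v₀ ∅ x y * aux_S _ _ N y := by
    intro x y
    rcases x with x | x <;> rcases y with y | y
    · by_cases h : x = y
      · subst h; simp [MGmatrix, aux_S]
      · simp [MGmatrix, aux_S, Matrix.diagonal_apply_ne _ h, Matrix.diagonal_apply_ne _ (Ne.symm h)]
    all_goals
      simp [MGmatrix, aux_S]
      try (split_ifs <;> simp_all)
  have h := aux_F_domain (MGmatrix G ε src tgt v₀ ∅) hs e he σ
  obtain ⟨n, hn⟩ := aux_fiveInv G ε src tgt v₀ e he
  obtain ⟨n', hn'⟩ := aux_fiveInv G ε src tgt v₀ (e ∘ σ) (he.comp σ.injective)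
  simp only [Function.comp_apply] at hn'
  rw [hn, hn']
  rcases neg_one_pow_eq_or (MvPolynomial (Fin N) ℤ) n with h1 | h1 <;>
  rcases neg_one_pow_eq_or (MvPolynomial (Fin N) ℤ) n' with h2 | h2 <;>
  rcases h with h | h <;> rw [h1, h2, h] <;> simp
end
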